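/- Let ℓ ∈ {5, 6} and let a be a fixed real number with 0.440002 ≤ a < 1/2. Then there exist real constants c_0, c_1, c_2, c_3 and c'_0, …, c'_{ℓ−1} such that for every ε > 0 there is a constant C(ε) > 0 with |∑_{n ≤ X} d_{4,ℓ}(n;a) − X·∑_{k=0}^{3} c_k (log X)^k − X^{1−a}·∑_{k=0}^{ℓ−1} c'_k (log X)^k| ≤ C(ε) X^{1/2+ε} for all X ≥ 2. -/

import Mathlib

open Real

/-- `d_k(n)`, the number of ordered ways of writing `n` as a product of `k` positive
integer factors: the `k`-th power of `ArithmeticFunction.zeta` under Dirichlet convolution. -/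
def dk (k : ℕ) (n : ℕ) : ℕ := (ArithmeticFunction.zeta ^ k : ArithmeticFunction ℕ) n

/-- The weighted divisor function `d_{4,ℓ}(n;a) = ∑_{n = n₁n₂} d₄(n₁) d_ℓ(n₂) n₂^{-a}`. -/
noncomputable def dWeighted (ℓ : ℕ) (a : ℝ) (n : ℕ) : ℝ :=
  ∑ p ∈ n.divisorsAntidiagonal, (dk 4 p.1 : ℝ) * (dk ℓ p.2 : ℝ) * (p.2 : ℝ) ^ (-a)

/-- The phase `e^{i x}` of a real number. -/
noncomputable def phase (x : ℝ) : ℂ := Complex.exp (x * Complex.I)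

lemma norm_phase (x : ℝ) : ‖phase x‖ = 1 := Complex.norm_exp_ofReal_mul_I x

lemma phase_add (x y : ℝ) : phase (x + y) = phase x * phase y := by
  simp only [phase, ← Complex.exp_add]
  push_cast
  ring_nf

lemma phase_add_int_mul_two_pi (x : ℝ) (k : ℤ) : phase (x + 2 * π * k) = phase x := by
  rw [phase, phase, Complex.exp_eq_exp_iff_exists_int]
  exact ⟨k, by push_cast; ring⟩

lemma one_sub_phase_mul (x : ℝ) (hx : Real.sin x ≠ 0) :
    (1 - phase (2 * x)) * ((1 / 2 : ℝ) + (Real.cos x / Real.sin x / 2 : ℝ) * Complex.I) = 1 := by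
  have h1 : phase (2 * x) = ((1 - 2 * Real.sin x ^ 2 : ℝ) : ℂ)
      + ((2 * Real.sin x * Real.cos x : ℝ) : ℂ) * Complex.I := by
    have h : Real.cos (2 * x) = 1 - 2 * Real.sin x ^ 2 := by
      rw [Real.cos_two_mul]; nlinarith [Real.sin_sq_add_cos_sq x]
    rw [phase, Complex.exp_mul_I, ← Complex.ofReal_cos, ← Complex.ofReal_sin, h,
      Real.sin_two_mul]
  have h2 := Real.sin_sq_add_cos_sq x
  rw [h1]
  generalize Real.sin x = u at *
  generalize Real.cos x = v at *
  apply Complex.ext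
  · simp only [Complex.mul_re, Complex.sub_re, Complex.add_re, Complex.add_im, Complex.sub_im,
      Complex.mul_im, Complex.one_re, Complex.one_im, Complex.ofReal_re, Complex.ofReal_im,
      Complex.I_re, Complex.I_im]
    field_simp
    linear_combination 2 * u * h2
  · simp only [Complex.mul_re, Complex.sub_re, Complex.add_re, Complex.add_im, Complex.sub_im,
      Complex.mul_im, Complex.one_re, Complex.one_im, Complex.ofReal_re, Complex.ofReal_im,
      Complex.I_re, Complex.I_im]
    field_simp
    ring

lemma cot_antitone_aux {x y : ℝ} (hx : 0 < x) (hxy : x ≤ y) (hy : y < π) :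
    Real.cos y / Real.sin y ≤ Real.cos x / Real.sin x := by
  have h1 : 0 < Real.sin x := Real.sin_pos_of_pos_of_lt_pi hx (by linarith)
  have h2 : 0 < Real.sin y := Real.sin_pos_of_pos_of_lt_pi (by linarith) hy
  rw [div_le_div_iff₀ h2 h1]
  have : 0 ≤ Real.sin (y - x) := Real.sin_nonneg_of_nonneg_of_le_pi (by linarith) (by linarith)
  rw [Real.sin_sub] at this
  linarith

lemma abs_cot_le {x l : ℝ} (hl : 0 < l) (h1 : l ≤ x) (h2 : x ≤ π - l) :
    |Real.cos x / Real.sin x| ≤ π / (2 * l) := by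
  have hs : 2 / π * l ≤ Real.sin x := by
    rcases le_total x (π / 2) with h | h
    · refine le_trans ?_ (Real.mul_le_sin (by linarith) h)
      gcongr
    · rw [← Real.sin_pi_sub]
      refine le_trans ?_ (Real.mul_le_sin (by linarith) (by linarith))
      gcongr
      linarith
  have hpi := Real.pi_pos
  have h0 : 0 < 2 / π * l := by positivity
  rw [abs_div, abs_of_pos (h0.trans_le hs)]
  calc |Real.cos x| / Real.sin x ≤ 1 / (2 / π * l) := by
        gcongr
        exact Real.abs_cos_le_one x
    _ = π / (2 * l) := by field_simp

/-- The **Kusmin–Landau inequality**: an exponential sum whose phase increments are monotone and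
stay at distance at least `l` from the multiples of `2π` is `O(1/l)`. -/
theorem kusmin_landau (θ : ℕ → ℝ) (a b : ℕ) (l : ℝ) (k : ℤ) (hl : 0 < l)
    (hmono : ∀ n, a ≤ n → n + 1 < b → θ (n + 1) - θ n ≤ θ (n + 2) - θ (n + 1))
    (hg : ∀ n, a ≤ n → n < b → 2 * π * k + l ≤ θ (n + 1) - θ n ∧
      θ (n + 1) - θ n ≤ 2 * π * (k + 1) - l) :
    ‖∑ n ∈ Finset.Ico a b, phase (θ n)‖ ≤ 10 / l := by
  rcases le_or_gt b a with hab | hab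
  · rw [Finset.Ico_eq_empty (by omega)]
    simp; positivity
  set x : ℕ → ℝ := fun n => (θ (n + 1) - θ n - 2 * π * k) / 2 with hxdef
  set κ : ℕ → ℝ := fun n => Real.cos (x n) / Real.sin (x n) / 2 with hκ
  set c : ℕ → ℂ := fun n => ((1 / 2 : ℝ) : ℂ) + (κ n : ℂ) * Complex.I with hc
  have hxr : ∀ n, a ≤ n → n < b → l / 2 ≤ x n ∧ x n ≤ π - l / 2 := by
    intro n h1 h2
    obtain ⟨h3, h4⟩ := hg n h1 h2
    simp only [hxdef]
    constructor <;> linarith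
  have hE : ∀ n, a ≤ n → n < b → phase (θ n) + phase (θ (n + 1)) * c n = phase (θ n) * c n := by
    intro n h1 h2
    obtain ⟨h3, h4⟩ := hxr n h1 h2
    have h5 : phase (θ (n + 1)) = phase (θ n) * phase (2 * x n) := by
      rw [← phase_add, ← phase_add_int_mul_two_pi (θ n + 2 * x n) k]
      congr 1
      simp only [hxdef]
      ring
    have h6 := one_sub_phase_mul (x n) (Real.sin_pos_of_pos_of_lt_pi (by linarith) (by linarith)).ne'
    have h7 : (1 - phase (2 * x n)) * c n = 1 := h6
    rw [h5]
    linear_combination (-phase (θ n)) * h7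
  have hκb : ∀ n, a ≤ n → n < b → |κ n| ≤ π / (2 * l) := by
    intro n h1 h2
    obtain ⟨h3, h4⟩ := hxr n h1 h2
    have := abs_cot_le (by linarith) h3 h4
    simp only [hκ]
    rw [abs_div, abs_of_pos (two_pos : (0 : ℝ) < 2)]
    calc _ ≤ π / (2 * (l / 2)) / 2 := by gcongr
      _ = _ := by field_simp
  have hcn : ∀ n, ‖c n‖ ≤ 1 / 2 + |κ n| := by
    intro n
    refine (norm_add_le _ _).trans ?_
    rw [norm_mul, Complex.norm_I, mul_one, Complex.norm_real, Complex.norm_real]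
    simp
  have key : ∀ m, a + 1 + m ≤ b →
      ‖∑ n ∈ Finset.Ico a (a + 1 + m), phase (θ n) + phase (θ (a + 1 + m)) * c (a + m)‖
        ≤ 1 / 2 + |κ a| + κ a - κ (a + m) := by
    intro m
    induction m with
    | zero =>
      intro h
      have := hE a le_rfl (by omega)
      simp only [add_zero, Finset.sum_Ico_succ_top le_rfl, Finset.Ico_self, Finset.sum_empty,
        zero_add, this, norm_mul, norm_phase, one_mul]
      linarith [hcn a]
    | succ m ih =>
      intro h
      have ih := ih (by omega)
      have h1 := hE (a + 1 + m) (by omega) (by omega)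
      have h2 : κ (a + (m + 1)) ≤ κ (a + m) := by
        have e1 := hxr (a + m) (by omega) (by omega)
        have e2 := hxr (a + (m + 1)) (by omega) (by omega)
        have e3 := hmono (a + m) (by omega) (by omega)
        have := cot_antitone_aux (x := x (a + m)) (y := x (a + (m + 1))) (by linarith)
          (by simp only [hxdef]; rw [show a + (m + 1) = a + m + 1 by ring]; linarith) (by linarith)
        simp only [hκ]
        linarith
      rw [show a + 1 + (m + 1) = (a + 1 + m) + 1 by ring, Finset.sum_Ico_succ_top (by omega)]
      rw [show a + (m + 1) = a + 1 + m by ring] at h2 ⊢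
      have : ∑ n ∈ Finset.Ico a (a + 1 + m), phase (θ n) + phase (θ (a + 1 + m)) +
          phase (θ (a + 1 + m + 1)) * c (a + 1 + m) =
          (∑ n ∈ Finset.Ico a (a + 1 + m), phase (θ n) + phase (θ (a + 1 + m)) * c (a + m)) +
          phase (θ (a + 1 + m)) * (((κ (a + 1 + m) - κ (a + m) : ℝ) : ℂ) * Complex.I) := by
        rw [add_assoc, h1]
        simp only [hc]
        push_cast
        ring
      rw [this]
      refine (norm_add_le _ _).trans ?_
      rw [norm_mul, norm_phase, norm_mul, Complex.norm_I, Complex.norm_real, Real.norm_eq_abs,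
        abs_of_nonpos (by linarith)]
      linarith
  have h1 := key (b - a - 1) (by omega)
  rw [show a + 1 + (b - a - 1) = b by omega] at h1
  have e1 := hκb a le_rfl hab
  have e2 := hκb (a + (b - a - 1)) (by omega) (by omega)
  have e3 := hcn (a + (b - a - 1))
  have e4 : ‖∑ n ∈ Finset.Ico a b, phase (θ n)‖ ≤
      ‖∑ n ∈ Finset.Ico a b, phase (θ n) + phase (θ b) * c (a + (b - a - 1))‖
      + ‖c (a + (b - a - 1))‖ := by
    have := norm_sub_le (∑ n ∈ Finset.Ico a b, phase (θ n) + phase (θ b) * c (a + (b - a - 1)))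
      (phase (θ b) * c (a + (b - a - 1)))
    rwa [add_sub_cancel_right, norm_mul, norm_phase, one_mul] at this
  have e5 : l ≤ π := by
    have := hxr a le_rfl hab
    linarith
  have e6 : 1 ≤ π / l := by rw [le_div_iff₀ hl]; linarith
  have e7 : π / (2 * l) = π / l / 2 := by field_simp
  have e8 : 10 / l = π / l * (10 / π) := by field_simp
  have e9 : π / l * 3 ≤ 10 / l := by
    rw [div_mul_eq_mul_div]
    gcongr
    linarith [Real.pi_lt_d2]
  have := abs_le.mp e1
  have := abs_le.mp e2
  linarith [le_abs_self (κ a), neg_abs_le (κ (a + (b - a - 1)))]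

/-- A monotone integer sequence meets each threshold at a single cut. -/
lemma exists_cut (g : ℕ → ℝ) (a b : ℕ) (hab : a ≤ b) (u : ℝ)
    (hmono : ∀ n, a ≤ n → n + 1 < b → g n ≤ g (n + 1)) :
    ∃ c, a ≤ c ∧ c ≤ b ∧ (∀ n, a ≤ n → n < c → g n < u) ∧ (∀ n, c ≤ n → n < b → u ≤ g n) := by
  induction b, hab using Nat.le_induction with
  | base => exact ⟨a, le_rfl, le_rfl, fun n h1 h2 => by omega, fun n h1 h2 => by omega⟩
  | succ b hab ih =>
    obtain ⟨c, h1, h2, h3, h4⟩ := ih (fun n hn hn' => hmono n hn (by omega))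
    rcases lt_or_ge (g b) u with hb | hb
    · refine ⟨b + 1, by omega, le_rfl, fun n hn hn' => ?_, fun n hn hn' => by omega⟩
      rcases Nat.lt_or_ge n c with h | h
      · exact h3 n hn h
      · rcases Nat.lt_or_ge n b with h' | h'
        · exfalso
          have : u ≤ g (b - 1) := h4 (b - 1) (by omega) (by omega)
          have h6 := hmono (b - 1) (by omega) (by omega)
          rw [show b - 1 + 1 = b by omega] at h6
          linarith
        · rwa [show n = b by omega]
    · refine ⟨c, h1, by omega, h3, fun n hn hn' => ?_⟩
      rcases Nat.lt_or_ge n b with h' | h'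
      · exact h4 n hn h'
      · rwa [show n = b by omega]

lemma norm_sum_phase_le_card (θ : ℕ → ℝ) (a b : ℕ) (hab : a ≤ b) :
    ‖∑ n ∈ Finset.Ico a b, phase (θ n)‖ ≤ (b : ℝ) - a := by
  refine (norm_sum_le _ _).trans ?_
  simp [norm_phase, Nat.cast_sub hab]

/-- If increments of `g` are at least `l` and `g` stays in an interval of length `δ`, the index
range is short. -/
lemma length_le_of_increment {g : ℕ → ℝ} {a b : ℕ} {l δ u : ℝ} (hl : 0 < l) (hδ : 0 ≤ δ)
    (hab : a ≤ b) (hinc : ∀ n, a ≤ n → n + 1 < b → l ≤ g (n + 1) - g n)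
    (hlo : ∀ n, a ≤ n → n < b → u ≤ g n) (hhi : ∀ n, a ≤ n → n < b → g n ≤ u + δ) :
    (b : ℝ) - a ≤ δ / l + 1 := by
  rcases hab.eq_or_lt with rfl | h
  · rw [sub_self]; positivity
  have key : ∀ m, a + m < b → g a + l * m ≤ g (a + m) := by
    intro m
    induction m with
    | zero => simp
    | succ m ih =>
      intro hm
      have h1 := ih (by omega)
      have h2 := hinc (a + m) (by omega) (by omega)
      push_cast
      rw [← add_assoc]
      linarith
  have h1 := key (b - a - 1) (by omega)
  have h2 := hhi (a + (b - a - 1)) (by omega) (by omega)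
  have h3 := hlo a le_rfl h
  have h4 : ((b - a - 1 : ℕ) : ℝ) = b - a - 1 := by
    rw [Nat.cast_sub (by omega), Nat.cast_sub (by omega)]; simp
  rw [h4] at h1
  have : (b : ℝ) - a - 1 ≤ δ / l := by
    rw [le_div_iff₀ hl]; linarith
  linarith

lemma norm_sum_phase_one_period (θ : ℕ → ℝ) (a b : ℕ) (l δ : ℝ) (k : ℤ) (hab : a ≤ b)
    (hl : 0 < l) (hδ : 0 < δ)
    (hinc : ∀ n, a ≤ n → n + 1 < b → l ≤ (θ (n + 2) - θ (n + 1)) - (θ (n + 1) - θ n))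
    (hlo : ∀ n, a ≤ n → n < b → 2 * π * k ≤ θ (n + 1) - θ n)
    (hhi : ∀ n, a ≤ n → n < b → θ (n + 1) - θ n < 2 * π * (k + 1)) :
    ‖∑ n ∈ Finset.Ico a b, phase (θ n)‖ ≤ 2 * (δ / l + 1) + 10 / δ := by
  set g : ℕ → ℝ := fun n => θ (n + 1) - θ n with hg
  have hmono : ∀ n, a ≤ n → n + 1 < b → g n ≤ g (n + 1) := by
    intro n h1 h2
    have := hinc n h1 h2
    simp only [hg]
    rw [show n + 1 + 1 = n + 2 by ring]
    linarith
  obtain ⟨c, hc1, hc2, hc3, hc4⟩ := exists_cut g a b hab (2 * π * k + δ) hmono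
  obtain ⟨d, hd1, hd2, hd3, hd4⟩ := exists_cut g c b hc2 (2 * π * (k + 1) - δ)
    (fun n h1 h2 => hmono n (by omega) h2)
  rw [← Finset.sum_Ico_consecutive _ hc1 hc2, ← Finset.sum_Ico_consecutive _ hd1 hd2]
  have b1 : ‖∑ n ∈ Finset.Ico a c, phase (θ n)‖ ≤ δ / l + 1 :=
    (norm_sum_phase_le_card θ a c hc1).trans (length_le_of_increment (g := g) hl hδ.le hc1
      (fun n h1 h2 => hinc n h1 (by omega)) (fun n h1 h2 => hlo n h1 (by omega))
      (fun n h1 h2 => (hc3 n h1 h2).le))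
  have b2 : ‖∑ n ∈ Finset.Ico c d, phase (θ n)‖ ≤ 10 / δ :=
    kusmin_landau θ c d δ k hδ (fun n h1 h2 => hmono n (by omega) (by omega))
      (fun n h1 h2 => ⟨hc4 n h1 (by omega), (hd3 n h1 h2).le⟩)
  have b3 : ‖∑ n ∈ Finset.Ico d b, phase (θ n)‖ ≤ δ / l + 1 :=
    (norm_sum_phase_le_card θ d b hd2).trans (length_le_of_increment (g := g)
      (u := 2 * π * (k + 1) - δ) hl hδ.le hd2
      (fun n h1 h2 => hinc n (by omega) (by omega)) (fun n h1 h2 => hd4 n h1 (by omega))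
      (fun n h1 h2 => by have := hhi n (by omega) h2; simp only [hg]; linarith))
  have t1 := norm_add_le (∑ n ∈ Finset.Ico a c, phase (θ n))
    (∑ n ∈ Finset.Ico c d, phase (θ n) + ∑ n ∈ Finset.Ico d b, phase (θ n))
  have t2 := norm_add_le (∑ n ∈ Finset.Ico c d, phase (θ n)) (∑ n ∈ Finset.Ico d b, phase (θ n))
  linarith

lemma norm_sum_phase_periods (θ : ℕ → ℝ) (a : ℕ) (l δ : ℝ) (k : ℤ) (hl : 0 < l) (hδ : 0 < δ)
    (m : ℕ) : ∀ b, a ≤ b →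
    (∀ n, a ≤ n → n + 1 < b → l ≤ (θ (n + 2) - θ (n + 1)) - (θ (n + 1) - θ n)) →
    (∀ n, a ≤ n → n < b → 2 * π * k ≤ θ (n + 1) - θ n) →
    (∀ n, a ≤ n → n < b → θ (n + 1) - θ n < 2 * π * (k + m)) →
    ‖∑ n ∈ Finset.Ico a b, phase (θ n)‖ ≤ m * (2 * (δ / l + 1) + 10 / δ) := by
  induction m with
  | zero =>
    intro b hab _ hlo hhi
    rcases hab.eq_or_lt with rfl | h
    · simp
    · have h1 := hlo a le_rfl h
      have h2 := hhi a le_rfl h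
      simp at h2
      linarith
  | succ m ih =>
    intro b hab hinc hlo hhi
    obtain ⟨c, hc1, hc2, hc3, hc4⟩ := exists_cut (fun n => θ (n + 1) - θ n) a b hab
      (2 * π * (k + m)) (fun n h1 h2 => by
        have := hinc n h1 h2
        rw [show n + 1 + 1 = n + 2 by ring]
        linarith)
    rw [← Finset.sum_Ico_consecutive _ hc1 hc2]
    have h1 := ih c hc1 (fun n h1 h2 => hinc n h1 (by omega)) (fun n h1 h2 => hlo n h1 (by omega))
      hc3
    have h2 := norm_sum_phase_one_period θ c b l δ (k + m) hc2 hl hδ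
      (fun n h1 h2 => hinc n (by omega) h2)
      (fun n h1 h2 => by push_cast; exact hc4 n h1 h2)
      (fun n h1 h2 => by
        have := hhi n (by omega) h2
        push_cast at this ⊢
        rwa [add_assoc (k : ℝ)])
    refine (norm_add_le _ _).trans ?_
    push_cast
    linarith

lemma sub_le_of_increment_le {g : ℕ → ℝ} {a : ℕ} {A : ℝ} (m : ℕ) :
    (∀ n, a ≤ n → n < a + m → g (n + 1) - g n ≤ A) → g (a + m) ≤ g a + A * m := by
  induction m with
  | zero => simp
  | succ m ih =>
    intro h
    have h1 := ih (fun n h1 h2 => h n h1 (by omega))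
    have h2 := h (a + m) (by omega) (by omega)
    push_cast
    rw [← add_assoc]
    linarith

/-- The **second derivative test** of van der Corput, in terms of second differences. -/
theorem second_derivative_test (θ : ℕ → ℝ) (a b : ℕ) (l A : ℝ) (hab : a ≤ b) (hl : 0 < l)
    (hA : 1 ≤ A)
    (hinc : ∀ n, a ≤ n → n + 1 < b → l ≤ (θ (n + 2) - θ (n + 1)) - (θ (n + 1) - θ n))
    (hinc' : ∀ n, a ≤ n → n + 1 < b → (θ (n + 2) - θ (n + 1)) - (θ (n + 1) - θ n) ≤ A * l) :
    ‖∑ n ∈ Finset.Ico a b, phase (θ n)‖ ≤ (A * l * ((b : ℝ) - a) + 2) * (14 / √l) := by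
  have hba : (0 : ℝ) ≤ b - a := by simpa using hab
  have hsl : 0 < √l := Real.sqrt_pos.mpr hl
  have hsq : √l * √l = l := Real.mul_self_sqrt hl.le
  rcases le_or_gt l 1 with hl1 | hl1
  swap
  · refine (norm_sum_phase_le_card θ a b hab).trans ?_
    have h1 : 1 ≤ √l := Real.one_le_sqrt.mpr hl1.le
    have : (A * l * ((b : ℝ) - a) + 2) * (14 / √l) = A * 14 * (√l * (b - a)) + 28 / √l := by
      field_simp
      rw [Real.sq_sqrt hl.le]
      ring
    rw [this]
    have h2 : (b : ℝ) - a ≤ √l * (b - a) := le_mul_of_one_le_left hba h1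
    have h3 : 0 < 28 / √l := by positivity
    nlinarith
  rcases hab.eq_or_lt with rfl | hlt
  · simp; positivity
  set g : ℕ → ℝ := fun n => θ (n + 1) - θ n with hg
  have hpi := Real.pi_pos
  set k : ℤ := ⌊g a / (2 * π)⌋ with hk
  have hk1 : 2 * π * k ≤ g a := by
    have := Int.floor_le (g a / (2 * π))
    rw [le_div_iff₀ (by positivity)] at this
    linarith
  have hk2 : g a < 2 * π * (k + 1) := by
    have := Int.lt_floor_add_one (g a / (2 * π))
    rw [div_lt_iff₀ (by positivity)] at this
    linarith
  have hlow : ∀ m, a + m < b → g a ≤ g (a + m) := by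
    intro m
    induction m with
    | zero => simp
    | succ m ih =>
      intro hm
      have h1 := ih (by omega)
      have h2 := hinc (a + m) (by omega) (by omega)
      simp only [hg] at *
      rw [show a + (m + 1) + 1 = a + m + 2 by ring, show a + (m + 1) = a + m + 1 by ring]
      linarith
  have hup : ∀ m, a + m < b → g (a + m) ≤ g a + A * l * m := by
    intro m hm
    exact sub_le_of_increment_le m (fun n h1 h2 => hinc' n h1 (by omega))
  set m : ℕ := ⌊A * l * ((b : ℝ) - a) / (2 * π)⌋₊ + 2 with hm
  have hm1 : A * l * ((b : ℝ) - a) ≤ 2 * π * (m - 1) := by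
    have := Nat.lt_floor_add_one (A * l * ((b : ℝ) - a) / (2 * π))
    rw [div_lt_iff₀ (by positivity)] at this
    rw [hm]
    push_cast
    linarith
  have hm2 : (m : ℝ) ≤ A * l * ((b : ℝ) - a) + 2 := by
    have h1 := Nat.floor_le (a := A * l * ((b : ℝ) - a) / (2 * π)) (by positivity)
    have h2 : A * l * ((b : ℝ) - a) / (2 * π) ≤ A * l * ((b : ℝ) - a) := by
      apply div_le_self (by positivity)
      linarith [Real.pi_gt_three]
    rw [hm]
    push_cast
    linarith
  have hmain := norm_sum_phase_periods θ a l (√l) k hl hsl m b hab hinc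
    (fun n h1 h2 => by
      have := hlow (n - a) (by omega)
      rw [show a + (n - a) = n by omega] at this
      exact hk1.trans this)
    (fun n h1 h2 => by
      have := hup (n - a) (by omega)
      rw [show a + (n - a) = n by omega] at this
      have h3 : ((n - a : ℕ) : ℝ) ≤ (b : ℝ) - a := by
        rw [Nat.cast_sub h1]
        have : (n : ℝ) ≤ b := by exact_mod_cast h2.le
        linarith
      have h4 : A * l * ((n - a : ℕ) : ℝ) ≤ A * l * ((b : ℝ) - a) := by gcongr
      have h5 : g n < 2 * π * (k + m) := by nlinarith
      exact h5)
  refine hmain.trans ?_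
  have hX : 2 * (√l / l + 1) + 10 / √l ≤ 14 / √l := by
    have e1 : √l / l = 1 / √l := by
      rw [div_eq_div_iff hl.ne' hsl.ne']; linarith
    have e2 : 1 ≤ 1 / √l := by
      rw [le_div_iff₀ hsl, one_mul]
      exact Real.sqrt_le_one.mpr hl1
    have e3 : 14 / √l = 14 * (1 / √l) := by ring
    have e4 : 10 / √l = 10 * (1 / √l) := by ring
    rw [e1, e3, e4]
    linarith
  have : 0 ≤ 14 / √l := by positivity
  gcongr

/-- The correlation `∑_n z(n + k) conj z(n)`. -/
noncomputable def correlation (z : ℤ → ℂ) (k : ℤ) : ℂ := ∑' n, z (n + k) * star (z n)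

lemma norm_correlation_neg (z : ℤ → ℂ) (k : ℤ) : ‖correlation z (-k)‖ = ‖correlation z k‖ := by
  have h : star (∑' n, z (n + k) * star (z n)) = ∑' n, star (z (n + k) * star (z n)) := tsum_star
  rw [← norm_star (correlation z k), correlation, correlation, h,
    ← (Equiv.addRight k).tsum_eq]
  congr 2
  ext n
  simp [mul_comm]

lemma sum_norm_correlation_le (r : ℕ → ℝ) (hr : ∀ k, 0 ≤ r k) (H h : ℕ) (hh : h < H) :
    ∑ h' ∈ Finset.range H, r ((h' : ℤ) - h).natAbs ≤ 2 * ∑ k ∈ Finset.range H, r k := by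
  have h1 : ∀ h' ∈ Finset.range H, r ((h' : ℤ) - h).natAbs ≤
      ∑ k ∈ Finset.range H, r k * ((if h' = h + k then 1 else 0) + if h = h' + k then 1 else 0) := by
    intro h' hh'
    rw [Finset.mem_range] at hh'
    have := Finset.single_le_sum (s := Finset.range H) (f := fun k => r k *
      (((if h' = h + k then 1 else 0) + if h = h' + k then 1 else 0 : ℝ)))
      (fun k _ => by have := hr k; positivity) (a := ((h' : ℤ) - h).natAbs)
      (by rw [Finset.mem_range]; omega)
    refine le_trans ?_ this
    have h2 : (1 : ℝ) ≤ (if h' = h + ((h' : ℤ) - h).natAbs then 1 else 0)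
        + if h = h' + ((h' : ℤ) - h).natAbs then 1 else 0 := by
      rcases le_total h h' with h3 | h3
      · rw [if_pos (by omega)]
        split_ifs <;> norm_num
      · rw [if_pos (show h = h' + ((h' : ℤ) - h).natAbs by omega)]
        split_ifs <;> norm_num
    exact le_mul_of_one_le_right (hr _) h2
  refine (Finset.sum_le_sum h1).trans ?_
  rw [Finset.sum_comm, Finset.mul_sum]
  refine Finset.sum_le_sum fun k _ => ?_
  rw [← Finset.mul_sum, Finset.sum_add_distrib, mul_comm]
  have e1 : ∑ h' ∈ Finset.range H, (if h' = h + k then (1 : ℝ) else 0) ≤ 1 := by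
    rw [Finset.sum_ite_eq' (Finset.range H) (h + k)]
    split_ifs <;> norm_num
  have e2 : ∑ h' ∈ Finset.range H, (if h = h' + k then (1 : ℝ) else 0) ≤ 1 := by
    calc _ ≤ ∑ h' ∈ Finset.range H, (if h' = h - k then (1 : ℝ) else 0) := by
          refine Finset.sum_le_sum fun h' _ => ?_
          split_ifs with h1 h2 <;> first | omega | norm_num
      _ ≤ 1 := by
          rw [Finset.sum_ite_eq' (Finset.range H) (h - k)]
          split_ifs <;> norm_num
  exact mul_le_mul_of_nonneg_right (by linarith) (hr k)

/-- The **van der Corput inequality**. -/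
theorem van_der_corput (z : ℤ → ℂ) (a b : ℤ) (hab : a ≤ b) (H : ℕ) (hH : 0 < H)
    (hz : ∀ n, ¬ (a ≤ n ∧ n < b) → z n = 0) :
    (H : ℝ) * ‖∑' n, z n‖ ^ 2 ≤
      ((b : ℝ) - a + H) * (2 * ∑ k ∈ Finset.range H, ‖correlation z k‖) := by
  set J := Finset.Ico a (b + H) with hJ
  have hcardJ : (J.card : ℝ) = (b : ℝ) - a + H := by
    rw [hJ, Int.card_Ico]
    have : (((b + H - a).toNat : ℤ) : ℝ) = ((b + H - a : ℤ) : ℝ) := by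
      rw [Int.toNat_of_nonneg (by omega)]
    rw [← Int.cast_natCast, this]
    push_cast
    ring
  have hsh : ∀ h ∈ Finset.range H, ∀ m ∉ J, z (m - h) = 0 := by
    intro h hh m hm
    rw [Finset.mem_range] at hh
    rw [hJ, Finset.mem_Ico] at hm
    apply hz
    omega
  have hshift : ∀ h ∈ Finset.range H, ∑ m ∈ J, z (m - h) = ∑' n, z n := by
    intro h hh
    rw [← tsum_eq_sum (L := .unconditional ℤ) (hsh h hh), ← (Equiv.subRight (h : ℤ)).tsum_eq z]
    rfl
  set y : ℤ → ℂ := fun m => ∑ h ∈ Finset.range H, z (m - h) with hy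
  have h1 : ∑ m ∈ J, y m = H * ∑' n, z n := by
    simp only [hy]
    rw [Finset.sum_comm, Finset.sum_congr rfl hshift]
    simp
  have h2 : (H : ℝ) ^ 2 * ‖∑' n, z n‖ ^ 2 ≤ ((b : ℝ) - a + H) * ∑ m ∈ J, ‖y m‖ ^ 2 := by
    have e : (H : ℝ) * ‖∑' n, z n‖ = ‖∑ m ∈ J, y m‖ := by
      rw [h1, norm_mul]; simp
    rw [← mul_pow, e, ← hcardJ]
    calc _ ≤ (∑ m ∈ J, ‖y m‖) ^ 2 := by
          gcongr
          exact norm_sum_le _ _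
      _ ≤ _ := sq_sum_le_card_mul_sum_sq
  have h3 : ((∑ m ∈ J, ‖y m‖ ^ 2 : ℝ) : ℂ) =
      ∑ h ∈ Finset.range H, ∑ h' ∈ Finset.range H, correlation z ((h' : ℤ) - h) := by
    have e : ∀ m, ((‖y m‖ ^ 2 : ℝ) : ℂ) = ∑ h ∈ Finset.range H, ∑ h' ∈ Finset.range H,
        z (m - h) * star (z (m - h')) := by
      intro m
      have : ((‖y m‖ ^ 2 : ℝ) : ℂ) = y m * star (y m) := by
        push_cast
        exact (Complex.mul_conj' (y m)).symm
      rw [this, hy, star_sum, Finset.sum_mul_sum]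
    push_cast
    rw [Finset.sum_congr rfl (fun m _ => by rw [← e m]; push_cast; rfl :
      ∀ m ∈ J, ((‖y m‖ : ℂ)) ^ 2 = ∑ h ∈ Finset.range H, ∑ h' ∈ Finset.range H,
        z (m - h) * star (z (m - h'))), Finset.sum_comm]
    refine Finset.sum_congr rfl fun h hh => ?_
    rw [Finset.sum_comm]
    refine Finset.sum_congr rfl fun h' hh' => ?_
    rw [← tsum_eq_sum (L := .unconditional ℤ) (f := fun m => z (m - h) * star (z (m - h')))
      (fun m hm => by rw [hsh h hh m hm, zero_mul]), correlation,
      ← (Equiv.subRight (h' : ℤ)).tsum_eq (fun n => z (n + ((h' : ℤ) - h)) * star (z n))]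
    refine tsum_congr fun m => ?_
    simp
  have h4 : ∑ m ∈ J, ‖y m‖ ^ 2 ≤ H * (2 * ∑ k ∈ Finset.range H, ‖correlation z k‖) := by
    have e : ∑ m ∈ J, ‖y m‖ ^ 2 = ‖((∑ m ∈ J, ‖y m‖ ^ 2 : ℝ) : ℂ)‖ := by
      rw [Complex.norm_real, Real.norm_of_nonneg]
      positivity
    rw [e, h3]
    calc _ ≤ ∑ h ∈ Finset.range H, ∑ h' ∈ Finset.range H, ‖correlation z ((h' : ℤ) - h)‖ :=
          (norm_sum_le _ _).trans (Finset.sum_le_sum fun h _ => norm_sum_le _ _)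
      _ ≤ ∑ h ∈ Finset.range H, (2 * ∑ k ∈ Finset.range H, ‖correlation z k‖) := by
          refine Finset.sum_le_sum fun h hh => ?_
          rw [Finset.mem_range] at hh
          refine le_trans (le_of_eq ?_)
            (sum_norm_correlation_le (fun k => ‖correlation z k‖) (fun _ => norm_nonneg _) H h hh)
          refine Finset.sum_congr rfl fun h' _ => ?_
          rcases Int.natAbs_eq ((h' : ℤ) - h) with h5 | h5
          · rw [← h5]
          · rw [← norm_correlation_neg z (((h' : ℤ) - h).natAbs : ℤ), ← h5]
      _ = _ := by simp
  have hH' : (0 : ℝ) < H := by exact_mod_cast hH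
  have h5 : 0 ≤ (b : ℝ) - a + H := by
    rw [← hcardJ]; positivity
  have h6 := h2.trans (mul_le_mul_of_nonneg_left h4 h5)
  have h7 : (H : ℝ) * (H * ‖∑' n, z n‖ ^ 2) ≤
      H * (((b : ℝ) - a + H) * (2 * ∑ k ∈ Finset.range H, ‖correlation z k‖)) := by
    linarith
  exact le_of_mul_le_mul_left h7 hH'

lemma sum_int_Ico (a b : ℕ) (f : ℤ → ℂ) :
    ∑ n ∈ Finset.Ico (a : ℤ) b, f n = ∑ n ∈ Finset.Ico a b, f n := by
  have h : Finset.Ico (a : ℤ) b = (Finset.Ico a b).map Nat.castEmbedding := by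
    ext n
    simp only [Finset.mem_Ico, Finset.mem_map, Nat.castEmbedding_apply]
    constructor
    · intro h
      exact ⟨n.toNat, by omega, by omega⟩
    · rintro ⟨m, h1, rfl⟩
      omega
  rw [h, Finset.sum_map]
  rfl

/-- The van der Corput inequality for sums of phases. -/
theorem van_der_corput_phase (θ : ℕ → ℝ) (a b : ℕ) (hab : a ≤ b) (H : ℕ) (hH : 0 < H) :
    (H : ℝ) * ‖∑ n ∈ Finset.Ico a b, phase (θ n)‖ ^ 2 ≤
      ((b : ℝ) - a + H) * (2 * ∑ k ∈ Finset.range H,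
        ‖∑ n ∈ Finset.Ico a (b - k), phase (θ (n + k) - θ n)‖) := by
  set z : ℤ → ℂ := fun n => if (a : ℤ) ≤ n ∧ n < b then phase (θ n.toNat) else 0 with hz
  have h := van_der_corput z a b (by exact_mod_cast hab) H hH
    (fun n hn => by simp only [hz]; rw [if_neg hn])
  have e1 : ∑' n, z n = ∑ n ∈ Finset.Ico a b, phase (θ n) := by
    rw [tsum_eq_sum (s := Finset.Ico (a : ℤ) b), sum_int_Ico]
    · refine Finset.sum_congr rfl fun n hn => ?_
      rw [Finset.mem_Ico] at hn
      simp only [hz]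
      rw [if_pos (by omega)]
      simp
    · intro n hn
      rw [Finset.mem_Ico] at hn
      simp only [hz]
      rw [if_neg hn]
  have e2 : ∀ k : ℕ, correlation z k = ∑ n ∈ Finset.Ico a (b - k), phase (θ (n + k) - θ n) := by
    intro k
    rw [correlation, tsum_eq_sum (s := Finset.Ico (a : ℤ) ((b - k : ℕ) : ℤ)), sum_int_Ico]
    · refine Finset.sum_congr rfl fun n hn => ?_
      rw [Finset.mem_Ico] at hn
      simp only [hz]
      rw [if_pos (by omega), if_pos (by omega), sub_eq_add_neg, phase_add]
      congr 1
      rw [Int.toNat_natCast, phase, phase, Complex.star_def, ← Complex.exp_conj]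
      simp
    · intro n hn
      rw [Finset.mem_Ico] at hn
      simp only [hz]
      by_cases h1 : (a : ℤ) ≤ n ∧ n < b
      · rw [if_neg (by omega), zero_mul]
      · rw [if_neg h1, star_zero, mul_zero]
  rw [e1] at h
  simp only [e2] at h
  exact_mod_cast h

lemma phase_neg (x : ℝ) : phase (-x) = star (phase x) := by
  rw [phase, phase, Complex.star_def, ← Complex.exp_conj]
  simp

lemma log_two_point (n : ℝ) (hn : 0 < n) :
    1 / (n + 1) ≤ log (n + 1) - log n ∧ log (n + 1) - log n ≤ 1 / n := by
  rw [← Real.log_div (by positivity) hn.ne']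
  constructor
  · have := Real.one_sub_inv_le_log_of_pos (x := (n + 1) / n) (by positivity)
    refine le_trans (le_of_eq ?_) this
    field_simp
    ring
  · have := Real.log_le_sub_one_of_pos (x := (n + 1) / n) (by positivity)
    refine this.trans (le_of_eq ?_)
    field_simp
    ring

lemma log_second_difference (n : ℝ) (hn : 0 < n) :
    1 / (n + 1) ^ 2 ≤ 2 * log (n + 1) - log n - log (n + 2) ∧
      2 * log (n + 1) - log n - log (n + 2) ≤ 1 / (n * (n + 2)) := by
  have e : 2 * log (n + 1) - log n - log (n + 2) = log ((n + 1) ^ 2 / (n * (n + 2))) := by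
    rw [Real.log_div (by positivity) (by positivity), Real.log_pow,
      Real.log_mul (by positivity) (by positivity)]
    push_cast
    ring
  rw [e]
  constructor
  · have := Real.one_sub_inv_le_log_of_pos (x := (n + 1) ^ 2 / (n * (n + 2))) (by positivity)
    refine le_trans (le_of_eq ?_) this
    field_simp
    ring
  · have := Real.log_le_sub_one_of_pos (x := (n + 1) ^ 2 / (n * (n + 2))) (by positivity)
    refine this.trans (le_of_eq ?_)
    field_simp
    ring

lemma log_shift_second_difference (n h : ℝ) (hn : 0 < n) (hh : 0 < h) :
    h / ((n + 1) ^ 2 * (n + h + 1)) ≤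
      (2 * log (n + 1) - log n - log (n + 2)) -
        (2 * log (n + 1 + h) - log (n + h) - log (n + 2 + h)) ∧
    (2 * log (n + 1) - log n - log (n + 2)) -
        (2 * log (n + 1 + h) - log (n + h) - log (n + 2 + h)) ≤ 2 * h / n ^ 3 := by
  set Q := (n + 1) ^ 2 * ((n + h) * (n + 2 + h)) / ((n * (n + 2)) * (n + 1 + h) ^ 2) with hQ
  have hQ0 : 0 < Q := by positivity
  have e : (2 * log (n + 1) - log n - log (n + 2)) -
        (2 * log (n + 1 + h) - log (n + h) - log (n + 2 + h)) = log Q := by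
    rw [hQ, Real.log_div (by positivity) (by positivity), Real.log_mul (by positivity)
      (by positivity), Real.log_mul (by positivity) (by positivity), Real.log_mul (by positivity)
      (by positivity), Real.log_mul (by positivity) (by positivity), Real.log_pow, Real.log_pow]
    push_cast
    ring
  rw [e]
  constructor
  · have := Real.one_sub_inv_le_log_of_pos hQ0
    refine le_trans ?_ this
    have e2 : 1 - Q⁻¹ = h * (2 * n + 2 + h) / ((n + 1) ^ 2 * ((n + h) * (n + 2 + h))) := by
      rw [hQ]
      field_simp
      ring
    rw [e2, div_le_div_iff₀ (by positivity) (by positivity)]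
    have h1 : (n + h) * (n + 2 + h) ≤ (2 * n + 2 + h) * (n + h + 1) := by nlinarith
    have h2 : 0 ≤ h * (n + 1) ^ 2 := by positivity
    nlinarith [mul_le_mul_of_nonneg_left h1 h2]
  · have := Real.log_le_sub_one_of_pos hQ0
    refine this.trans ?_
    have e2 : Q - 1 = h * (2 * n + 2 + h) / ((n * (n + 2)) * (n + 1 + h) ^ 2) := by
      rw [hQ]
      field_simp
      ring
    rw [e2, div_le_div_iff₀ (by positivity) (by positivity)]
    have h1 : n ^ 3 * (2 * n + 2 + h) ≤ 2 * ((n * (n + 2)) * (n + 1 + h) ^ 2) := by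
      have h2 : n ^ 2 * (2 * n + 2 + h) ≤ 2 * ((n + 2) * (n + 1 + h) ^ 2) := by
        have h3 : n ^ 2 ≤ (n + 2) * (n + 1 + h) := by nlinarith
        have h4 : 2 * n + 2 + h ≤ 2 * (n + 1 + h) := by linarith
        calc _ ≤ ((n + 2) * (n + 1 + h)) * (2 * (n + 1 + h)) := by gcongr
          _ = _ := by ring
      nlinarith [mul_le_mul_of_nonneg_left h2 hn.le]
    nlinarith [mul_le_mul_of_nonneg_left h1 hh.le]

lemma norm_sum_log_phase_le_of_le (N a b : ℕ) (t : ℝ) (hN : 0 < N) (ht : 0 < t) (htN : t ≤ N)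
    (ha : N ≤ a) (hb : b ≤ 2 * N) :
    ‖∑ n ∈ Finset.Ico a b, phase (-(t * log n))‖ ≤ 20 * N / t := by
  have hN' : (0 : ℝ) < N := by exact_mod_cast hN
  have := kusmin_landau (fun n => -(t * log n)) a b (t / (2 * N)) (-1) (by positivity) ?_ ?_
  · refine this.trans (le_of_eq ?_)
    field_simp
    norm_num
  · intro n h1 h2
    have h3 := (log_second_difference n (by exact_mod_cast (by omega : 0 < n))).1
    have h4 : 0 ≤ 2 * log ((n : ℝ) + 1) - log n - log ((n : ℝ) + 2) := le_trans (by positivity) h3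
    push_cast
    nlinarith [mul_nonneg ht.le h4]
  · intro n h1 h2
    obtain ⟨h3, h4⟩ := log_two_point n (by exact_mod_cast (by omega : 0 < n))
    have h5 : 1 / (2 * N : ℝ) ≤ 1 / ((n : ℝ) + 1) := by
      apply one_div_le_one_div_of_le (by positivity)
      exact_mod_cast (by omega : n + 1 ≤ 2 * N)
    have h6 : 1 / (n : ℝ) ≤ 1 / N := by
      apply one_div_le_one_div_of_le (by positivity)
      exact_mod_cast (by omega : N ≤ n)
    have h7 : t / (2 * N) = t * (1 / (2 * N)) := by ring
    have h8 : t * (1 / (N : ℝ)) ≤ 1 := by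
      rw [mul_one_div, div_le_one hN']; exact htN
    have h9 : t / (2 * N) ≤ 1 := by
      rw [div_le_one (by positivity)]; linarith
    have h10 := mul_le_mul_of_nonneg_left (h5.trans h3) ht.le
    have h11 := mul_le_mul_of_nonneg_left (h4.trans h6) ht.le
    push_cast
    constructor
    · nlinarith [Real.pi_gt_three]
    · nlinarith [Real.pi_gt_three]

lemma norm_sum_log_phase_le_sqrt (N a b : ℕ) (t : ℝ) (hN : 0 < N) (htN : N ≤ t)
    (ha : N ≤ a) (hb : b ≤ 2 * N) :
    ‖∑ n ∈ Finset.Ico a b, phase (-(t * log n))‖ ≤ 84 * √t := by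
  have hN' : (0 : ℝ) < N := by exact_mod_cast hN
  have ht : 0 < t := by linarith
  rcases lt_or_ge b a with hab | hab
  · rw [Finset.Ico_eq_empty (by omega)]
    simp
  have hsd := second_derivative_test (fun n => -(t * log n)) a b (t / (2 * N) ^ 2) 4 hab
    (by positivity) (by norm_num) ?_ ?_
  · refine hsd.trans ?_
    have e : √(t / (2 * N) ^ 2) = √t / (2 * N) := by
      rw [Real.sqrt_div ht.le, Real.sqrt_sq (by positivity)]
    have hst : 0 < √t := Real.sqrt_pos.mpr ht
    have hsq : √t * √t = t := Real.mul_self_sqrt ht.le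
    rw [e]
    have hba : (b : ℝ) - a ≤ N := by
      have : (b : ℝ) ≤ a + N := by exact_mod_cast (by omega : b ≤ a + N)
      linarith
    have h1 : 4 * (t / (2 * N) ^ 2) * ((b : ℝ) - a) + 2 ≤ 3 * (t / N) := by
      have h2 : 4 * (t / (2 * N : ℝ) ^ 2) * ((b : ℝ) - a) ≤ 4 * (t / (2 * N) ^ 2) * N := by
        gcongr
      have h3 : 4 * (t / (2 * N : ℝ) ^ 2) * N = t / N := by
        field_simp
        norm_num
      have h4 : 1 ≤ t / N := by rwa [le_div_iff₀ hN', one_mul]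
      linarith
    calc _ ≤ 3 * (t / N) * (14 / (√t / (2 * N))) := by gcongr
      _ = 84 * (t / √t) := by
        field_simp
        norm_num
      _ = 84 * √t := by
        congr 1
        rw [div_eq_iff hst.ne', hsq]
  · intro n h1 h2
    have h3 := (log_second_difference n (by exact_mod_cast (by omega : 0 < n))).1
    have h4 : t / (2 * N : ℝ) ^ 2 ≤ t * (1 / ((n : ℝ) + 1) ^ 2) := by
      rw [mul_one_div]
      gcongr
      exact_mod_cast (by omega : n + 1 ≤ 2 * N)
    have h5 := mul_le_mul_of_nonneg_left h3 ht.le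
    push_cast
    nlinarith
  · intro n h1 h2
    have h3 := (log_second_difference n (by exact_mod_cast (by omega : 0 < n))).2
    have h4 : t * (1 / ((n : ℝ) * (n + 2))) ≤ 4 * (t / (2 * N : ℝ) ^ 2) := by
      have hn : (N : ℝ) ≤ n := by exact_mod_cast (by omega : N ≤ n)
      have : 4 * (t / (2 * N : ℝ) ^ 2) = t / (N * N) := by
        field_simp
        norm_num
      rw [mul_one_div, this]
      gcongr
      linarith
    have h5 := mul_le_mul_of_nonneg_left h3 ht.le
    push_cast
    nlinarith

lemma norm_sum_log_shift_phase_le (N a b h : ℕ) (t : ℝ) (hN : 0 < N) (hh : 0 < h) (ht : 0 < t)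
    (ha : N ≤ a) (hb : b ≤ 2 * N) :
    ‖∑ n ∈ Finset.Ico a (b - h), phase (-(t * log (n + h : ℕ)) - -(t * log n))‖ ≤
      80 * (√t / √N * √h + √N ^ 3 / √t * (1 / √h)) := by
  have hN' : (0 : ℝ) < N := by exact_mod_cast hN
  have hh' : (0 : ℝ) < h := by exact_mod_cast hh
  rcases lt_or_ge (b - h) a with hab | hab
  · rw [Finset.Ico_eq_empty (by omega)]
    simp; positivity
  have hst : 0 < √t := Real.sqrt_pos.mpr ht
  have hsq : √t ^ 2 = t := Real.sq_sqrt ht.le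
  have hsN : 0 < √(N : ℝ) := Real.sqrt_pos.mpr hN'
  have hsqN : √(N : ℝ) ^ 2 = N := Real.sq_sqrt hN'.le
  have hsh : 0 < √(h : ℝ) := Real.sqrt_pos.mpr hh'
  have hsqh : √(h : ℝ) ^ 2 = h := Real.sq_sqrt hh'.le
  have hconj : ∀ n : ℕ, phase (-(t * log (n + h : ℕ)) - -(t * log n)) =
      star (phase (t * log (n + h : ℕ) - t * log n)) := by
    intro n
    rw [← phase_neg]
    congr 1
    ring
  rw [Finset.sum_congr rfl fun n _ => hconj n, ← star_sum, norm_star]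
  have hb' : b - h ≤ b := Nat.sub_le b h
  have hsd := second_derivative_test (fun n => t * log (n + h : ℕ) - t * log n) a (b - h)
    (t * h / (2 * N) ^ 3) 16 hab (by positivity) (by norm_num) ?_ ?_
  · refine hsd.trans ?_
    have e : √(t * h / (2 * N) ^ 3) = √t * √h / (√2 ^ 3 * √N ^ 3) := by
      rw [Real.sqrt_div (by positivity), Real.sqrt_mul ht.le, ← Real.sqrt_mul_self
        (show 0 ≤ √2 ^ 3 * √(N : ℝ) ^ 3 by positivity)]
      congr 2
      have h2 : √(2 : ℝ) ^ 2 = 2 := Real.sq_sqrt (by norm_num)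
      rw [show √2 ^ 3 * √(N : ℝ) ^ 3 * (√2 ^ 3 * √(N : ℝ) ^ 3)
        = (√2 ^ 2) ^ 3 * (√(N : ℝ) ^ 2) ^ 3 by ring, h2, hsqN]
      ring
    rw [e]
    have hba : ((b - h : ℕ) : ℝ) - a ≤ N := by
      have : ((b - h : ℕ) : ℝ) ≤ a + N := by exact_mod_cast (by omega : b - h ≤ a + N)
      linarith
    have h1 : 16 * (t * h / (2 * N) ^ 3) * (((b - h : ℕ) : ℝ) - a) + 2 ≤
        2 * (t * h / N ^ 2 + 1) := by
      have h2 : 16 * (t * h / (2 * N : ℝ) ^ 3) * (((b - h : ℕ) : ℝ) - a) ≤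
          16 * (t * h / (2 * N) ^ 3) * N := by
        gcongr
      have h3 : 16 * (t * h / (2 * N : ℝ) ^ 3) * N = 2 * (t * h / N ^ 2) := by
        field_simp
        norm_num
      linarith
    have h23 : 28 * √(2 : ℝ) ^ 3 ≤ 80 := by
      have h2 : √(2 : ℝ) ≤ 1.42 := by
        rw [Real.sqrt_le_left (by norm_num)]
        norm_num
      have h3 : √(2 : ℝ) ^ 3 = 2 * √2 := by
        rw [pow_succ, Real.sq_sqrt (by norm_num)]
      rw [h3]
      linarith
    calc _ ≤ 2 * (t * h / N ^ 2 + 1) * (14 / (√t * √h / (√2 ^ 3 * √N ^ 3))) := by gcongr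
      _ = 28 * √2 ^ 3 * ((t * h / N ^ 2 + 1) * (√N ^ 3 / (√t * √h))) := by
        field_simp
        norm_num
      _ ≤ 80 * ((t * h / N ^ 2 + 1) * (√N ^ 3 / (√t * √h))) := by gcongr
      _ = _ := by
        rw [← hsq, ← hsqh, ← hsqN]
        simp only [Real.sqrt_sq hst.le, Real.sqrt_sq hsh.le, Real.sqrt_sq hsN.le]
        field_simp
  · intro n h1 h2
    have hn : (0 : ℝ) < n := by exact_mod_cast (by omega : 0 < n)
    have h3 := (log_shift_second_difference n h hn hh').1
    have h4 : t * h / (2 * N : ℝ) ^ 3 ≤ t * (h / (((n : ℝ) + 1) ^ 2 * (n + h + 1))) := by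
      rw [← mul_div_assoc]
      have h5 : (n : ℝ) + 1 ≤ 2 * N := by exact_mod_cast (by omega : n + 1 ≤ 2 * N)
      have h6 : (n : ℝ) + h + 1 ≤ 2 * N := by exact_mod_cast (by omega : n + h + 1 ≤ 2 * N)
      gcongr
      calc _ ≤ (2 * N : ℝ) ^ 2 * (2 * N) := by gcongr
        _ = _ := by ring
    have h5 := mul_le_mul_of_nonneg_left h3 ht.le
    push_cast
    nlinarith
  · intro n h1 h2
    have hn : (0 : ℝ) < n := by exact_mod_cast (by omega : 0 < n)
    have h3 := (log_shift_second_difference n h hn hh').2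
    have h4 : t * (2 * h / (n : ℝ) ^ 3) ≤ 16 * (t * h / (2 * N : ℝ) ^ 3) := by
      have hn : (N : ℝ) ≤ n := by exact_mod_cast (by omega : N ≤ n)
      have : 16 * (t * h / (2 * N : ℝ) ^ 3) = t * (2 * h / N ^ 3) := by
        field_simp
        norm_num
      rw [this]
      gcongr
    have h5 := mul_le_mul_of_nonneg_left h3 ht.le
    push_cast
    nlinarith

lemma sum_one_div_sqrt_le (H : ℕ) : ∑ h ∈ Finset.range H, 1 / √(h : ℝ) ≤ 2 * √H := by
  have key : ∀ H : ℕ, ∑ h ∈ Finset.range (H + 1), 1 / √(h : ℝ) ≤ 2 * √H := by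
    intro H
    induction H with
    | zero => simp
    | succ n ih =>
      rw [Finset.sum_range_succ]
      have h1 : 0 < √((n + 1 : ℕ) : ℝ) := Real.sqrt_pos.mpr (by positivity)
      have h2 : √((n + 1 : ℕ) : ℝ) ^ 2 = n + 1 := by rw [Real.sq_sqrt (by positivity)]; simp
      have h3 : √(n : ℝ) ^ 2 = n := Real.sq_sqrt (by positivity)
      have h4 : 1 / √((n + 1 : ℕ) : ℝ) ≤ 2 * √((n + 1 : ℕ) : ℝ) - 2 * √n := by
        rw [div_le_iff₀ h1]
        nlinarith [sq_nonneg (√((n + 1 : ℕ) : ℝ) - √n)]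
      linarith
  rcases H with _ | H
  · simp
  · refine (key H).trans ?_
    gcongr
    exact_mod_cast Nat.le_succ H

/-- The third-derivative estimate for the sums `∑ n^{-it}`. -/
theorem norm_sum_log_phase_le_sixth (N a b : ℕ) (t u : ℝ) (hN : 0 < N) (hu : 0 < u)
    (htu : u ^ 6 = t) (htN : N ≤ t) (ha : N ≤ a) (hb : b ≤ 2 * N) :
    ‖∑ n ∈ Finset.Ico a b, phase (-(t * log n))‖ ≤ 100 * (√N * u) := by
  have hN' : (0 : ℝ) < N := by exact_mod_cast hN
  have ht : 0 < t := by linarith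
  rcases lt_or_ge b a with hab | hab
  · rw [Finset.Ico_eq_empty (by omega)]
    simp; positivity
  set v := √(N : ℝ) with hv
  have hv0 : 0 < v := Real.sqrt_pos.mpr hN'
  have hv2 : v ^ 2 = N := Real.sq_sqrt hN'.le
  have hst : √t = u ^ 3 := by
    rw [← htu, show u ^ 6 = (u ^ 3) ^ 2 by ring, Real.sqrt_sq (by positivity)]
  have hba : (b : ℝ) - a ≤ N := by
    have : (b : ℝ) ≤ a + N := by exact_mod_cast (by omega : b ≤ a + N)
    linarith
  rcases le_or_gt (u ^ 2) v with h1 | h1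
  · refine (norm_sum_log_phase_le_sqrt N a b t hN htN ha hb).trans ?_
    rw [hst]
    nlinarith [mul_le_mul_of_nonneg_right h1 hu.le, mul_pos hv0 hu]
  rcases le_or_gt v u with h2 | h2
  · refine (norm_sum_phase_le_card (fun n => -(t * log n)) a b hab).trans ?_
    nlinarith [mul_le_mul_of_nonneg_left h2 hv0.le, mul_pos hv0 hu]
  have hx : 1 ≤ N / u ^ 2 := by
    rw [le_div_iff₀ (by positivity), ← hv2, one_mul]
    gcongr
  set H := ⌊N / u ^ 2⌋₊ with hH
  have hH1 : 1 ≤ H := (Nat.one_le_floor_iff _).mpr hx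
  have hHu : (H : ℝ) ≤ N / u ^ 2 := Nat.floor_le (by positivity)
  have hHl : N / u ^ 2 < 2 * H := by
    have h3 := Nat.lt_floor_add_one (N / u ^ 2)
    have h4 : (1 : ℝ) ≤ H := by exact_mod_cast hH1
    linarith
  set w := √(H : ℝ) with hw
  have hH' : (0 : ℝ) < H := by exact_mod_cast hH1
  have hw0 : 0 < w := Real.sqrt_pos.mpr hH'
  have hw2 : w ^ 2 = H := Real.sq_sqrt hH'.le
  have hwu : w * u ≤ v := by
    rw [le_div_iff₀ (by positivity), ← hw2, ← hv2] at hHu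
    nlinarith [mul_pos hw0 hu]
  have hwl : v ^ 2 ≤ 2 * (u ^ 2 * w ^ 2) := by
    rw [div_lt_iff₀ (by positivity), ← hw2, ← hv2] at hHl
    linarith
  have hwl' : v ≤ 1.5 * (u * w) := by
    apply le_of_sq_le_sq _ (by positivity)
    nlinarith [mul_pos hw0 hu]
  have hHN : (H : ℝ) ≤ N := by
    rw [← hw2, ← hv2]
    have hu1 : 1 ≤ u := by nlinarith
    have : w ≤ v := by nlinarith
    gcongr
  have hR : ∑ k ∈ Finset.range H, ‖∑ n ∈ Finset.Ico a (b - k),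
      phase (-(t * log (n + k : ℕ)) - -(t * log n))‖ ≤
      N + 80 * (u ^ 3 / v * w ^ 3 + v ^ 3 / u ^ 3 * (2 * w)) := by
    calc _ ≤ ∑ k ∈ Finset.range H, ((if k = 0 then (N : ℝ) else 0) +
          80 * (u ^ 3 / v * w + v ^ 3 / u ^ 3 * (1 / √k))) := by
          refine Finset.sum_le_sum fun k hk => ?_
          rw [Finset.mem_range] at hk
          rcases Nat.eq_zero_or_pos k with rfl | hk0
          · rw [if_pos rfl]
            have h3 := norm_sum_phase_le_card (fun n => -(t * log (n + 0 : ℕ)) - -(t * log n))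
              a (b - 0) (by simpa using hab)
            have h4 : 0 ≤ 80 * (u ^ 3 / v * w + v ^ 3 / u ^ 3 * (1 / √((0 : ℕ) : ℝ))) := by
              positivity
            simp only [Nat.sub_zero] at h3 ⊢
            linarith
          · rw [if_neg (by omega), zero_add]
            refine (norm_sum_log_shift_phase_le N a b k t hN hk0 ht ha hb).trans ?_
            have hkw : √(k : ℝ) ≤ w := Real.sqrt_le_sqrt (by exact_mod_cast hk.le)
            rw [hst]
            gcongr
      _ = (∑ k ∈ Finset.range H, if k = 0 then (N : ℝ) else 0) +
          80 * (u ^ 3 / v * (H * w) + v ^ 3 / u ^ 3 * ∑ k ∈ Finset.range H, 1 / √(k : ℝ)) := by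
          rw [Finset.sum_add_distrib, ← Finset.mul_sum, Finset.sum_add_distrib, ← Finset.mul_sum]
          simp only [Finset.sum_const, Finset.card_range, nsmul_eq_mul, ← Finset.mul_sum]
      _ ≤ _ := by
          rw [Finset.sum_ite_eq', if_pos (Finset.mem_range.mpr hH1), ← hw2,
            show w ^ 2 * w = w ^ 3 by ring]
          have := sum_one_div_sqrt_le H
          gcongr
  have hvdc := van_der_corput_phase (fun n => -(t * log n)) a b hab H hH1
  have h5 : (w * ‖∑ n ∈ Finset.Ico a b, phase (-(t * log n))‖) ^ 2 ≤ (w * (100 * (v * u))) ^ 2 := by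
    have e1 : u ^ 3 / v * w ^ 3 ≤ u ^ 2 * w ^ 2 := by
      rw [div_mul_eq_mul_div, div_le_iff₀ hv0]
      have : 0 ≤ u ^ 2 * w ^ 2 := by positivity
      nlinarith [mul_le_mul_of_nonneg_left hwu this]
    have e2 : v ^ 3 / u ^ 3 * w ≤ 1.5 * (u ^ 2 * w ^ 2) := by
      rw [div_mul_eq_mul_div, div_le_iff₀ (by positivity)]
      have e3 : v ^ 2 ≤ u ^ 4 := by
        calc v ^ 2 ≤ (u ^ 2) ^ 2 := by gcongr
          _ = _ := by ring
      calc v ^ 3 * w = v ^ 2 * v * w := by ring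
        _ ≤ u ^ 4 * (1.5 * (u * w)) * w := by gcongr
        _ = _ := by ring
    calc _ = (H : ℝ) * ‖∑ n ∈ Finset.Ico a b, phase (-(t * log n))‖ ^ 2 := by
          rw [← hw2]; ring
      _ ≤ _ := hvdc
      _ ≤ (N + N) * (2 * (N + 80 * (u ^ 3 / v * w ^ 3 + v ^ 3 / u ^ 3 * (2 * w)))) := by
          gcongr
      _ ≤ (N + N) * (2 * (2 * (u ^ 2 * w ^ 2) + 80 * (u ^ 2 * w ^ 2 + 3 * (u ^ 2 * w ^ 2)))) := by
          have : v ^ 3 / u ^ 3 * (2 * w) ≤ 3 * (u ^ 2 * w ^ 2) := by linarith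
          have : (N : ℝ) ≤ 2 * (u ^ 2 * w ^ 2) := by rw [← hv2]; exact hwl
          gcongr
      _ = 1288 * (v ^ 2 * u ^ 2 * w ^ 2) := by rw [← hv2]; ring
      _ ≤ 10000 * (v ^ 2 * u ^ 2 * w ^ 2) := by gcongr; norm_num
      _ = _ := by ring
  have h6 := le_of_sq_le_sq h5 (by positivity)
  exact le_of_mul_le_mul_left h6 hw0

/-- Abel's inequality for a nonincreasing weight. -/
theorem norm_sum_mul_le_of_antitone (w : ℕ → ℝ) (z : ℕ → ℂ) (a b : ℕ) (M : ℝ) (hab : a ≤ b)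
    (hw : ∀ n, a ≤ n → w (n + 1) ≤ w n) (hw0 : ∀ n, a ≤ n → 0 ≤ w n)
    (hM : ∀ m, a ≤ m → m ≤ b → ‖∑ n ∈ Finset.Ico a m, z n‖ ≤ M) :
    ‖∑ n ∈ Finset.Ico a b, (w n : ℂ) * z n‖ ≤ w a * M := by
  have key : ∀ k, a + k ≤ b → ‖∑ n ∈ Finset.Ico a (a + k), (w n : ℂ) * z n -
      w (a + k) * ∑ n ∈ Finset.Ico a (a + k), z n‖ ≤ (w a - w (a + k)) * M := by
    intro k
    induction k with
    | zero => simp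
    | succ k ih =>
      intro hk
      have h1 := ih (by omega)
      have h2 := hM (a + k + 1) (by omega) (by omega)
      have h3 := hw (a + k) (by omega)
      rw [← add_assoc]
      have e : ∑ n ∈ Finset.Ico a (a + k + 1), (w n : ℂ) * z n -
          w (a + k + 1) * ∑ n ∈ Finset.Ico a (a + k + 1), z n =
          (∑ n ∈ Finset.Ico a (a + k), (w n : ℂ) * z n -
            w (a + k) * ∑ n ∈ Finset.Ico a (a + k), z n) +
          ((w (a + k) - w (a + k + 1) : ℝ) : ℂ) * ∑ n ∈ Finset.Ico a (a + k + 1), z n := by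
        rw [Finset.sum_Ico_succ_top (by omega), Finset.sum_Ico_succ_top (by omega)]
        push_cast
        ring
      rw [e]
      refine (norm_add_le _ _).trans ?_
      rw [norm_mul, Complex.norm_real, Real.norm_of_nonneg (by linarith)]
      have := mul_le_mul_of_nonneg_left h2 (sub_nonneg.mpr h3)
      linarith
  obtain ⟨k, rfl⟩ := Nat.exists_eq_add_of_le hab
  have h1 := key k le_rfl
  have h2 := hM (a + k) (by omega) le_rfl
  have h3 := hw0 (a + k) (by omega)
  calc _ = ‖(∑ n ∈ Finset.Ico a (a + k), (w n : ℂ) * z n -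
        w (a + k) * ∑ n ∈ Finset.Ico a (a + k), z n) +
        w (a + k) * ∑ n ∈ Finset.Ico a (a + k), z n‖ := by rw [sub_add_cancel]
    _ ≤ (w a - w (a + k)) * M + w (a + k) * M := by
        refine (norm_add_le _ _).trans (add_le_add h1 ?_)
        rw [norm_mul, Complex.norm_real, Real.norm_of_nonneg h3]
        gcongr
    _ = _ := by ring

lemma natCast_cpow_eq_phase (n : ℕ) (hn : 0 < n) (σ t : ℝ) :
    (n : ℂ) ^ (-((σ : ℂ) + t * Complex.I)) = (((n : ℝ) ^ (-σ) : ℝ) : ℂ) * phase (-(t * log n)) := by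
  have hn' : (n : ℂ) ≠ 0 := by exact_mod_cast hn.ne'
  have h : (n : ℂ) = ((n : ℝ) : ℂ) := by simp
  rw [Complex.ofReal_cpow (by positivity), ← h, neg_add, Complex.cpow_add _ _ hn', phase,
    Complex.cpow_def_of_ne_zero hn' (-(t * Complex.I))]
  push_cast
  ring_nf

/-- A bound for partial sums of `n^{-it}` transfers to `n^{-σ-it}`. -/
lemma norm_sum_cpow_le (N a b : ℕ) (σ t M : ℝ) (hN : 0 < N) (hσ : 0 ≤ σ) (ha : N ≤ a)
    (hM : ∀ m, m ≤ b → ‖∑ n ∈ Finset.Ico a m, phase (-(t * log n))‖ ≤ M) :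
    ‖∑ n ∈ Finset.Ico a b, (n : ℂ) ^ (-((σ : ℂ) + t * Complex.I))‖ ≤ (N : ℝ) ^ (-σ) * M := by
  have hM0 : 0 ≤ M := (norm_nonneg _).trans (hM 0 (by omega))
  rcases lt_or_ge b a with hab | hab
  · rw [Finset.Ico_eq_empty (by omega)]
    simp; positivity
  have e : ∑ n ∈ Finset.Ico a b, (n : ℂ) ^ (-((σ : ℂ) + t * Complex.I)) =
      ∑ n ∈ Finset.Ico a b, (((n : ℝ) ^ (-σ) : ℝ) : ℂ) * phase (-(t * log n)) := by
    refine Finset.sum_congr rfl fun n hn => ?_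
    rw [Finset.mem_Ico] at hn
    exact natCast_cpow_eq_phase n (by omega) σ t
  have hanti : ∀ m n : ℕ, 0 < m → m ≤ n → (n : ℝ) ^ (-σ) ≤ (m : ℝ) ^ (-σ) := by
    intro m n h1 h2
    exact Real.rpow_le_rpow_of_nonpos (by exact_mod_cast h1) (by exact_mod_cast h2) (by linarith)
  rw [e]
  refine (norm_sum_mul_le_of_antitone (fun n => (n : ℝ) ^ (-σ)) (fun n => phase (-(t * log n)))
    a b M hab (fun n h => hanti n (n + 1) (by omega) (by omega)) (fun n _ => by positivity)
    (fun m _ h => hM m h)).trans ?_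
  exact mul_le_mul_of_nonneg_right (hanti N a hN ha) hM0

/-- `m^{-s} - ∫_m^{m+1} x^{-s} dx`, multiplied by `s - 1`. -/
noncomputable def zetaTerm (s : ℂ) (m : ℕ) : ℂ :=
  (s - 1) * (m : ℂ) ^ (-s) + ((m + 1 : ℕ) : ℂ) ^ (1 - s) - (m : ℂ) ^ (1 - s)

lemma norm_zetaTerm_le (s : ℂ) (m : ℕ) (hm : 0 < m) (hs : 0 ≤ s.re) :
    ‖zetaTerm s m‖ ≤ ‖s - 1‖ * ‖s‖ * (m : ℝ) ^ (-s.re - 1) := by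
  have hm' : (0 : ℝ) < m := by exact_mod_cast hm
  have hd : ∀ (r : ℂ) (x : ℝ), x ∈ Set.Icc (m : ℝ) (m + 1) →
      HasDerivWithinAt (fun y : ℝ => (y : ℂ) ^ r) (r * (x : ℂ) ^ (r - 1))
        (Set.Icc (m : ℝ) (m + 1)) x := by
    intro r x hx
    have hx0 : 0 < x := hm'.trans_le hx.1
    rcases eq_or_ne r 0 with rfl | hr
    · simp only [Complex.cpow_zero, zero_mul]
      exact hasDerivWithinAt_const _ _ _
    · exact (hasDerivAt_ofReal_cpow_const hx0.ne' hr).hasDerivWithinAt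
  have hconv : Convex ℝ (Set.Icc (m : ℝ) (m + 1)) := convex_Icc _ _
  have hmem : (m : ℝ) ∈ Set.Icc (m : ℝ) (m + 1) := ⟨le_rfl, by linarith⟩
  have hmem' : (m : ℝ) + 1 ∈ Set.Icc (m : ℝ) (m + 1) := ⟨by linarith, le_rfl⟩
  have h1 : ∀ x ∈ Set.Icc (m : ℝ) (m + 1), ‖(x : ℂ) ^ (-s) - ((m : ℝ) : ℂ) ^ (-s)‖ ≤
      ‖s‖ * (m : ℝ) ^ (-s.re - 1) := by
    intro x hx
    have := hconv.norm_image_sub_le_of_norm_hasDerivWithin_le (f := fun y : ℝ => (y : ℂ) ^ (-s))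
      (C := ‖s‖ * (m : ℝ) ^ (-s.re - 1)) (fun y hy => hd (-s) y hy) (fun y hy => ?_) hmem hx
    · refine this.trans ?_
      have : ‖x - m‖ ≤ 1 := by
        rw [Real.norm_eq_abs, abs_le]; constructor <;> linarith [hx.1, hx.2]
      exact mul_le_of_le_one_right (by positivity) this
    · have hy0 : 0 < y := hm'.trans_le hy.1
      rw [norm_mul, norm_neg, Complex.norm_cpow_eq_rpow_re_of_pos hy0]
      simp only [Complex.sub_re, Complex.neg_re, Complex.one_re]
      have := Real.rpow_le_rpow_of_nonpos hm' hy.1 (by linarith : -s.re - 1 ≤ 0)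
      gcongr
  have h2 := hconv.norm_image_sub_le_of_norm_hasDerivWithin_le
    (f := fun y : ℝ => (s - 1) * (y * ((m : ℝ) : ℂ) ^ (-s)) + (y : ℂ) ^ (1 - s))
    (f' := fun y : ℝ => (s - 1) * (((m : ℝ) : ℂ) ^ (-s)) + (1 - s) * (y : ℂ) ^ (1 - s - 1))
    (C := ‖s - 1‖ * (‖s‖ * (m : ℝ) ^ (-s.re - 1))) (fun y hy => ?_) (fun y hy => ?_) hmem hmem'
  · have e : zetaTerm s m = ((s - 1) * (((m + 1 : ℝ) : ℂ) * ((m : ℝ) : ℂ) ^ (-s)) +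
        ((m + 1 : ℝ) : ℂ) ^ (1 - s)) - ((s - 1) * (((m : ℝ) : ℂ) * ((m : ℝ) : ℂ) ^ (-s)) +
        ((m : ℝ) : ℂ) ^ (1 - s)) := by
      rw [zetaTerm]
      push_cast
      ring
    rw [e]
    refine h2.trans (le_of_eq ?_)
    simp
    ring
  · refine HasDerivWithinAt.add ?_ (hd _ y hy)
    refine HasDerivWithinAt.const_mul _ ?_
    have := (Complex.ofRealCLM.hasDerivAt (x := y)).mul_const (((m : ℝ) : ℂ) ^ (-s))
    simpa using this.hasDerivWithinAt
  · have e : (s - 1) * (((m : ℝ) : ℂ) ^ (-s)) + (1 - s) * (y : ℂ) ^ (1 - s - 1) =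
        -((s - 1) * ((y : ℂ) ^ (-s) - ((m : ℝ) : ℂ) ^ (-s))) := by
      rw [show 1 - s - 1 = -s by ring]
      ring
    rw [e, norm_neg, norm_mul]
    have := h1 y hy
    gcongr

lemma sum_zetaTerm (s : ℂ) (N M : ℕ) (h : N ≤ M) : ∑ m ∈ Finset.Ico N M, zetaTerm s m =
    (s - 1) * ∑ m ∈ Finset.Ico N M, (m : ℂ) ^ (-s) + (M : ℂ) ^ (1 - s) - (N : ℂ) ^ (1 - s) := by
  obtain ⟨k, rfl⟩ := Nat.exists_eq_add_of_le h
  induction k with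
  | zero => simp
  | succ k ih =>
    rw [← add_assoc, Finset.sum_Ico_succ_top (by omega), Finset.sum_Ico_succ_top (by omega),
      ih (by omega), zetaTerm]
    ring

lemma zetaTerm_zero_sum (s : ℂ) (M : ℕ) (hM : 1 ≤ M) :
    1 + ∑ m ∈ Finset.Ico 1 M, zetaTerm s m =
    (s - 1) * ∑ m ∈ Finset.Ico 1 M, (m : ℂ) ^ (-s) + (M : ℂ) ^ (1 - s) := by
  rw [sum_zetaTerm s 1 M hM]
  simp

lemma hasSum_zetaTerm {s : ℂ} (hs : 1 / 4 < s.re) :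
    HasSum (fun m : ℕ => zetaTerm s (m + 1)) (riemannZeta₁ s - 1) := by
  have hsumm : ∀ s : ℂ, 1 / 4 < s.re → Summable (fun m : ℕ => zetaTerm s (m + 1)) := by
    intro s hs
    have h1 : Summable (fun m : ℕ => ‖s - 1‖ * ‖s‖ * ((m + 1 : ℕ) : ℝ) ^ (-s.re - 1)) := by
      apply Summable.mul_left
      exact (summable_nat_add_iff 1).mpr (Real.summable_nat_rpow.mpr (by linarith))
    exact Summable.of_norm_bounded h1
      (fun m => norm_zetaTerm_le s (m + 1) (by omega) (by linarith))
  set U : Set ℂ := {s | 1 / 4 < s.re} with hU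
  have hUo : IsOpen U := isOpen_lt continuous_const Complex.continuous_re
  have hUc : IsPreconnected U := (convex_halfSpace_re_gt (1 / 4)).isPreconnected
  have hterm : ∀ m : ℕ, Differentiable ℂ (fun s => zetaTerm s (m + 1)) := by
    intro m
    have h1 : ((m + 1 : ℕ) : ℂ) ≠ 0 := by exact_mod_cast (by omega : m + 1 ≠ 0)
    have h2 : ((m + 1 + 1 : ℕ) : ℂ) ≠ 0 := by exact_mod_cast (by omega : m + 1 + 1 ≠ 0)
    unfold zetaTerm
    intro s
    have d1 : DifferentiableAt ℂ (fun s => ((m + 1 : ℕ) : ℂ) ^ (-s)) s :=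
      differentiableAt_id.neg.const_cpow (Or.inl h1)
    have d2 : DifferentiableAt ℂ (fun s => ((m + 1 : ℕ) : ℂ) ^ (1 - s)) s :=
      ((differentiableAt_const _).sub differentiableAt_id).const_cpow (Or.inl h1)
    have d3 : DifferentiableAt ℂ (fun s => ((m + 1 + 1 : ℕ) : ℂ) ^ (1 - s)) s :=
      ((differentiableAt_const _).sub differentiableAt_id).const_cpow (Or.inl h2)
    exact (((differentiableAt_id.sub (differentiableAt_const _)).mul d1).add d3).sub d2
  have hdiff : DifferentiableOn ℂ (fun s => 1 + ∑' m : ℕ, zetaTerm s (m + 1)) U := by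
    intro s0 hs0
    set V : Set ℂ := U ∩ Metric.ball 0 (‖s0‖ + 1) with hV
    have hVo : IsOpen V := hUo.inter Metric.isOpen_ball
    have hs0V : s0 ∈ V := ⟨hs0, by simp⟩
    have : DifferentiableOn ℂ (fun s => ∑' m : ℕ, zetaTerm s (m + 1)) V := by
      refine Complex.differentiableOn_tsum_of_summable_norm
        (u := fun m => (‖s0‖ + 2) * (‖s0‖ + 1) * ((m + 1 : ℕ) : ℝ) ^ (-(5 / 4) : ℝ))
        ?_ (fun m => (hterm m).differentiableOn) hVo ?_
      · apply Summable.mul_left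
        exact (summable_nat_add_iff 1).mpr (Real.summable_nat_rpow.mpr (by norm_num))
      · intro m s hs
        have h1 : 1 / 4 < s.re := hs.1
        have h2 : ‖s‖ ≤ ‖s0‖ + 1 := by
          have := hs.2
          rw [mem_ball_zero_iff] at this
          exact this.le
        refine (norm_zetaTerm_le s (m + 1) (by omega) (by linarith)).trans ?_
        have h3 : ‖s - 1‖ ≤ ‖s0‖ + 2 := by
          refine (norm_sub_le _ _).trans ?_
          rw [norm_one]
          linarith
        have h4 : (1 : ℝ) ≤ ((m + 1 : ℕ) : ℝ) := by exact_mod_cast (by omega : 1 ≤ m + 1)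
        have h5 : -s.re - 1 ≤ -(5 / 4) := by linarith
        gcongr
    exact (((differentiableOn_const _).add this).differentiableAt
      (hVo.mem_nhds hs0V)).differentiableWithinAt
  have heq : Set.EqOn riemannZeta₁ (fun s => 1 + ∑' m : ℕ, zetaTerm s (m + 1)) U := by
    refine AnalyticOnNhd.eqOn_of_preconnected_of_eventuallyEq
      (differentiable_riemannZeta₁.differentiableOn.analyticOnNhd hUo)
      (hdiff.analyticOnNhd hUo) hUc (z₀ := 2) (by simp [hU]; norm_num) ?_
    have hnb : {s : ℂ | 1 < s.re} ∈ nhds (2 : ℂ) :=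
      (isOpen_lt continuous_const Complex.continuous_re).mem_nhds (by simp)
    filter_upwards [hnb] with s hs
    have hs : 1 < s.re := hs
    have hs1 : s ≠ 1 := by rintro rfl; simp at hs
    have t1 := ((hsumm s (by linarith)).hasSum.tendsto_sum_nat).const_add 1
    have e : ∀ M : ℕ, 1 + ∑ m ∈ Finset.range M, zetaTerm s (m + 1) =
        (s - 1) * ∑ m ∈ Finset.range M, 1 / ((m : ℂ) + 1) ^ s + ((M + 1 : ℕ) : ℂ) ^ (1 - s) := by
      intro M
      have h1 := zetaTerm_zero_sum s (M + 1) (by omega)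
      rw [Finset.sum_Ico_eq_sum_range, Finset.sum_Ico_eq_sum_range] at h1
      simp only [Nat.add_sub_cancel, add_comm 1] at h1
      rw [h1]
      congr 2
      refine Finset.sum_congr rfl fun m _ => ?_
      rw [Complex.cpow_neg, one_div]
      push_cast
      rfl
    have t2 : Filter.Tendsto (fun M : ℕ => (s - 1) * ∑ m ∈ Finset.range M, 1 / ((m : ℂ) + 1) ^ s +
        ((M + 1 : ℕ) : ℂ) ^ (1 - s)) Filter.atTop (nhds ((s - 1) * riemannZeta s + 0)) := by
      have hsm : Summable (fun m : ℕ => 1 / ((m : ℂ) + 1) ^ s) := by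
        have := (summable_nat_add_iff 1).mpr (Complex.summable_one_div_nat_cpow.mpr hs)
        simpa using this
      refine (Filter.Tendsto.const_mul _ ?_).add ?_
      · rw [zeta_eq_tsum_one_div_nat_add_one_cpow hs]
        exact hsm.hasSum.tendsto_sum_nat
      · rw [tendsto_zero_iff_norm_tendsto_zero]
        have h1 : ∀ M : ℕ, ‖((M + 1 : ℕ) : ℂ) ^ (1 - s)‖ = ((M + 1 : ℕ) : ℝ) ^ (-(s.re - 1)) := by
          intro M
          rw [Complex.norm_natCast_cpow_of_pos (by omega)]
          simp
        simp only [h1]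
        have h2 := (tendsto_rpow_neg_atTop (by linarith : 0 < s.re - 1)).comp
          (tendsto_natCast_atTop_atTop (R := ℝ))
        exact (Filter.tendsto_add_atTop_iff_nat 1).mpr h2
    simp only [e] at t1
    have h3 := tendsto_nhds_unique t1 t2
    rw [h3, add_zero, riemannZeta_eq_inv_sub_mul hs1]
    have : s - 1 ≠ 0 := sub_ne_zero.mpr hs1
    field_simp
  have h1 : riemannZeta₁ s = 1 + ∑' m : ℕ, zetaTerm s (m + 1) := heq hs
  rw [h1, add_sub_cancel_left]
  exact (hsumm s hs).hasSum

lemma tendsto_zeta_partial {s : ℂ} (hs : 1 / 4 < s.re) (N : ℕ) (hN : 1 ≤ N) :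
    Filter.Tendsto (fun M : ℕ => ∑ m ∈ Finset.Ico N M, zetaTerm s m) Filter.atTop
      (nhds (riemannZeta₁ s - ((s - 1) * ∑ m ∈ Finset.Ico 1 N, (m : ℂ) ^ (-s) +
        (N : ℂ) ^ (1 - s)))) := by
  have h1 := (hasSum_zetaTerm hs).tendsto_sum_nat
  have h2 := (h1.comp (Filter.tendsto_sub_atTop_nat 1)).sub_const
    (∑ m ∈ Finset.Ico 1 N, zetaTerm s m)
  have e : riemannZeta₁ s - 1 - ∑ m ∈ Finset.Ico 1 N, zetaTerm s m =
      riemannZeta₁ s - ((s - 1) * ∑ m ∈ Finset.Ico 1 N, (m : ℂ) ^ (-s) +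
        (N : ℂ) ^ (1 - s)) := by
    rw [← zetaTerm_zero_sum s N hN]
    ring
  rw [e] at h2
  refine h2.congr' ?_
  filter_upwards [Filter.eventually_ge_atTop N] with M hM
  simp only [Function.comp]
  rw [sub_eq_iff_eq_add', Finset.sum_Ico_consecutive _ hN hM, Finset.sum_Ico_eq_sum_range]
  simp only [add_comm]

lemma rpow_neg_three_halves_le (m : ℕ) (hm : 0 < m) :
    (m : ℝ) ^ (-(3 / 2) : ℝ) ≤ 4 * (1 / √(m : ℝ) - 1 / √((m + 1 : ℕ) : ℝ)) := by
  have hm' : (1 : ℝ) ≤ m := by exact_mod_cast hm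
  have h0 : 0 < √(m : ℝ) := Real.sqrt_pos.mpr (by linarith)
  have h1 : 0 < √((m + 1 : ℕ) : ℝ) := Real.sqrt_pos.mpr (by positivity)
  have h2 : √(m : ℝ) ^ 2 = m := Real.sq_sqrt (by linarith)
  have h3 : √((m + 1 : ℕ) : ℝ) ^ 2 = m + 1 := by rw [Real.sq_sqrt (by positivity)]; simp
  have e : (m : ℝ) ^ (-(3 / 2) : ℝ) = 1 / √(m : ℝ) ^ 3 := by
    rw [Real.sqrt_eq_rpow, ← Real.rpow_natCast, ← Real.rpow_mul (by linarith),
      Real.rpow_neg (by linarith), one_div]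
    norm_num
  rw [e]
  generalize √(m : ℝ) = x at *
  generalize √((m + 1 : ℕ) : ℝ) = y at *
  have h4 : y ≤ 1.5 * x := by
    apply le_of_sq_le_sq _ (by positivity)
    nlinarith
  have e2 : 1 / x - 1 / y = 1 / (x * y * (x + y)) := by
    have : (y - x) * (x + y) = 1 := by nlinarith
    field_simp
    linarith
  rw [e2, mul_one_div, div_le_div_iff₀ (by positivity) (by positivity)]
  have : x * y * (x + y) ≤ x * (1.5 * x) * (x + 1.5 * x) := by gcongr
  have h5 : 0 < x ^ 3 := by positivity
  nlinarith

/-- Approximation of `ζ` by a partial sum of its Dirichlet series. -/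
theorem norm_zeta_sub_sum_le {s : ℂ} (hs : 1 / 2 ≤ s.re) (N : ℕ) (hN : 1 ≤ N) :
    ‖riemannZeta₁ s - (s - 1) * ∑ m ∈ Finset.Ico 1 N, (m : ℂ) ^ (-s)‖ ≤
      (N : ℝ) ^ (1 - s.re) + 4 * (‖s - 1‖ * ‖s‖ * (N : ℝ) ^ (-s.re)) := by
  have hN' : (0 : ℝ) < N := by exact_mod_cast hN
  have h1 := tendsto_zeta_partial (by linarith) N hN (s := s)
  have h2 : ‖riemannZeta₁ s - ((s - 1) * ∑ m ∈ Finset.Ico 1 N, (m : ℂ) ^ (-s) +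
        (N : ℂ) ^ (1 - s))‖ ≤ 4 * (‖s - 1‖ * ‖s‖ * (N : ℝ) ^ (-s.re)) := by
    refine le_of_tendsto h1.norm (Filter.Eventually.of_forall fun M => ?_)
    have hterm : ∀ m ∈ Finset.Ico N M, ‖zetaTerm s m‖ ≤ ‖s - 1‖ * ‖s‖ *
        ((N : ℝ) ^ (1 / 2 - s.re) * (4 * (1 / √(m : ℝ) - 1 / √((m + 1 : ℕ) : ℝ)))) := by
      intro m hm
      rw [Finset.mem_Ico] at hm
      have hm' : (0 : ℝ) < m := by exact_mod_cast (by omega : 0 < m)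
      refine (norm_zetaTerm_le s m (by omega) (by linarith)).trans ?_
      rw [show -s.re - 1 = (1 / 2 - s.re) + (-(3 / 2)) by ring, Real.rpow_add hm']
      have h3 := rpow_neg_three_halves_le m (by omega)
      have h4 : (m : ℝ) ^ (1 / 2 - s.re) ≤ (N : ℝ) ^ (1 / 2 - s.re) :=
        Real.rpow_le_rpow_of_nonpos hN' (by exact_mod_cast hm.1) (by linarith)
      gcongr
    refine (norm_sum_le _ _).trans ((Finset.sum_le_sum hterm).trans ?_)
    rw [← Finset.mul_sum, ← Finset.mul_sum, ← Finset.mul_sum]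
    have h5 : ∑ m ∈ Finset.Ico N M, (1 / √(m : ℝ) - 1 / √((m + 1 : ℕ) : ℝ)) ≤ 1 / √(N : ℝ) := by
      rcases le_or_gt N M with h | h
      · have e := Finset.sum_Ico_sub (fun m : ℕ => -(1 / √(m : ℝ))) h
        have : 0 ≤ 1 / √(M : ℝ) := by positivity
        rw [Finset.sum_congr rfl (fun m _ => by ring : ∀ m ∈ Finset.Ico N M,
          1 / √(m : ℝ) - 1 / √((m + 1 : ℕ) : ℝ) =
            -(1 / √((m + 1 : ℕ) : ℝ)) - -(1 / √(m : ℝ))), e]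
        linarith
      · rw [Finset.Ico_eq_empty (by omega)]
        simp
    calc _ ≤ ‖s - 1‖ * ‖s‖ * ((N : ℝ) ^ (1 / 2 - s.re) * (4 * (1 / √(N : ℝ)))) := by gcongr
      _ = 4 * (‖s - 1‖ * ‖s‖ * ((N : ℝ) ^ (1 / 2 - s.re) * (N : ℝ) ^ (-(1 / 2) : ℝ))) := by
        rw [Real.sqrt_eq_rpow, Real.rpow_neg hN'.le, one_div ((N : ℝ) ^ (1 / 2 : ℝ))]
        ring
      _ = _ := by
        rw [← Real.rpow_add hN']
        ring_nf
  have e : riemannZeta₁ s - (s - 1) * ∑ m ∈ Finset.Ico 1 N, (m : ℂ) ^ (-s) =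
      (N : ℂ) ^ (1 - s) + (riemannZeta₁ s - ((s - 1) * ∑ m ∈ Finset.Ico 1 N, (m : ℂ) ^ (-s) +
        (N : ℂ) ^ (1 - s))) := by ring
  rw [e]
  refine (norm_add_le _ _).trans (add_le_add (le_of_eq ?_) h2)
  rw [Complex.norm_natCast_cpow_of_pos (by omega)]
  simp

/-- The dyadic block `∑_{2^k ≤ n < 2^{k+1}} n^{-s}`. -/
noncomputable def dyadicBlock (k : ℕ) (s : ℂ) : ℂ :=
  ∑ n ∈ Finset.Ico (2 ^ k : ℕ) (2 ^ (k + 1)), (n : ℂ) ^ (-s)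

lemma sum_dyadicBlock (K : ℕ) (s : ℂ) :
    ∑ k ∈ Finset.range K, dyadicBlock k s = ∑ n ∈ Finset.Ico 1 (2 ^ K : ℕ), (n : ℂ) ^ (-s) := by
  induction K with
  | zero => simp
  | succ K ih =>
    rw [Finset.sum_range_succ, ih, dyadicBlock, Finset.sum_Ico_consecutive _ Nat.one_le_two_pow
      (Nat.pow_le_pow_right (by norm_num) (by omega))]

lemma norm_dyadicBlock_le_of_le (k : ℕ) (σ t : ℝ) (hσ : 1 / 2 ≤ σ) (ht : 0 < t)
    (h1 : t ≤ 2 ^ k) (h2 : (2 : ℝ) ^ k ≤ t ^ 2) :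
    ‖dyadicBlock k (σ + t * Complex.I)‖ ≤ 20 := by
  have hN : (((2 ^ k : ℕ) : ℝ)) = 2 ^ k := by push_cast; rfl
  have := norm_sum_cpow_le (2 ^ k) (2 ^ k) (2 ^ (k + 1)) σ t (20 * (2 ^ k : ℕ) / t) (by positivity)
    (by linarith) le_rfl (fun m hm => norm_sum_log_phase_le_of_le (2 ^ k) (2 ^ k) m t
      (by positivity) ht (by rwa [hN]) le_rfl (by rw [pow_succ] at hm; omega))
  refine this.trans ?_
  rw [hN]
  set N : ℝ := 2 ^ k with hNd
  have hN1 : 1 ≤ N := one_le_pow₀ (by norm_num)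
  have hN0 : 0 < N := by linarith
  calc N ^ (-σ) * (20 * N / t) ≤ N ^ (-(1 / 2) : ℝ) * (20 * N / t) := by
        gcongr
    _ = 20 * (N ^ (1 / 2 : ℝ) / t) := by
        have : N ^ (-(1 / 2) : ℝ) * N = N ^ (1 / 2 : ℝ) := by
          nth_rewrite 2 [← Real.rpow_one N]
          rw [← Real.rpow_add hN0]
          norm_num
        rw [← this]
        ring
    _ ≤ 20 * 1 := by
        gcongr
        rw [div_le_one ht, ← Real.sqrt_eq_rpow, Real.sqrt_le_left ht.le]
        exact h2
    _ = 20 := by norm_num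

lemma norm_dyadicBlock_le_sixth (k : ℕ) (σ t : ℝ) (hσ : 1 / 2 ≤ σ) (ht : 1 ≤ t)
    (h1 : (2 : ℝ) ^ k ≤ t) :
    ‖dyadicBlock k (σ + t * Complex.I)‖ ≤ 100 * t ^ (1 / 6 : ℝ) := by
  have hN : (((2 ^ k : ℕ) : ℝ)) = 2 ^ k := by push_cast; rfl
  have ht0 : 0 < t := by linarith
  have hu : (t ^ (1 / 6 : ℝ)) ^ 6 = t := by
    rw [← Real.rpow_natCast, ← Real.rpow_mul ht0.le]
    norm_num
  have := norm_sum_cpow_le (2 ^ k) (2 ^ k) (2 ^ (k + 1)) σ t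
    (100 * (√((2 ^ k : ℕ) : ℝ) * t ^ (1 / 6 : ℝ))) (by positivity)
    (by linarith) le_rfl (fun m hm => norm_sum_log_phase_le_sixth (2 ^ k) (2 ^ k) m t _
      (by positivity) (by positivity) hu (by rwa [hN]) le_rfl (by rw [pow_succ] at hm; omega))
  refine this.trans ?_
  rw [hN]
  set N : ℝ := 2 ^ k with hNd
  have hN1 : 1 ≤ N := one_le_pow₀ (by norm_num)
  have hN0 : 0 < N := by linarith
  calc N ^ (-σ) * (100 * (√N * t ^ (1 / 6 : ℝ)))
      ≤ N ^ (-(1 / 2) : ℝ) * (100 * (√N * t ^ (1 / 6 : ℝ))) := by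
        gcongr
    _ = (N ^ (-(1 / 2) : ℝ) * √N) * (100 * t ^ (1 / 6 : ℝ)) := by ring
    _ = _ := by
        rw [Real.sqrt_eq_rpow, ← Real.rpow_add hN0]
        norm_num

lemma norm_dyadicBlock_le_of_rpow_le (k : ℕ) (σ t : ℝ) (hσ : 9 / 10 ≤ σ) (ht : 1 ≤ t)
    (h1 : (2 : ℝ) ^ k ≤ t) (h2 : t ^ (3 / 5 : ℝ) ≤ 2 ^ k) :
    ‖dyadicBlock k (σ + t * Complex.I)‖ ≤ 84 := by
  have hN : (((2 ^ k : ℕ) : ℝ)) = 2 ^ k := by push_cast; rfl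
  have ht0 : 0 < t := by linarith
  have := norm_sum_cpow_le (2 ^ k) (2 ^ k) (2 ^ (k + 1)) σ t
    (84 * √t) (by positivity)
    (by linarith) le_rfl (fun m hm => norm_sum_log_phase_le_sqrt (2 ^ k) (2 ^ k) m t
      (by positivity) (by rwa [hN]) le_rfl (by rw [pow_succ] at hm; omega))
  refine this.trans ?_
  rw [hN]
  calc ((2 : ℝ) ^ k) ^ (-σ) * (84 * √t) ≤ (t ^ (3 / 5 : ℝ)) ^ (-σ) * (84 * √t) := by
        gcongr ?_ * _
        exact Real.rpow_le_rpow_of_nonpos (by positivity) h2 (by linarith)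
    _ = 84 * t ^ (3 / 5 * -σ + 1 / 2) := by
        rw [← Real.rpow_mul ht0.le, Real.sqrt_eq_rpow, Real.rpow_add ht0]
        ring
    _ ≤ 84 * 1 := by
        gcongr
        exact Real.rpow_le_one_of_one_le_of_nonpos ht (by linarith)
    _ = 84 := by norm_num

/-- `ζ` is bounded by dyadic blocks of its Dirichlet series. -/
theorem norm_zeta_le_sum_dyadicBlock (σ t : ℝ) (hσ : 1 / 2 ≤ σ) (ht : 1 ≤ t) :
    ∃ K : ℕ, (2 : ℝ) ^ K ≤ t ^ 2 ∧ ‖riemannZeta (σ + t * Complex.I)‖ ≤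
      8 + 4 * σ + ∑ k ∈ Finset.range (K + 1), ‖dyadicBlock k (σ + t * Complex.I)‖ := by
  obtain ⟨K, hK1, hK2⟩ := exists_nat_pow_near (x := t ^ 2) (y := (2 : ℝ))
    (one_le_pow₀ ht) (by norm_num)
  refine ⟨K, hK1, ?_⟩
  set s : ℂ := σ + t * Complex.I with hs
  have hre : s.re = σ := by simp [hs]
  have him : s.im = t := by simp [hs]
  have ht0 : 0 < t := by linarith
  have h1 := norm_zeta_sub_sum_le (s := s) (by rw [hre]; exact hσ) (2 ^ (K + 1))
    Nat.one_le_two_pow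
  have hs1 : t ≤ ‖s - 1‖ := by
    have := Complex.abs_im_le_norm (s - 1)
    rw [Complex.sub_im, him, Complex.one_im, sub_zero, abs_of_pos ht0] at this
    exact this
  have hs1' : 0 < ‖s - 1‖ := by linarith
  have hne : s ≠ 1 := by
    intro h
    rw [h, sub_self, norm_zero] at hs1'
    exact lt_irrefl _ hs1'
  have hsn : ‖s‖ ≤ σ + t := by
    rw [hs]
    refine (norm_add_le _ _).trans ?_
    rw [norm_mul, Complex.norm_I, Complex.norm_real, Complex.norm_real, mul_one,
      Real.norm_of_nonneg (by linarith), Real.norm_of_nonneg ht0.le]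
  set N : ℝ := ((2 ^ (K + 1) : ℕ) : ℝ) with hN
  have hNe : N = 2 ^ (K + 1) := by rw [hN]; push_cast; rfl
  have hN1 : t ^ 2 ≤ N := by rw [hNe]; exact hK2.le
  have hN2 : N ≤ 2 * t ^ 2 := by rw [hNe, pow_succ]; linarith
  have hN0 : 1 ≤ N := by rw [hNe]; exact one_le_pow₀ (by norm_num)
  rw [← sum_dyadicBlock, hre] at h1
  have h2 : ‖riemannZeta s - ∑ k ∈ Finset.range (K + 1), dyadicBlock k s‖ ≤ 8 + 4 * σ := by
    have e : riemannZeta s - ∑ k ∈ Finset.range (K + 1), dyadicBlock k s =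
        (s - 1)⁻¹ * (riemannZeta₁ s - (s - 1) * ∑ k ∈ Finset.range (K + 1), dyadicBlock k s) := by
      rw [riemannZeta_eq_inv_sub_mul hne]
      have : s - 1 ≠ 0 := sub_ne_zero.mpr hne
      field_simp
    have hb : (N : ℝ) ^ (-σ) ≤ 1 / t := by
      calc N ^ (-σ) ≤ (t ^ 2) ^ (-σ) :=
            Real.rpow_le_rpow_of_nonpos (by positivity) hN1 (by linarith)
        _ ≤ (t ^ 2) ^ (-(1 / 2) : ℝ) := by
            apply Real.rpow_le_rpow_of_exponent_le (one_le_pow₀ ht)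
            linarith
        _ = 1 / t := by
            rw [Real.rpow_neg (by positivity), ← Real.sqrt_eq_rpow, Real.sqrt_sq ht0.le, one_div]
    have ha : N ^ (1 - σ) ≤ 2 * t := by
      rw [sub_eq_add_neg, Real.rpow_add (by linarith), Real.rpow_one]
      calc N * N ^ (-σ) ≤ (2 * t ^ 2) * (1 / t) := by gcongr
        _ = _ := by field_simp
    rw [e, norm_mul, norm_inv]
    calc _ ≤ ‖s - 1‖⁻¹ * (N ^ (1 - σ) + 4 * (‖s - 1‖ * ‖s‖ * N ^ (-σ))) := by gcongr
      _ = ‖s - 1‖⁻¹ * N ^ (1 - σ) + 4 * (‖s‖ * N ^ (-σ)) := by field_simp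
      _ ≤ t⁻¹ * (2 * t) + 4 * ((σ + t) * (1 / t)) := by gcongr
      _ = 2 + 4 * (σ / t + 1) := by field_simp
      _ ≤ 2 + 4 * (σ + 1) := by
          gcongr
          exact div_le_self (by linarith) ht
      _ ≤ _ := by linarith
  calc ‖riemannZeta s‖ = ‖(riemannZeta s - ∑ k ∈ Finset.range (K + 1), dyadicBlock k s) +
        ∑ k ∈ Finset.range (K + 1), dyadicBlock k s‖ := by rw [sub_add_cancel]
    _ ≤ _ := (norm_add_le _ _).trans (add_le_add h2 (norm_sum_le _ _))

lemma le_three_mul_log_of_two_pow_le (K : ℕ) (t : ℝ) (ht : 1 ≤ t) (h : (2 : ℝ) ^ K ≤ t ^ 2) :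
    (K : ℝ) ≤ 3 * log t := by
  have h1 := Real.log_le_log (by positivity) h
  rw [Real.log_pow, Real.log_pow] at h1
  push_cast at h1
  have h2 := Real.log_two_gt_d9
  have h3 := Real.log_nonneg ht
  nlinarith [show (0 : ℝ) ≤ K by positivity]

/-- The bound `ζ(σ+it) ≪ |t|^{1/6+ε}` for `σ ≥ 1/2`. -/
theorem norm_zeta_le_sixth (ε S : ℝ) (hε : 0 < ε) : ∃ C : ℝ, 0 < C ∧ ∀ σ t : ℝ, 1 / 2 ≤ σ →
    σ ≤ S → 1 ≤ |t| → ‖riemannZeta (σ + t * Complex.I)‖ ≤ C * |t| ^ (1 / 6 + ε) := by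
  refine ⟨8 + 4 * |S| + (3 / ε + 1) * 100, by positivity, ?_⟩
  have hpos : ∀ σ t : ℝ, 1 / 2 ≤ σ → σ ≤ S → 1 ≤ t → ‖riemannZeta (σ + t * Complex.I)‖ ≤
      (8 + 4 * |S| + (3 / ε + 1) * 100) * t ^ (1 / 6 + ε) := by
    intro σ t hσ hS ht
    have ht0 : 0 < t := by linarith
    obtain ⟨K, hK1, hK2⟩ := norm_zeta_le_sum_dyadicBlock σ t hσ ht
    have hu : 1 ≤ t ^ (1 / 6 : ℝ) := Real.one_le_rpow ht (by norm_num)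
    have hue : 1 ≤ t ^ ε := Real.one_le_rpow ht hε.le
    have h1 : ∀ k ∈ Finset.range (K + 1), ‖dyadicBlock k (σ + t * Complex.I)‖ ≤
        100 * t ^ (1 / 6 : ℝ) := by
      intro k hk
      rw [Finset.mem_range] at hk
      rcases le_total ((2 : ℝ) ^ k) t with h | h
      · exact norm_dyadicBlock_le_sixth k σ t hσ ht h
      · refine (norm_dyadicBlock_le_of_le k σ t hσ ht0 h (le_trans ?_ hK1)).trans (by linarith)
        exact pow_le_pow_right₀ (by norm_num) (by omega)
    have h2 := Finset.sum_le_sum h1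
    rw [Finset.sum_const, Finset.card_range, nsmul_eq_mul] at h2
    have h3 := le_three_mul_log_of_two_pow_le K t ht hK1
    have h4 := Real.log_le_rpow_div ht0.le hε
    have h5 : (((K + 1 : ℕ) : ℝ)) ≤ (3 / ε + 1) * t ^ ε := by
      push_cast
      have : 3 * (t ^ ε / ε) = 3 / ε * t ^ ε := by ring
      linarith
    have h6 : σ ≤ |S| := hS.trans (le_abs_self S)
    rw [Real.rpow_add ht0]
    have h7 : 1 ≤ t ^ (1 / 6 : ℝ) * t ^ ε := by nlinarith
    calc _ ≤ _ := hK2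
      _ ≤ (8 + 4 * |S|) * 1 + ((3 / ε + 1) * t ^ ε) * (100 * t ^ (1 / 6 : ℝ)) := by
          rw [mul_one]
          refine add_le_add (by linarith) (h2.trans ?_)
          gcongr
      _ ≤ (8 + 4 * |S|) * (t ^ (1 / 6 : ℝ) * t ^ ε) +
          ((3 / ε + 1) * t ^ ε) * (100 * t ^ (1 / 6 : ℝ)) := by gcongr
      _ = _ := by ring
  intro σ t hσ hS ht
  rcases le_total 0 t with h | h
  · rw [abs_of_nonneg h] at ht ⊢
    exact hpos σ t hσ hS ht
  · rw [abs_of_nonpos h] at ht ⊢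
    have e : (starRingEnd ℂ) ((σ : ℂ) + ((-t : ℝ) : ℂ) * Complex.I) = σ + t * Complex.I := by
      simp
    rw [← e, riemannZeta_conj, Complex.norm_conj]
    exact hpos σ (-t) hσ hS ht

lemma continuous_phase : Continuous phase := by
  unfold phase
  fun_prop

lemma norm_integral_phase_le (c A B : ℝ) (hc : c ≠ 0) :
    ‖∫ t in A..B, phase (c * t)‖ ≤ 2 / |c| := by
  have hc' : (Complex.I * c : ℂ) ≠ 0 := mul_ne_zero Complex.I_ne_zero (by exact_mod_cast hc)
  have e : ∫ t in A..B, phase (c * t) = ∫ t in A..B, Complex.exp ((Complex.I * c) * t) := by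
    congr 1
    ext t
    rw [phase]
    push_cast
    ring_nf
  have hn : ∀ x : ℝ, ‖Complex.exp (Complex.I * c * x)‖ = 1 := by
    intro x
    rw [show Complex.I * c * x = ((c * x : ℝ) : ℂ) * Complex.I by push_cast; ring]
    exact Complex.norm_exp_ofReal_mul_I _
  rw [e, integral_exp_mul_complex hc', norm_div, norm_mul, Complex.norm_I, one_mul,
    Complex.norm_real, Real.norm_eq_abs]
  gcongr
  refine (norm_sub_le _ _).trans ?_
  rw [hn, hn]
  norm_num

lemma inv_abs_log_sub_log_le (N m n : ℕ) (hm : 0 < m) (hn : 0 < n) (hmN : m ≤ N) (hnN : n ≤ N)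
    (hmn : m ≠ n) : log n - log m ≠ 0 ∧
      2 / |log n - log m| ≤ 2 * N * (1 / (((n : ℤ) - m).natAbs : ℝ)) := by
  wlog h : m < n generalizing m n
  · obtain ⟨h1, h2⟩ := this n m hn hm hnN hmN hmn.symm (by omega)
    refine ⟨fun h3 => h1 (by linarith), ?_⟩
    rw [abs_sub_comm, show ((n : ℤ) - m).natAbs = ((m : ℤ) - n).natAbs by omega]
    exact h2
  have hm' : (0 : ℝ) < m := by exact_mod_cast hm
  have hn' : (0 : ℝ) < n := by exact_mod_cast hn
  have hN' : (n : ℝ) ≤ N := by exact_mod_cast hnN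
  have hlt : (m : ℝ) < n := by exact_mod_cast h
  have h1 : ((n : ℝ) - m) / N ≤ log n - log m := by
    rw [← Real.log_div hn'.ne' hm'.ne']
    have := Real.one_sub_inv_le_log_of_pos (x := (n : ℝ) / m) (by positivity)
    refine le_trans ?_ this
    have e : 1 - ((n : ℝ) / m)⁻¹ = (n - m) / n := by field_simp
    rw [e]
    have : 0 ≤ (n : ℝ) - m := by linarith
    gcongr
  have h0 : 0 < ((n : ℝ) - m) / N := div_pos (by linarith) (by linarith)
  refine ⟨by linarith, ?_⟩
  rw [abs_of_pos (by linarith)]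
  have e2 : (((n : ℤ) - m).natAbs : ℝ) = n - m := by
    rw [show ((n : ℤ) - m).natAbs = n - m by omega, Nat.cast_sub h.le]
  rw [e2]
  calc 2 / (log n - log m) ≤ 2 / (((n : ℝ) - m) / N) := by gcongr
    _ = _ := by field_simp

/-- Mean value theorem for Dirichlet polynomials. -/
theorem integral_norm_sq_dirichlet_le (a : ℕ → ℂ) (N : ℕ) (T₀ T : ℝ) (hT : 0 ≤ T) :
    ∫ t in T₀..(T₀ + T), ‖∑ n ∈ Finset.Icc 1 N, a n * phase (-(t * log n))‖ ^ 2 ≤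
      (T + 4 * N * (1 + log N)) * ∑ n ∈ Finset.Icc 1 N, ‖a n‖ ^ 2 := by
  have e1 : ((∫ t in T₀..(T₀ + T), ‖∑ n ∈ Finset.Icc 1 N, a n * phase (-(t * log n))‖ ^ 2 : ℝ) : ℂ)
      = ∑ m ∈ Finset.Icc 1 N, ∑ n ∈ Finset.Icc 1 N,
        a m * star (a n) * ∫ t in T₀..(T₀ + T), phase ((log n - log m) * t) := by
    rw [← intervalIntegral.integral_ofReal]
    have h : ∀ t : ℝ, ((‖∑ n ∈ Finset.Icc 1 N, a n * phase (-(t * log n))‖ ^ 2 : ℝ) : ℂ) =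
        ∑ m ∈ Finset.Icc 1 N, ∑ n ∈ Finset.Icc 1 N,
          a m * star (a n) * phase ((log n - log m) * t) := by
      intro t
      push_cast
      rw [← Complex.mul_conj', ← Complex.star_def, star_sum, Finset.sum_mul_sum]
      refine Finset.sum_congr rfl fun m _ => Finset.sum_congr rfl fun n _ => ?_
      rw [star_mul, ← phase_neg, neg_neg,
        show (log n - log m) * t = -(t * log m) + t * log n by ring, phase_add]
      ring
    simp only [h]
    have hc : ∀ m n : ℕ, Continuous
        (fun t : ℝ => a m * star (a n) * phase ((log n - log m) * t)) := by
      intro m n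
      exact continuous_const.mul (continuous_phase.comp (by fun_prop))
    rw [intervalIntegral.integral_finsetSum fun m _ =>
      (continuous_finsetSum _ fun n _ => hc m n).intervalIntegrable _ _]
    refine Finset.sum_congr rfl fun m _ => ?_
    rw [intervalIntegral.integral_finsetSum fun n _ => (hc m n).intervalIntegrable _ _]
    refine Finset.sum_congr rfl fun n _ => ?_
    rw [intervalIntegral.integral_const_mul]
  have h0 : 0 ≤ ∫ t in T₀..(T₀ + T), ‖∑ n ∈ Finset.Icc 1 N, a n * phase (-(t * log n))‖ ^ 2 :=
    intervalIntegral.integral_nonneg (by linarith) fun _ _ => by positivity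
  rw [← Real.norm_of_nonneg h0, ← Complex.norm_real, e1]
  set κ : ℕ → ℕ → ℝ := fun m n => (if m = n then T else 0) +
    2 * N * (1 / (((n : ℤ) - m).natAbs : ℝ)) with hκ
  have hκ0 : ∀ m n, 0 ≤ κ m n := by
    intro m n
    simp only [hκ]
    split_ifs <;> positivity
  have hκs : ∀ m n, κ m n = κ n m := by
    intro m n
    simp only [hκ]
    rw [show ((n : ℤ) - m).natAbs = ((m : ℤ) - n).natAbs by omega]
    simp only [eq_comm]
  have hint : ∀ m ∈ Finset.Icc 1 N, ∀ n ∈ Finset.Icc 1 N,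
      ‖∫ t in T₀..(T₀ + T), phase ((log n - log m) * t)‖ ≤ κ m n := by
    intro m hm n hn
    rw [Finset.mem_Icc] at hm hn
    simp only [hκ]
    by_cases hmn : m = n
    · subst hmn
      simp [phase, abs_of_nonneg hT]
    · rw [if_neg hmn, zero_add]
      obtain ⟨h1, h2⟩ := inv_abs_log_sub_log_le N m n (by omega) (by omega) hm.2 hn.2 hmn
      exact (norm_integral_phase_le _ _ _ h1).trans h2
  have hrow : ∀ m ∈ Finset.Icc 1 N, ∑ n ∈ Finset.Icc 1 N, κ m n ≤ T + 4 * N * (1 + log N) := by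
    intro m hm
    have hm' := Finset.mem_Icc.mp hm
    simp only [hκ]
    rw [Finset.sum_add_distrib, Finset.sum_ite_eq, if_pos hm, ← Finset.mul_sum]
    have h1 : ∑ n ∈ Finset.Icc 1 N, 1 / (((n : ℤ) - m).natAbs : ℝ) ≤ 2 * (1 + log N) := by
      calc _ ≤ ∑ n ∈ Finset.range (N + 1), 1 / (((n : ℤ) - m).natAbs : ℝ) := by
            apply Finset.sum_le_sum_of_subset_of_nonneg
            · intro n hn
              rw [Finset.mem_Icc] at hn
              rw [Finset.mem_range]
              omega
            · intros; positivity
        _ ≤ 2 * ∑ k ∈ Finset.range (N + 1), 1 / (k : ℝ) :=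
            sum_norm_correlation_le (fun k => 1 / (k : ℝ)) (fun k => by positivity) (N + 1) m
              (by omega)
        _ = 2 * (harmonic N : ℝ) := by
            rw [Finset.sum_range_succ', harmonic]
            push_cast
            simp
        _ ≤ _ := by
            gcongr
            exact harmonic_le_one_add_log N
    have h2 : 2 * (N : ℝ) * ∑ n ∈ Finset.Icc 1 N, 1 / (((n : ℤ) - m).natAbs : ℝ) ≤
        2 * N * (2 * (1 + log N)) := by gcongr
    linarith
  calc _ ≤ ∑ m ∈ Finset.Icc 1 N, ∑ n ∈ Finset.Icc 1 N,
        ((‖a m‖ ^ 2 / 2) * κ m n + (‖a n‖ ^ 2 / 2) * κ m n) := by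
        refine (norm_sum_le _ _).trans (Finset.sum_le_sum fun m hm =>
          (norm_sum_le _ _).trans (Finset.sum_le_sum fun n hn => ?_))
        rw [norm_mul, norm_mul, norm_star]
        have h1 := hint m hm n hn
        have h2 : ‖a m‖ * ‖a n‖ ≤ ‖a m‖ ^ 2 / 2 + ‖a n‖ ^ 2 / 2 := by
          nlinarith [sq_nonneg (‖a m‖ - ‖a n‖)]
        rw [← add_mul]
        gcongr
    _ = ∑ m ∈ Finset.Icc 1 N, ‖a m‖ ^ 2 * ∑ n ∈ Finset.Icc 1 N, κ m n := by
        simp only [Finset.sum_add_distrib]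
        rw [Finset.sum_comm (f := fun m n => ‖a n‖ ^ 2 / 2 * κ m n), ← Finset.sum_add_distrib]
        refine Finset.sum_congr rfl fun m _ => ?_
        rw [Finset.mul_sum, ← Finset.sum_add_distrib]
        refine Finset.sum_congr rfl fun n _ => ?_
        rw [hκs n m]
        ring
    _ ≤ ∑ m ∈ Finset.Icc 1 N, ‖a m‖ ^ 2 * (T + 4 * N * (1 + log N)) := by
        refine Finset.sum_le_sum fun m hm => ?_
        have := hrow m hm
        gcongr
    _ = _ := by rw [← Finset.sum_mul, mul_comm]

lemma card_divisors_le_rpow (ε : ℝ) (hε : 0 < ε) :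
    ∃ C : ℝ, 1 ≤ C ∧ ∀ n : ℕ, n ≠ 0 → (n.divisors.card : ℝ) ≤ C * (n : ℝ) ^ ε := by
  obtain ⟨Q, hQ⟩ := exists_nat_ge ((2 : ℝ) ^ (1 / ε))
  have hl2 : 0 < log 2 := log_pos one_lt_two
  set K : ℝ := max 1 (1 / (ε * log 2)) with hK
  have hK1 : 1 ≤ K := le_max_left _ _
  have hK2 : 1 ≤ K * (ε * log 2) := by
    have : 1 / (ε * log 2) ≤ K := le_max_right _ _
    rwa [div_le_iff₀ (by positivity)] at this
  refine ⟨K ^ Q, one_le_pow₀ hK1, fun n hn => ?_⟩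
  have hprime : ∀ p ∈ n.primeFactors, ((n.factorization p + 1 : ℕ) : ℝ) ≤
      (if p < Q then K else 1) * ((p : ℝ) ^ n.factorization p) ^ ε := by
    intro p hp
    have hp2 : (2 : ℝ) ≤ p := by exact_mod_cast (Nat.prime_of_mem_primeFactors hp).two_le
    set e := n.factorization p
    have hpow : ((p : ℝ) ^ e) ^ ε = ((p : ℝ) ^ ε) ^ e := by
      rw [← rpow_natCast, ← rpow_natCast, ← rpow_mul (by positivity), ← rpow_mul (by positivity),
        mul_comm]
    split_ifs with h
    · have h1 : ((2 : ℝ) ^ e) ^ ε ≤ ((p : ℝ) ^ e) ^ ε := by gcongr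
      have h2 : 1 + (e : ℝ) * ε * log 2 ≤ ((2 : ℝ) ^ e) ^ ε := by
        rw [← rpow_natCast, ← rpow_mul (by positivity), rpow_def_of_pos (by positivity)]
        have := add_one_le_exp (log 2 * (e * ε))
        linarith
      have h3 : ((e + 1 : ℕ) : ℝ) ≤ K * (1 + (e : ℝ) * ε * log 2) := by
        push_cast
        have : (e : ℝ) * 1 ≤ e * (K * (ε * log 2)) := by gcongr
        linarith
      calc _ ≤ _ := h3
        _ ≤ _ := by gcongr; exact h2.trans h1
    · have hQp : (2 : ℝ) ^ (1 / ε) ≤ p := hQ.trans (by exact_mod_cast not_lt.1 h)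
      have h1 : (2 : ℝ) ≤ (p : ℝ) ^ ε := by
        calc (2 : ℝ) = ((2 : ℝ) ^ (1 / ε)) ^ ε := by
              rw [← rpow_mul (by positivity), one_div_mul_cancel hε.ne', rpow_one]
          _ ≤ _ := by gcongr
      rw [one_mul, hpow]
      have h2 : e + 1 ≤ 2 ^ e := Nat.lt_two_pow_self
      calc ((e + 1 : ℕ) : ℝ) ≤ ((2 ^ e : ℕ) : ℝ) := by exact_mod_cast h2
        _ = 2 ^ e := by push_cast; ring
        _ ≤ _ := by gcongr
  rw [Nat.card_divisors hn]
  have hn' : ∏ p ∈ n.primeFactors, ((p : ℝ) ^ n.factorization p) = n := by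
    have := Nat.prod_factorization_pow_eq_self hn
    rw [Finsupp.prod, Nat.support_factorization] at this
    exact_mod_cast this
  calc ((∏ p ∈ n.primeFactors, (n.factorization p + 1) : ℕ) : ℝ)
      ≤ ∏ p ∈ n.primeFactors, (if p < Q then K else 1) * ((p : ℝ) ^ n.factorization p) ^ ε := by
        rw [Nat.cast_prod]
        exact Finset.prod_le_prod (fun _ _ => by positivity) hprime
    _ = (∏ p ∈ n.primeFactors, if p < Q then K else 1) * (n : ℝ) ^ ε := by
        rw [Finset.prod_mul_distrib, Real.finsetProd_rpow _ _ (fun _ _ => by positivity), hn']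
    _ ≤ K ^ Q * (n : ℝ) ^ ε := by
        gcongr
        rw [Finset.prod_ite, Finset.prod_const, Finset.prod_const_one, mul_one]
        refine pow_le_pow_right₀ hK1 ?_
        calc _ ≤ (Finset.range Q).card := Finset.card_le_card fun p hp => by
              simpa using (Finset.mem_filter.1 hp).2
          _ = Q := Finset.card_range Q

lemma dk_succ (k n : ℕ) : dk (k + 1) n = ∑ p ∈ n.divisorsAntidiagonal, dk k p.1 := by
  rw [dk, pow_succ, ArithmeticFunction.mul_apply]
  refine Finset.sum_congr rfl fun p hp => ?_
  have : p.2 ≠ 0 := by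
    rintro h
    rw [Nat.mem_divisorsAntidiagonal, h, mul_zero] at hp
    exact hp.2 hp.1.symm
  rw [ArithmeticFunction.zeta_apply_ne this, mul_one, dk]

lemma dk_le_rpow (k : ℕ) (ε : ℝ) (hε : 0 < ε) :
    ∃ C : ℝ, 1 ≤ C ∧ ∀ n : ℕ, n ≠ 0 → (dk k n : ℝ) ≤ C * (n : ℝ) ^ ε := by
  induction k generalizing ε with
  | zero =>
    refine ⟨1, le_rfl, fun n hn => ?_⟩
    have h1 : (1 : ℝ) ≤ (n : ℝ) ^ ε :=
      one_le_rpow (by exact_mod_cast Nat.one_le_iff_ne_zero.2 hn) hε.le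
    rw [dk, pow_zero, ArithmeticFunction.one_apply, one_mul]
    split_ifs
    · simpa using h1
    · simpa using by linarith
  | succ k ih =>
    obtain ⟨C₁, hC₁, h₁⟩ := ih (ε / 2) (by positivity)
    obtain ⟨C₂, hC₂, h₂⟩ := card_divisors_le_rpow (ε / 2) (by positivity)
    refine ⟨C₁ * C₂, one_le_mul_of_one_le_of_one_le hC₁ hC₂, fun n hn => ?_⟩
    have hn0 : (0 : ℝ) < n := by exact_mod_cast Nat.pos_of_ne_zero hn
    rw [dk_succ, Nat.cast_sum]
    calc ∑ p ∈ n.divisorsAntidiagonal, (dk k p.1 : ℝ)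
        ≤ ∑ p ∈ n.divisorsAntidiagonal, C₁ * (n : ℝ) ^ (ε / 2) := by
          refine Finset.sum_le_sum fun p hp => ?_
          have hpn := (Nat.mem_divisorsAntidiagonal.1 hp).1
          have hp1 : p.1 ≠ 0 := by
            rintro h
            rw [h, zero_mul] at hpn
            exact hn hpn.symm
          refine (h₁ _ hp1).trans ?_
          gcongr
          exact Nat.le_of_dvd (Nat.pos_of_ne_zero hn) ⟨_, hpn.symm⟩
      _ = n.divisors.card * (C₁ * (n : ℝ) ^ (ε / 2)) := by
          rw [Nat.sum_divisorsAntidiagonal (fun _ _ => C₁ * (n : ℝ) ^ (ε / 2)),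
            Finset.sum_const, nsmul_eq_mul]
      _ ≤ (C₂ * (n : ℝ) ^ (ε / 2)) * (C₁ * (n : ℝ) ^ (ε / 2)) := by
          gcongr
          exact h₂ n hn
      _ = C₁ * C₂ * ((n : ℝ) ^ (ε / 2) * (n : ℝ) ^ (ε / 2)) := by ring
      _ = _ := by rw [← rpow_add hn0, add_halves]

/-- The indicator function of an interval of positive integers. -/
def indIco (A B : ℕ) : ArithmeticFunction ℕ :=
  ⟨fun n => if 1 ≤ n ∧ A ≤ n ∧ n < B then 1 else 0, by simp⟩

lemma indIco_apply (A B n : ℕ) :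
    indIco A B n = if 1 ≤ n ∧ A ≤ n ∧ n < B then 1 else 0 := rfl

lemma indIco_pow_le_dk (A B j n : ℕ) : (indIco A B ^ j : ArithmeticFunction ℕ) n ≤ dk j n := by
  induction j generalizing n with
  | zero => simp [dk]
  | succ j ih =>
    rw [dk_succ, pow_succ, ArithmeticFunction.mul_apply]
    refine Finset.sum_le_sum fun p _ => ?_
    calc _ ≤ (indIco A B ^ j : ArithmeticFunction ℕ) p.1 * 1 := by
          gcongr
          rw [indIco_apply]
          split_ifs <;> simp
      _ ≤ _ := by simpa using ih _

lemma indIco_pow_support (A B j n : ℕ) (hn : (indIco A B ^ j : ArithmeticFunction ℕ) n ≠ 0) :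
    1 ≤ n ∧ A ^ j ≤ n ∧ n ≤ B ^ j := by
  induction j generalizing n with
  | zero =>
    rw [pow_zero, ArithmeticFunction.one_apply] at hn
    have : n = 1 := by
      by_contra h
      simp [h] at hn
    simp [this]
  | succ j ih =>
    rw [pow_succ, ArithmeticFunction.mul_apply] at hn
    obtain ⟨p, hp, hne⟩ := Finset.exists_ne_zero_of_sum_ne_zero hn
    have h1 := ih p.1 (left_ne_zero_of_mul hne)
    have h2 := right_ne_zero_of_mul hne
    rw [indIco_apply] at h2
    have h3 : 1 ≤ p.2 ∧ A ≤ p.2 ∧ p.2 < B := by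
      by_contra h
      simp [h] at h2
    rw [← (Nat.mem_divisorsAntidiagonal.1 hp).1, pow_succ, pow_succ]
    exact ⟨Nat.mul_pos h1.1 h3.1, Nat.mul_le_mul h1.2.1 h3.2.1, Nat.mul_le_mul h1.2.2 h3.2.2.le⟩

lemma lseriesHasSum_indIco_pow (A B j : ℕ) (hA : 1 ≤ A) (s : ℂ) :
    LSeriesHasSum (fun n => ((indIco A B ^ j : ArithmeticFunction ℕ) n : ℂ)) s
      ((∑ n ∈ Finset.Ico A B, (n : ℂ) ^ (-s)) ^ j) := by
  have h1 : LSeriesHasSum (fun n => ((indIco A B : ArithmeticFunction ℕ) n : ℂ)) s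
      (∑ n ∈ Finset.Ico A B, (n : ℂ) ^ (-s)) := by
    have : ∑ n ∈ Finset.Ico A B, (n : ℂ) ^ (-s) = ∑ n ∈ Finset.Ico A B,
        LSeries.term (fun n => ((indIco A B : ArithmeticFunction ℕ) n : ℂ)) s n := by
      refine Finset.sum_congr rfl fun n hn => ?_
      rw [Finset.mem_Ico] at hn
      have hn0 : n ≠ 0 := by omega
      rw [LSeries.term_of_ne_zero hn0, indIco_apply, if_pos ⟨by omega, hn.1, hn.2⟩,
        Complex.cpow_neg, Nat.cast_one, one_div]
    rw [this]
    refine hasSum_sum_of_ne_finset_zero fun n hn => ?_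
    rw [Finset.mem_Ico] at hn
    rcases eq_or_ne n 0 with rfl | hn0
    · simp
    rw [LSeries.term_of_ne_zero hn0, indIco_apply, if_neg (fun h => hn h.2)]
    simp
  induction j with
  | zero =>
    have e : (fun n => ((indIco A B ^ 0 : ArithmeticFunction ℕ) n : ℂ)) = LSeries.delta := by
      ext n
      simp [ArithmeticFunction.one_apply, LSeries.delta]
    rw [e, LSeriesHasSum, pow_zero, funext (LSeries.term_delta s)]
    exact hasSum_ite_eq 1 1
  | succ j ih =>
    have e : ∀ f g : ArithmeticFunction ℕ,
        (fun n => ((f * g : ArithmeticFunction ℕ) n : ℂ)) =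
        fun n => ((f : ArithmeticFunction ℂ) * (g : ArithmeticFunction ℂ)) n := by
      intro f g
      ext n
      rw [← ArithmeticFunction.natCoe_mul, ArithmeticFunction.natCoe_apply]
    rw [pow_succ, pow_succ, e]
    exact ArithmeticFunction.LSeriesHasSum_mul ih h1

lemma pow_sum_cpow (A B j : ℕ) (hA : 1 ≤ A) (s : ℂ) :
    (∑ n ∈ Finset.Ico A B, (n : ℂ) ^ (-s)) ^ j = ∑ n ∈ Finset.Icc 1 (B ^ j),
      ((indIco A B ^ j : ArithmeticFunction ℕ) n : ℂ) * (n : ℂ) ^ (-s) := by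
  refine HasSum.unique (lseriesHasSum_indIco_pow A B j hA s) ?_
  have : ∑ n ∈ Finset.Icc 1 (B ^ j),
      ((indIco A B ^ j : ArithmeticFunction ℕ) n : ℂ) * (n : ℂ) ^ (-s) =
      ∑ n ∈ Finset.Icc 1 (B ^ j),
        LSeries.term (fun n => ((indIco A B ^ j : ArithmeticFunction ℕ) n : ℂ)) s n := by
    refine Finset.sum_congr rfl fun n hn => ?_
    have hn0 : n ≠ 0 := by
      have := (Finset.mem_Icc.1 hn).1
      omega
    rw [LSeries.term_of_ne_zero hn0, Complex.cpow_neg, div_eq_mul_inv]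
  rw [this]
  refine hasSum_sum_of_ne_finset_zero fun n hn => ?_
  rcases eq_or_ne n 0 with rfl | hn0
  · simp
  have : (indIco A B ^ j : ArithmeticFunction ℕ) n = 0 := by
    by_contra h
    have := indIco_pow_support A B j n h
    exact hn (Finset.mem_Icc.2 ⟨this.1, this.2.2⟩)
  rw [LSeries.term_of_ne_zero hn0, this, Nat.cast_zero, zero_div]

lemma sum_inv_Icc_le (N : ℕ) : ∑ n ∈ Finset.Icc 1 N, (n : ℝ)⁻¹ ≤ 1 + log N := by
  have := harmonic_le_one_add_log N
  rw [harmonic_eq_sum_Icc] at this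
  push_cast at this
  exact this

lemma one_add_log_le_rpow (θ : ℝ) (hθ : 0 < θ) (x : ℝ) (hx : 1 ≤ x) :
    1 + log x ≤ (1 + 1 / θ) * x ^ θ := by
  have h1 := log_le_rpow_div (by linarith : 0 ≤ x) hθ
  have h2 : 1 ≤ x ^ θ := one_le_rpow hx hθ.le
  have : (1 + 1 / θ) * x ^ θ = x ^ θ + x ^ θ / θ := by ring
  linarith

lemma integral_norm_pow_sum_cpow_le (j : ℕ) (θ : ℝ) (hθ : 0 < θ) :
    ∃ C : ℝ, 0 < C ∧ ∀ A B : ℕ, 1 ≤ A → A ≤ B → ∀ σ W : ℝ, 0 ≤ W →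
      (∀ n : ℕ, 0 < n → A ^ j ≤ n → n ≤ B ^ j → (n : ℝ) ^ (1 - 2 * σ) ≤ W) → ∀ T₀ T : ℝ, 0 ≤ T →
      ∫ t in T₀..(T₀ + T), ‖∑ n ∈ Finset.Ico A B, (n : ℂ) ^ (-((σ : ℂ) + t * Complex.I))‖ ^ (2 * j)
        ≤ C * ((T + (B : ℝ) ^ j) * ((B : ℝ) ^ j) ^ θ * W) := by
  obtain ⟨C₁, hC₁, h₁⟩ := dk_le_rpow j (θ / 6) (by positivity)
  set K := 1 + 1 / (θ / 3) with hK
  have hK1 : 1 ≤ K := by rw [hK]; linarith [show 0 < 1 / (θ / 3) by positivity]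
  refine ⟨4 * K * (C₁ ^ 2 * K), by positivity, fun A B hA hAB σ W hW0 hW T₀ T hT => ?_⟩
  set M := B ^ j with hM
  have hM1 : 1 ≤ M := Nat.one_le_pow _ _ (by omega)
  have hMr : (1 : ℝ) ≤ M := by exact_mod_cast hM1
  rw [show (B : ℝ) ^ j = (M : ℝ) by rw [hM]; push_cast; rfl]
  set b : ℕ → ℂ := fun n =>
    ((indIco A B ^ j : ArithmeticFunction ℕ) n : ℂ) * (((n : ℝ) ^ (-σ) : ℝ) : ℂ) with hb
  have e : ∀ t : ℝ, ‖∑ n ∈ Finset.Ico A B, (n : ℂ) ^ (-((σ : ℂ) + t * Complex.I))‖ ^ (2 * j) =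
      ‖∑ n ∈ Finset.Icc 1 M, b n * phase (-(t * log n))‖ ^ 2 := by
    intro t
    rw [mul_comm 2 j, pow_mul, ← norm_pow, pow_sum_cpow A B j hA]
    congr 2
    refine Finset.sum_congr rfl fun n hn => ?_
    rw [natCast_cpow_eq_phase n (Finset.mem_Icc.1 hn).1, hb]
    ring
  simp_rw [e]
  refine (integral_norm_sq_dirichlet_le b M T₀ T hT).trans ?_
  have hlog := one_add_log_le_rpow (θ / 3) (by positivity) M hMr
  have hsum : ∑ n ∈ Finset.Icc 1 M, ‖b n‖ ^ 2 ≤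
      C₁ ^ 2 * (M : ℝ) ^ (θ / 3) * W * (1 + log M) := by
    calc ∑ n ∈ Finset.Icc 1 M, ‖b n‖ ^ 2 ≤ ∑ n ∈ Finset.Icc 1 M,
          C₁ ^ 2 * (M : ℝ) ^ (θ / 3) * W * (n : ℝ)⁻¹ := by
          refine Finset.sum_le_sum fun n hn => ?_
          obtain ⟨hn1, hnM⟩ := Finset.mem_Icc.1 hn
          have hn0 : (0 : ℝ) < n := by exact_mod_cast hn1
          by_cases hz : (indIco A B ^ j : ArithmeticFunction ℕ) n = 0
          · have hbn : b n = 0 := by simp [hb, hz]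
            rw [hbn, norm_zero, zero_pow two_ne_zero]
            positivity
          have hsup := (indIco_pow_support A B j n hz).2.1
          have hc : ((indIco A B ^ j : ArithmeticFunction ℕ) n : ℝ) ≤ C₁ * (M : ℝ) ^ (θ / 6) := by
            calc ((indIco A B ^ j : ArithmeticFunction ℕ) n : ℝ) ≤ dk j n := by
                  exact_mod_cast indIco_pow_le_dk A B j n
              _ ≤ C₁ * (n : ℝ) ^ (θ / 6) := h₁ n (by omega)
              _ ≤ _ := by gcongr
          have hnb : ‖b n‖ ≤ C₁ * (M : ℝ) ^ (θ / 6) * (n : ℝ) ^ (-σ) := by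
            rw [hb]
            simp only
            rw [norm_mul, Complex.norm_natCast, Complex.norm_real, Real.norm_eq_abs,
              abs_of_nonneg (by positivity)]
            gcongr
          have hpow : ((n : ℝ) ^ (-σ)) ^ 2 ≤ W * (n : ℝ)⁻¹ := by
            rw [← rpow_natCast, ← rpow_mul hn0.le,
              show -σ * ((2 : ℕ) : ℝ) = (1 - 2 * σ) + (-1) by push_cast; ring, rpow_add hn0,
              rpow_neg_one]
            exact mul_le_mul_of_nonneg_right (hW n hn1 hsup hnM) (by positivity)
          calc ‖b n‖ ^ 2 ≤ (C₁ * (M : ℝ) ^ (θ / 6) * (n : ℝ) ^ (-σ)) ^ 2 := by gcongr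
            _ = C₁ ^ 2 * ((M : ℝ) ^ (θ / 6) * (M : ℝ) ^ (θ / 6)) * ((n : ℝ) ^ (-σ)) ^ 2 := by ring
            _ = C₁ ^ 2 * (M : ℝ) ^ (θ / 3) * ((n : ℝ) ^ (-σ)) ^ 2 := by
              rw [← rpow_add (by linarith)]
              ring_nf
            _ ≤ C₁ ^ 2 * (M : ℝ) ^ (θ / 3) * (W * (n : ℝ)⁻¹) := by gcongr
            _ = _ := by ring
      _ ≤ _ := by
          rw [← Finset.mul_sum]
          gcongr
          exact sum_inv_Icc_le M
  have hlog0 : 0 ≤ log (M : ℝ) := log_nonneg hMr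
  have hMθ : 1 ≤ (M : ℝ) ^ (θ / 3) := one_le_rpow hMr (by positivity)
  calc (T + 4 * M * (1 + log M)) * ∑ n ∈ Finset.Icc 1 M, ‖b n‖ ^ 2
      ≤ (4 * (T + M) * (K * (M : ℝ) ^ (θ / 3))) *
        (C₁ ^ 2 * (M : ℝ) ^ (θ / 3) * W * (K * (M : ℝ) ^ (θ / 3))) := by
        have h5 : 1 ≤ K * (M : ℝ) ^ (θ / 3) := one_le_mul_of_one_le_of_one_le hK1 hMθ
        have h6 : T + 4 * M * (1 + log M) ≤ 4 * (T + M) * (K * (M : ℝ) ^ (θ / 3)) := by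
          have : T * 1 ≤ T * (K * (M : ℝ) ^ (θ / 3)) := by gcongr
          have : 4 * M * (1 + log M) ≤ 4 * M * (K * (M : ℝ) ^ (θ / 3)) := by gcongr
          nlinarith
        have h7 : C₁ ^ 2 * (M : ℝ) ^ (θ / 3) * W * (1 + log M) ≤
            C₁ ^ 2 * (M : ℝ) ^ (θ / 3) * W *
              (K * (M : ℝ) ^ (θ / 3)) := by gcongr
        gcongr
        exact hsum.trans h7
    _ = 4 * K * (C₁ ^ 2 * K) * ((T + M) * ((M : ℝ) ^ (θ / 3) * (M : ℝ) ^ (θ / 3) *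
          (M : ℝ) ^ (θ / 3)) * W) := by ring
    _ = _ := by
        rw [← rpow_add (by linarith), ← rpow_add (by linarith)]
        ring_nf

open Filter Topology in
/-- Shifting a contour integral between two vertical lines. -/
lemma integral_vertical_eq_of_differentiableOn {f : ℂ → ℂ} {a b : ℝ} (hab : a ≤ b)
    (hd : DifferentiableOn ℂ f {s | a ≤ s.re ∧ s.re ≤ b})
    (ha : MeasureTheory.Integrable fun y : ℝ => f (a + y * Complex.I))
    (hb : MeasureTheory.Integrable fun y : ℝ => f (b + y * Complex.I))
    {g : ℝ → ℝ} (hg : Tendsto g atTop (𝓝 0))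
    (hbd : ∀ x y : ℝ, a ≤ x → x ≤ b → 1 ≤ |y| → ‖f (x + y * Complex.I)‖ ≤ g |y|) :
    ∫ y : ℝ, f (a + y * Complex.I) = ∫ y : ℝ, f (b + y * Complex.I) := by
  have hla := MeasureTheory.intervalIntegral_tendsto_integral ha tendsto_neg_atTop_atBot tendsto_id
  have hlb := MeasureTheory.intervalIntegral_tendsto_integral hb tendsto_neg_atTop_atBot tendsto_id
  have hrect : ∀ T : ℝ, (∫ x : ℝ in a..b, f (x + (-T : ℝ) * Complex.I)) -
      (∫ x : ℝ in a..b, f (x + T * Complex.I)) + Complex.I •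
      (∫ y : ℝ in -T..T, f (b + y * Complex.I)) -
      Complex.I • (∫ y : ℝ in -T..T, f (a + y * Complex.I)) = 0 := by
    intro T
    have := Complex.integral_boundary_rect_eq_zero_of_differentiableOn f
      (⟨a, -T⟩ : ℂ) (⟨b, T⟩ : ℂ) (hd.mono fun s hs => by
        have h1 := hs.1
        simp only [Set.uIcc_of_le hab, Set.mem_preimage, Set.mem_Icc] at h1
        exact h1)
    exact this
  have hhor : ∀ T : ℝ, 1 ≤ |T| → ‖∫ x : ℝ in a..b, f (x + T * Complex.I)‖ ≤ g |T| * |b - a| := by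
    intro T hT
    refine intervalIntegral.norm_integral_le_of_norm_le_const fun x hx => ?_
    rw [Set.uIoc_of_le hab] at hx
    exact hbd x T hx.1.le hx.2 hT
  have hdiff : ∀ᶠ T : ℝ in atTop, ‖(∫ y : ℝ in -T..id T, f (b + y * Complex.I)) -
      ∫ y : ℝ in -T..id T, f (a + y * Complex.I)‖ ≤ 2 * (g T * |b - a|) := by
    filter_upwards [eventually_ge_atTop 1] with T hT
    have hT' : |T| = T := abs_of_nonneg (by linarith)
    have h1 := hhor T (by rwa [hT'])
    have h2 := hhor (-T) (by rwa [abs_neg, hT'])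
    rw [abs_neg, hT'] at h2
    rw [hT'] at h1
    have h3 := hrect T
    have h4 : Complex.I * ((∫ y : ℝ in -T..T, f (b + y * Complex.I)) -
        ∫ y : ℝ in -T..T, f (a + y * Complex.I)) =
        (∫ x : ℝ in a..b, f (x + T * Complex.I)) -
        ∫ x : ℝ in a..b, f (x + (-T : ℝ) * Complex.I) := by
      simp only [smul_eq_mul] at h3
      linear_combination h3
    have h5 := congrArg norm h4
    rw [norm_mul, Complex.norm_I, one_mul] at h5
    rw [id, h5]
    refine (norm_sub_le _ _).trans ?_
    linarith
  have hz : Tendsto (fun T => (∫ y : ℝ in -T..id T, f (b + y * Complex.I)) -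
      ∫ y : ℝ in -T..id T, f (a + y * Complex.I)) atTop (𝓝 0) := by
    refine squeeze_zero_norm' hdiff ?_
    have := (hg.mul_const |b - a|).const_mul 2
    simpa using this
  have := tendsto_nhds_unique hz (hlb.sub hla)
  exact (sub_eq_zero.1 this.symm).symm

/-- The factor `h` in the functional equation `ζ(1 - s) = h(s) ζ(s)`. -/
noncomputable def zetaFactor (s : ℂ) : ℂ :=
  2 * (2 * π) ^ (-s) * Complex.Gamma s * Complex.cos (π * s / 2)

lemma two_pi_ne_zero' : (2 * π : ℂ) ≠ 0 := by
  simp [Real.pi_ne_zero]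

lemma riemannZeta_one_sub_eq (s : ℂ) (hs : 0 < s.re) (hs1 : s ≠ 1) :
    riemannZeta (1 - s) = zetaFactor s * riemannZeta s := by
  refine riemannZeta_one_sub (fun n h => ?_) hs1
  have := congrArg Complex.re h
  simp at this
  have h0 : (0 : ℝ) ≤ n := Nat.cast_nonneg n
  linarith

lemma ne_neg_natCast_of_re_pos {s : ℂ} (hs : 0 < s.re) (m : ℕ) : s ≠ -m := by
  intro h
  have := congrArg Complex.re h
  simp at this
  have h0 : (0 : ℝ) ≤ m := Nat.cast_nonneg m
  linarith

lemma differentiableAt_zetaFactor (s : ℂ) (hs : 0 < s.re) : DifferentiableAt ℂ zetaFactor s := by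
  unfold zetaFactor
  have h1 : DifferentiableAt ℂ (fun s : ℂ => (2 * π : ℂ) ^ (-s)) s :=
    differentiableAt_id.neg.const_cpow (Or.inl two_pi_ne_zero')
  have h2 := Complex.differentiableAt_Gamma s (ne_neg_natCast_of_re_pos hs)
  fun_prop

lemma conj_two : (starRingEnd ℂ) 2 = 2 := map_ofNat _ 2

lemma zetaFactor_conj (s : ℂ) : zetaFactor (star s) = star (zetaFactor s) := by
  have h1 : (2 * π : ℂ) ^ (-(starRingEnd ℂ) s) = (starRingEnd ℂ) ((2 * π : ℂ) ^ (-s)) := by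
    have := Complex.conj_cpow (2 * π : ℂ) (-s) ?_
    · have h2 := Complex.cpow_conj (2 * π : ℂ) (-s) ?_
      · rw [map_neg] at h2
        rw [h2]
        simp [conj_two]
      · rw [show (2 * π : ℂ) = ((2 * π : ℝ) : ℂ) by push_cast; rfl, Complex.arg_ofReal_of_nonneg
          (by positivity)]
        exact Real.pi_pos.ne
    · rw [show (2 * π : ℂ) = ((2 * π : ℝ) : ℂ) by push_cast; rfl, Complex.arg_ofReal_of_nonneg
          (by positivity)]
      exact Real.pi_pos.ne
  have h3 : (π : ℂ) * (starRingEnd ℂ) s / 2 = (starRingEnd ℂ) (π * s / 2) := by simp [conj_two]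
  unfold zetaFactor
  change 2 * (2 * π : ℂ) ^ (-(starRingEnd ℂ) s) * Complex.Gamma ((starRingEnd ℂ) s) *
    Complex.cos (π * (starRingEnd ℂ) s / 2) = (starRingEnd ℂ) _
  rw [h1, Complex.Gamma_conj, h3, Complex.cos_conj]
  simp [conj_two]

lemma zetaFactor_mul_one_sub (s : ℂ) (hs : Complex.sin (π * s) ≠ 0) :
    zetaFactor s * zetaFactor (1 - s) = 1 := by
  have h1 := Complex.Gamma_mul_Gamma_one_sub s
  have h2 : (2 * π : ℂ) ^ (-s) * (2 * π : ℂ) ^ (-(1 - s)) = (2 * π : ℂ)⁻¹ := by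
    rw [← Complex.cpow_add _ _ two_pi_ne_zero', ← Complex.cpow_neg_one]
    ring_nf
  have h3 : Complex.cos (π * (1 - s) / 2) = Complex.sin (π * s / 2) := by
    rw [← Complex.cos_pi_div_two_sub]
    congr 1
    ring
  have h4 : Complex.sin (π * s) = 2 * Complex.sin (π * s / 2) * Complex.cos (π * s / 2) := by
    rw [← Complex.sin_two_mul]
    congr 1
    ring
  have hπ : (π : ℂ) ≠ 0 := by exact_mod_cast Real.pi_ne_zero
  unfold zetaFactor
  rw [h3]
  calc _ = 4 * ((2 * π : ℂ) ^ (-s) * (2 * π : ℂ) ^ (-(1 - s))) *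
        (Complex.Gamma s * Complex.Gamma (1 - s)) *
        (Complex.sin (π * s / 2) * Complex.cos (π * s / 2)) := by ring
    _ = 1 := by
      rw [h1, h2]
      have ha := right_ne_zero_of_mul (h4 ▸ hs)
      have hb := right_ne_zero_of_mul (left_ne_zero_of_mul (h4 ▸ hs))
      rw [h4]
      generalize Complex.sin (π * s / 2) = x at *
      generalize Complex.cos (π * s / 2) = y at *
      field_simp
      norm_num

lemma norm_zetaFactor_half (t : ℝ) : ‖zetaFactor (1 / 2 + t * Complex.I)‖ = 1 := by
  set s : ℂ := 1 / 2 + t * Complex.I with hs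
  have hstar : 1 - s = star s := by
    apply Complex.ext
    · simp [hs]
      norm_num
    · simp [hs]
  have hsin : Complex.sin (π * s) ≠ 0 := by
    rw [show (π : ℂ) * s = (π / 2) - (-(π * t : ℝ) : ℂ) * Complex.I by
      rw [hs]; push_cast; ring, Complex.sin_pi_div_two_sub,
      show (-(π * t : ℝ) : ℂ) = ((-(π * t) : ℝ) : ℂ) by push_cast; ring, Complex.cos_mul_I,
      ← Complex.ofReal_cosh]
    exact_mod_cast (Real.cosh_pos _).ne'
  have h1 := zetaFactor_mul_one_sub s hsin
  rw [hstar, zetaFactor_conj] at h1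
  have h2 := congrArg norm h1
  rw [norm_mul, norm_star, norm_one] at h2
  nlinarith [norm_nonneg (zetaFactor s)]

lemma norm_zetaFactor_three_halves (t : ℝ) :
    ‖zetaFactor (3 / 2 + t * Complex.I)‖ = ‖(1 / 2 + t * Complex.I : ℂ)‖ / (2 * π) := by
  set s : ℂ := 1 / 2 + t * Complex.I with hs
  have hs0 : s ≠ 0 := by
    intro h
    have := congrArg Complex.re h
    simp [hs] at this
  have e : (3 / 2 + t * Complex.I : ℂ) = s + 1 := by rw [hs]; ring
  have h1 : (2 * π : ℂ) ^ (-(s + 1)) = (2 * π : ℂ) ^ (-s) * (2 * π : ℂ)⁻¹ := by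
    rw [← Complex.cpow_neg_one, ← Complex.cpow_add _ _ two_pi_ne_zero']
    ring_nf
  have h2 : Complex.cos (π * (s + 1) / 2) = -Complex.sin (π * s / 2) := by
    rw [← Complex.cos_add_pi_div_two]
    congr 1
    ring
  have h3 : ‖Complex.sin (π * s / 2)‖ = ‖Complex.cos (π * s / 2)‖ := by
    have : (π : ℂ) * s / 2 = π / 2 - (starRingEnd ℂ) (π * s / 2) := by
      rw [hs]
      simp [conj_two]
      ring
    rw [this, Complex.sin_pi_div_two_sub, Complex.cos_conj, ← this, RCLike.norm_conj]
  have h4 := norm_zetaFactor_half t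
  rw [← hs] at h4
  unfold zetaFactor at h4 ⊢
  rw [e, h1, Complex.Gamma_add_one s hs0, h2]
  simp only [norm_mul, norm_neg, norm_inv] at h4 ⊢
  rw [h3]
  have h5 : ‖(2 : ℂ)‖ * ‖(π : ℂ)‖ = 2 * π := by
    simp [abs_of_pos Real.pi_pos]
  rw [h5]
  calc _ = (‖(2 : ℂ)‖ * ‖(2 * π : ℂ) ^ (-s)‖ * ‖Complex.Gamma s‖ * ‖Complex.cos (π * s / 2)‖) *
        (‖s‖ / (2 * π)) := by ring
    _ = _ := by rw [h4, one_mul]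

lemma norm_Gamma_le_of_re_pos (s : ℂ) (hs : 0 < s.re) :
    ‖Complex.Gamma s‖ ≤ Real.Gamma s.re := by
  rw [Complex.Gamma_eq_integral hs, Real.Gamma_eq_integral hs, Complex.GammaIntegral]
  refine (MeasureTheory.norm_integral_le_integral_norm _).trans (le_of_eq ?_)
  refine MeasureTheory.setIntegral_congr_fun measurableSet_Ioi fun x hx => ?_
  simp only [norm_mul, Complex.norm_real, Real.norm_eq_abs, abs_of_pos (Real.exp_pos _),
    Complex.norm_cpow_eq_rpow_re_of_pos hx, Complex.sub_re, Complex.one_re]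

lemma norm_cos_le_exp (s : ℂ) : ‖Complex.cos s‖ ≤ exp |s.im| := by
  have h : ∀ z : ℂ, ‖Complex.exp z‖ ≤ exp |z.re| := fun z => by
    rw [Complex.norm_exp]
    exact Real.exp_le_exp.2 (le_abs_self _)
  rw [Complex.cos, norm_div, Complex.norm_ofNat]
  have h1 := h (s * Complex.I)
  have h2 := h (-s * Complex.I)
  simp only [Complex.mul_re, Complex.neg_re, Complex.neg_im, Complex.I_re, Complex.I_im, mul_zero,
    mul_one, zero_sub, neg_neg, abs_neg] at h1 h2
  have := norm_add_le (Complex.exp (s * Complex.I)) (Complex.exp (-s * Complex.I))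
  rw [div_le_iff₀ (by norm_num)]
  linarith

lemma exists_Gamma_le : ∃ C : ℝ, 1 ≤ C ∧ ∀ s : ℂ, 1 / 2 ≤ s.re → s.re ≤ 3 / 2 →
    ‖Complex.Gamma s‖ ≤ C := by
  have hc : ContinuousOn Real.Gamma (Set.Icc (1 / 2) (3 / 2)) := fun x hx =>
    (Real.differentiableAt_Gamma fun m h => by
      have h0 : (0 : ℝ) ≤ m := Nat.cast_nonneg m
      have := hx.1
      rw [h] at this
      linarith).continuousAt.continuousWithinAt
  obtain ⟨C, hC⟩ := isCompact_Icc.exists_bound_of_continuousOn hc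
  refine ⟨max C 1, le_max_right _ _, fun s h1 h2 => ?_⟩
  refine (norm_Gamma_le_of_re_pos s (by linarith)).trans ?_
  exact (le_abs_self _).trans ((hC s.re ⟨h1, h2⟩).trans (le_max_left _ _))

/-- The partial sum of the zeta series over `n < Y`. -/
noncomputable def zetaSum (Y : ℕ) (s : ℂ) : ℂ := ∑ n ∈ Finset.Ico 1 Y, (n : ℂ) ^ (-s)

/-- `(1 - s) h(1 - s)`, where `h` is the factor in the functional equation. -/
noncomputable def dualFactor (s : ℂ) : ℂ :=
  2 * (2 * π) ^ (-(1 - s)) * Complex.Gamma (2 - s) * Complex.cos (π * (1 - s) / 2)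

/-- `(s - 1) (ζ(s) - A(s) - h(1 - s) A(1 - s))` for the partial sum `A` of `ζ`. -/
noncomputable def zetaRem₁ (Y : ℕ) (s : ℂ) : ℂ :=
  riemannZeta₁ s - (s - 1) * zetaSum Y s + dualFactor s * zetaSum Y (1 - s)

/-- `ζ(1 - s) - A(1 - s) - h(s) A(s)` for the partial sum `A` of `ζ`. -/
noncomputable def zetaRem (Y : ℕ) (s : ℂ) : ℂ :=
  riemannZeta (1 - s) - zetaSum Y (1 - s) - zetaFactor s * zetaSum Y s

/-- The integrand whose contour shift bounds the fourth moment of `ζ`. -/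
noncomputable def quarticKernel (Y : ℕ) (T : ℝ) (s : ℂ) : ℂ :=
  zetaRem₁ Y s ^ 2 * zetaRem Y s ^ 2 * s ^ 2 *
    Complex.exp ((s - 1 / 2 - T * Complex.I) ^ 2 / T ^ 2)

lemma sub_one_mul_riemannZeta {s : ℂ} (hs : s ≠ 1) : (s - 1) * riemannZeta s = riemannZeta₁ s := by
  rw [riemannZeta_eq_inv_sub_mul hs, ← mul_assoc, mul_inv_cancel₀ (sub_ne_zero.2 hs), one_mul]

lemma dualFactor_eq {s : ℂ} (hs : s ≠ 1) : dualFactor s = (1 - s) * zetaFactor (1 - s) := by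
  have : Complex.Gamma (2 - s) = (1 - s) * Complex.Gamma (1 - s) := by
    rw [← Complex.Gamma_add_one _ (sub_ne_zero.2 hs.symm)]
    congr 1
    ring
  rw [dualFactor, zetaFactor, this]
  ring

lemma zetaRem₁_eq (Y : ℕ) {s : ℂ} (hs : s ≠ 1) : zetaRem₁ Y s =
    (s - 1) * (riemannZeta s - zetaSum Y s - zetaFactor (1 - s) * zetaSum Y (1 - s)) := by
  rw [zetaRem₁, ← sub_one_mul_riemannZeta hs, dualFactor_eq hs]
  ring

lemma zetaRem_eq (Y : ℕ) {s : ℂ} (h0 : 0 < s.re) (hs : s ≠ 1) : zetaRem Y s =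
    zetaFactor s * (riemannZeta s - zetaSum Y s) - zetaSum Y (1 - s) := by
  rw [zetaRem, riemannZeta_one_sub_eq s h0 hs]
  ring

lemma differentiable_zetaSum (Y : ℕ) : Differentiable ℂ (zetaSum Y) := by
  unfold zetaSum
  refine Differentiable.fun_sum fun n hn => ?_
  have hn0 : (n : ℂ) ≠ 0 := by
    have := (Finset.mem_Ico.1 hn).1
    exact_mod_cast (by omega : n ≠ 0)
  exact differentiable_id.neg.const_cpow (Or.inl hn0)

lemma differentiableAt_quarticKernel (Y : ℕ) (T : ℝ) (s : ℂ) (h0 : 0 < s.re) (h2 : s.re < 2) :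
    DifferentiableAt ℂ (quarticKernel Y T) s := by
  have hA : Differentiable ℂ fun s => zetaSum Y (1 - s) :=
    (differentiable_zetaSum Y).comp (by fun_prop : Differentiable ℂ fun s : ℂ => 1 - s)
  have hX : DifferentiableAt ℂ dualFactor s := by
    unfold dualFactor
    have h1 : DifferentiableAt ℂ (fun s : ℂ => (2 * π : ℂ) ^ (-(1 - s))) s :=
      (by fun_prop : DifferentiableAt ℂ (fun s : ℂ => -(1 - s)) s).const_cpow
        (Or.inl two_pi_ne_zero')
    have h2 : DifferentiableAt ℂ (fun s : ℂ => Complex.Gamma (2 - s)) s :=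
      DifferentiableAt.comp s (Complex.differentiableAt_Gamma (2 - s) (ne_neg_natCast_of_re_pos
        (by simpa using h2))) (by fun_prop)
    fun_prop
  have hZ : DifferentiableAt ℂ (fun s => riemannZeta (1 - s)) s := by
    refine DifferentiableAt.comp s (differentiableAt_riemannZeta ?_) (by fun_prop)
    intro h
    have := congrArg Complex.re h
    simp at this
    rw [this] at h0
    simp at h0
  have hr1 : DifferentiableAt ℂ (zetaRem₁ Y) s := by
    unfold zetaRem₁
    have := (differentiable_riemannZeta₁ s)
    have := (differentiable_zetaSum Y s)
    have := hA s
    fun_prop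
  have hr : DifferentiableAt ℂ (zetaRem Y) s := by
    unfold zetaRem
    have := differentiableAt_zetaFactor s h0
    have := (differentiable_zetaSum Y s)
    have := hA s
    fun_prop
  unfold quarticKernel
  fun_prop

lemma zetaSum_conj (Y : ℕ) (s : ℂ) :
    zetaSum Y ((starRingEnd ℂ) s) = (starRingEnd ℂ) (zetaSum Y s) := by
  rw [zetaSum, zetaSum, map_sum]
  refine Finset.sum_congr rfl fun n _ => ?_
  have h := Complex.cpow_conj (n : ℂ) (-s) (by rw [Complex.natCast_arg]; exact Real.pi_pos.ne)
  rw [map_neg] at h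
  rw [h, Complex.conj_natCast]

lemma quarticKernel_half (Y : ℕ) (T : ℝ) (hT : 0 < T) (t : ℝ) :
    quarticKernel Y T ((1 / 2 : ℝ) + t * Complex.I) =
      ((‖(1 / 2 + t * Complex.I : ℂ)‖ ^ 4 * ‖zetaRem Y (1 / 2 + t * Complex.I)‖ ^ 4 *
        exp (-((t - T) / T) ^ 2) : ℝ) : ℂ) := by
  rw [show (((1 / 2 : ℝ) : ℂ) + t * Complex.I) = 1 / 2 + t * Complex.I by push_cast; ring]
  set s : ℂ := 1 / 2 + t * Complex.I with hs
  have hs1 : s ≠ 1 := by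
    intro h
    have := congrArg Complex.re h
    norm_num [hs] at this
  have hstar : 1 - s = (starRingEnd ℂ) s := by
    apply Complex.ext
    · simp [hs]
      norm_num
    · simp [hs]
  have hconj : (starRingEnd ℂ) (zetaRem Y s) =
      riemannZeta s - zetaSum Y s - zetaFactor (1 - s) * zetaSum Y (1 - s) := by
    have hf : zetaFactor ((starRingEnd ℂ) s) = (starRingEnd ℂ) (zetaFactor s) := zetaFactor_conj s
    rw [zetaRem, hstar, map_sub, map_sub, map_mul, riemannZeta_conj, zetaSum_conj, hf]
    simp
  have hsq : s * (s - 1) = -((‖s‖ ^ 2 : ℝ) : ℂ) := by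
    rw [show s - 1 = -(1 - s) by ring, hstar, mul_neg, Complex.mul_conj, Complex.normSq_eq_norm_sq]
  have hexp : Complex.exp ((s - 1 / 2 - T * Complex.I) ^ 2 / T ^ 2) =
      ((exp (-((t - T) / T) ^ 2) : ℝ) : ℂ) := by
    rw [Complex.ofReal_exp]
    congr 1
    have hT' : (T : ℂ) ≠ 0 := by exact_mod_cast hT.ne'
    push_cast
    rw [hs]
    field_simp
    ring_nf
    rw [Complex.I_sq]
    ring
  rw [quarticKernel, zetaRem₁_eq Y hs1, ← hconj, hexp]
  have hn : (starRingEnd ℂ) (zetaRem Y s) * zetaRem Y s = ((‖zetaRem Y s‖ ^ 2 : ℝ) : ℂ) := by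
    rw [mul_comm, Complex.mul_conj, Complex.normSq_eq_norm_sq]
  calc _ = (s * (s - 1)) ^ 2 * ((starRingEnd ℂ) (zetaRem Y s) * zetaRem Y s) ^ 2 *
        ((exp (-((t - T) / T) ^ 2) : ℝ) : ℂ) := by ring
    _ = _ := by
      rw [hsq, hn]
      push_cast
      ring

lemma norm_exp_kernel (x y T : ℝ) (hT : 0 < T) :
    ‖Complex.exp (((x : ℂ) + y * Complex.I - 1 / 2 - T * Complex.I) ^ 2 / T ^ 2)‖ =
      exp ((x - 1 / 2) ^ 2 / T ^ 2 - ((y - T) / T) ^ 2) := by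
  rw [Complex.norm_exp]
  congr 1
  have hT' : (T : ℂ) ≠ 0 := by exact_mod_cast hT.ne'
  have : ((x : ℂ) + y * Complex.I - 1 / 2 - T * Complex.I) ^ 2 / T ^ 2 =
      (((x - 1 / 2) ^ 2 / T ^ 2 - ((y - T) / T) ^ 2 : ℝ) : ℂ) +
        ((2 * (x - 1 / 2) * (y - T) / T ^ 2 : ℝ) : ℂ) * Complex.I := by
    push_cast
    field_simp
    ring_nf
    rw [Complex.I_sq]
    ring
  rw [this, Complex.add_re, Complex.ofReal_re, Complex.re_ofReal_mul, Complex.I_re, mul_zero,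
    add_zero]

lemma norm_quarticKernel_three_halves (Y : ℕ) (T : ℝ) (hT : 1 ≤ T) (t : ℝ) (s : ℂ)
    (hs : s = (3 / 2 : ℝ) + t * Complex.I) :
    ‖quarticKernel Y T s‖ ≤
      (‖s - 1‖ * ‖riemannZeta s - zetaSum Y s‖ + 7 * ‖zetaSum Y (1 - s)‖) ^ 4 * ‖s‖ ^ 2 *
        (exp 1 * exp (-((t - T) / T) ^ 2)) := by
  have hre : s.re = 3 / 2 := by simp [hs]
  have hs1 : s ≠ 1 := by
    intro h
    rw [h] at hre
    norm_num at hre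
  have hs' : s - 1 = 1 / 2 + t * Complex.I := by
    rw [hs]
    push_cast
    ring
  have hsub : ‖1 - s‖ = ‖s - 1‖ := norm_sub_rev _ _
  have hpos : 0 < ‖s - 1‖ := norm_pos_iff.2 (sub_ne_zero.2 hs1)
  have hf : ‖zetaFactor s‖ = ‖s - 1‖ / (2 * π) := by
    rw [hs', ← norm_zetaFactor_three_halves, hs]
    push_cast
    rfl
  have hsin : Complex.sin (π * s) ≠ 0 := by
    intro h
    have h4 : Complex.sin (π * s) = 2 * Complex.sin (π * s / 2) * Complex.cos (π * s / 2) := by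
      rw [← Complex.sin_two_mul]
      congr 1
      ring
    rw [h4] at h
    have h5 : (π : ℂ) * s = 3 * π / 2 + (π * t : ℝ) * Complex.I := by
      rw [hs]
      push_cast
      ring
    rw [← h4, h5, show (3 * π / 2 + (π * t : ℝ) * Complex.I : ℂ) =
      π / 2 - (-(π * t) : ℝ) * Complex.I + π by push_cast; ring, Complex.sin_add_pi,
      Complex.sin_pi_div_two_sub, Complex.cos_mul_I, ← Complex.ofReal_cosh, neg_eq_zero] at h
    exact (Real.cosh_pos _).ne' (by exact_mod_cast h)
  have hd : ‖dualFactor s‖ = 2 * π := by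
    have h1 := congrArg norm (zetaFactor_mul_one_sub s hsin)
    rw [norm_mul, norm_one, hf] at h1
    rw [dualFactor_eq hs1, norm_mul, hsub]
    field_simp at h1
    linarith
  have hπ := Real.pi_lt_d2
  have hπ3 := Real.pi_gt_three
  set b := ‖riemannZeta s - zetaSum Y s‖ with hb
  set α := ‖zetaSum Y (1 - s)‖ with hα
  have h1 : ‖zetaRem₁ Y s‖ ≤ ‖s - 1‖ * b + 7 * α := by
    rw [zetaRem₁, ← sub_one_mul_riemannZeta hs1, ← mul_sub]
    refine (norm_add_le _ _).trans ?_
    rw [norm_mul, norm_mul, hd]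
    gcongr
    linarith
  have h2 : ‖zetaRem Y s‖ ≤ ‖s - 1‖ * b + 7 * α := by
    rw [zetaRem_eq Y (by rw [hre]; norm_num) hs1]
    refine (norm_sub_le _ _).trans ?_
    rw [norm_mul, hf]
    have h3 : ‖s - 1‖ / (2 * π) * b ≤ ‖s - 1‖ * b := by
      gcongr
      exact div_le_self hpos.le (by linarith)
    have : 0 ≤ α := norm_nonneg _
    linarith
  have h3 : ‖Complex.exp ((s - 1 / 2 - T * Complex.I) ^ 2 / T ^ 2)‖ ≤
      exp 1 * exp (-((t - T) / T) ^ 2) := by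
    rw [hs, norm_exp_kernel _ _ _ (by linarith), ← Real.exp_add]
    refine Real.exp_le_exp.2 ?_
    have : ((3 / 2 : ℝ) - 1 / 2) ^ 2 / T ^ 2 ≤ 1 := by
      rw [div_le_one (by positivity)]
      nlinarith
    linarith
  rw [quarticKernel, norm_mul, norm_mul, norm_mul, norm_pow, norm_pow, norm_pow]
  calc _ ≤ (‖s - 1‖ * b + 7 * α) ^ 2 * (‖s - 1‖ * b + 7 * α) ^ 2 * ‖s‖ ^ 2 *
        (exp 1 * exp (-((t - T) / T) ^ 2)) := by gcongr
    _ = _ := by ring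

lemma norm_zetaSum_le (Y : ℕ) (s : ℂ) (hs : -1 ≤ s.re) :
    ‖zetaSum Y s‖ ≤ ∑ n ∈ Finset.Ico 1 Y, (n : ℝ) := by
  refine norm_sum_le_of_le _ fun n hn => ?_
  have hn1 : 1 ≤ n := (Finset.mem_Ico.1 hn).1
  rw [Complex.norm_natCast_cpow_of_pos hn1, Complex.neg_re]
  calc (n : ℝ) ^ (-s.re) ≤ (n : ℝ) ^ (1 : ℝ) :=
        rpow_le_rpow_of_exponent_le (by exact_mod_cast hn1) (by linarith)
    _ = n := rpow_one _

lemma norm_riemannZeta₁_le (s : ℂ) (hs : 1 / 2 ≤ s.re) :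
    ‖riemannZeta₁ s‖ ≤ 1 + 4 * (‖s - 1‖ * ‖s‖) := by
  simpa using norm_zeta_sub_sum_le hs 1 le_rfl

lemma norm_exp_kernel_mul_le (x y T : ℝ) (hT : 1 ≤ T) (hx1 : 1 / 2 ≤ x) (hx2 : x ≤ 3 / 2) :
    ‖Complex.exp (((x : ℂ) + y * Complex.I - 1 / 2 - T * Complex.I) ^ 2 / T ^ 2)‖ *
      exp |y| ^ 15 ≤ exp (15 * T + (15 * T) ^ 2 / 4 + 1) := by
  rw [norm_exp_kernel _ _ _ (by linarith), ← Real.exp_nat_mul, ← Real.exp_add]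
  refine Real.exp_le_exp.2 ?_
  have h1 : (x - 1 / 2) ^ 2 / T ^ 2 ≤ 1 := by
    rw [div_le_one (by positivity)]
    exact pow_le_pow_left₀ (by linarith) (by linarith) 2
  have h2 : |y| ≤ T + |y - T| := by
    calc |y| = |T + (y - T)| := by ring_nf
      _ ≤ _ := by
        refine (abs_add_le _ _).trans ?_
        rw [abs_of_nonneg (by linarith : 0 ≤ T)]
  have h3 : 15 * |y - T| ≤ (15 * T) ^ 2 / 4 + ((y - T) / T) ^ 2 := by
    have h4 : |y - T| = T * |(y - T) / T| := by
      rw [abs_div, abs_of_nonneg (by linarith : 0 ≤ T)]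
      field_simp
    rw [h4, ← sq_abs ((y - T) / T)]
    generalize |(y - T) / T| = v
    linarith [sq_nonneg (15 * T / 2 - v)]
  push_cast
  linarith

lemma norm_quarticKernel_decay (Y : ℕ) (T : ℝ) (hT : 1 ≤ T) : ∃ C : ℝ, ∀ x y : ℝ, 1 / 2 ≤ x →
    x ≤ 3 / 2 → 1 ≤ |y| → ‖quarticKernel Y T (x + y * Complex.I)‖ ≤ C * (1 + y ^ 2)⁻¹ := by
  obtain ⟨G, hG1, hG⟩ := exists_Gamma_le
  set K := ∑ n ∈ Finset.Ico 1 Y, (n : ℝ) with hK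
  have hK0 : 0 ≤ K := Finset.sum_nonneg fun _ _ => Nat.cast_nonneg _
  set K₁ := 9 + K + 14 * G * K with hK₁
  set K₂ := 2 * G * (9 + K) + K with hK₂
  set V := exp (15 * T + (15 * T) ^ 2 / 4 + 1) with hV
  refine ⟨K₁ ^ 2 * K₂ ^ 2 * 4 * V * 3, fun x y hx1 hx2 hy => ?_⟩
  set s : ℂ := x + y * Complex.I with hs
  have hre : s.re = x := by simp [hs]
  have him : s.im = y := by simp [hs]
  set e := exp |y| with he
  have he1 : 1 + |y| ≤ e := by
    have := add_one_le_exp |y|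
    linarith
  have hy0 := abs_nonneg y
  have he0 : 1 ≤ e := by linarith
  have hs1 : ‖s - 1‖ ≤ e := by
    refine (Complex.norm_le_abs_re_add_abs_im _).trans ?_
    simp only [Complex.sub_re, Complex.sub_im, Complex.one_re, Complex.one_im, hre, him, sub_zero]
    have : |x - 1| ≤ 1 / 2 := abs_le.2 ⟨by linarith, by linarith⟩
    linarith
  have hs0 : ‖s‖ ≤ 2 * e := by
    refine (Complex.norm_le_abs_re_add_abs_im _).trans ?_
    rw [hre, him, abs_of_nonneg (by linarith)]
    linarith
  have hs1' : 1 ≤ ‖s - 1‖ := by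
    have := Complex.abs_im_le_norm (s - 1)
    simp only [Complex.sub_im, Complex.one_im, him, sub_zero] at this
    linarith
  have hsne : s ≠ 1 := by
    rintro h
    rw [h] at hs1'
    simp at hs1'
    linarith
  have he2 : e ≤ e ^ 2 := le_self_pow₀ he0 (by norm_num)
  have he12 : 1 ≤ e ^ 2 := one_le_pow₀ he0
  have hz1 : ‖riemannZeta₁ s‖ ≤ 9 * e ^ 2 := by
    refine (norm_riemannZeta₁_le s (by rw [hre]; exact hx1)).trans ?_
    have : ‖s - 1‖ * ‖s‖ ≤ e * (2 * e) := by gcongr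
    nlinarith
  have hz : ‖riemannZeta s‖ ≤ 9 * e ^ 2 := by
    rw [← sub_one_mul_riemannZeta hsne, norm_mul] at hz1
    refine le_trans ?_ hz1
    exact le_mul_of_one_le_left (norm_nonneg _) hs1'
  have hA1 : ‖zetaSum Y s‖ ≤ K := norm_zetaSum_le Y s (by rw [hre]; linarith)
  have hA2 : ‖zetaSum Y (1 - s)‖ ≤ K :=
    norm_zetaSum_le Y (1 - s) (by simp only [Complex.sub_re, Complex.one_re, hre]; linarith)
  have hπ := Real.pi_lt_d2
  have hπ3 := Real.pi_gt_three
  have hcos : exp (π * |y| / 2) ≤ e ^ 2 := by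
    rw [he, ← Real.exp_nat_mul]
    refine Real.exp_le_exp.2 ?_
    push_cast
    nlinarith
  have h2π : (2 * π : ℂ) = ((2 * π : ℝ) : ℂ) := by push_cast; rfl
  have hf : ‖zetaFactor s‖ ≤ 2 * G * e ^ 2 := by
    have h1 : ‖(2 * π : ℂ) ^ (-s)‖ ≤ 1 := by
      rw [h2π, Complex.norm_cpow_eq_rpow_re_of_pos (by positivity), Complex.neg_re, hre]
      exact rpow_le_one_of_one_le_of_nonpos (by linarith) (by linarith)
    have h2 := hG s (by rw [hre]; exact hx1) (by rw [hre]; exact hx2)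
    have h3 := norm_cos_le_exp (π * s / 2)
    have h4 : (π * s / 2 : ℂ).im = π * y / 2 := by
      rw [show (π * s / 2 : ℂ) = ((π / 2 : ℝ) : ℂ) * s by push_cast; ring, Complex.im_ofReal_mul,
        him]
      ring
    rw [h4, abs_div, abs_mul, abs_of_pos Real.pi_pos, abs_two] at h3
    rw [zetaFactor, norm_mul, norm_mul, norm_mul, Complex.norm_ofNat]
    calc _ ≤ 2 * 1 * G * e ^ 2 := by
          gcongr
          exact h3.trans hcos
      _ = _ := by ring
  have hX : ‖dualFactor s‖ ≤ 14 * G * e ^ 2 := by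
    have h1 : ‖(2 * π : ℂ) ^ (-(1 - s))‖ ≤ 7 := by
      rw [h2π, Complex.norm_cpow_eq_rpow_re_of_pos (by positivity), Complex.neg_re, Complex.sub_re,
        Complex.one_re, hre]
      calc (2 * π) ^ (-(1 - x)) ≤ (2 * π) ^ (1 : ℝ) :=
            rpow_le_rpow_of_exponent_le (by linarith) (by linarith)
        _ ≤ 7 := by rw [rpow_one]; linarith
    have h2 := hG (2 - s) (by simp only [Complex.sub_re, Complex.re_ofNat, hre]; linarith)
      (by simp only [Complex.sub_re, Complex.re_ofNat, hre]; linarith)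
    have h3 := norm_cos_le_exp (π * (1 - s) / 2)
    have h4 : (π * (1 - s) / 2 : ℂ).im = -(π * y / 2) := by
      rw [show (π * (1 - s) / 2 : ℂ) = ((π / 2 : ℝ) : ℂ) * (1 - s) by push_cast; ring,
        Complex.im_ofReal_mul, Complex.sub_im, him, Complex.one_im]
      ring
    rw [h4, abs_neg, abs_div, abs_mul, abs_of_pos Real.pi_pos, abs_two] at h3
    rw [dualFactor, norm_mul, norm_mul, norm_mul, Complex.norm_ofNat]
    calc _ ≤ 2 * 7 * G * e ^ 2 := by
          gcongr
          exact h3.trans hcos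
      _ = _ := by ring
  have hr1 : ‖zetaRem₁ Y s‖ ≤ K₁ * e ^ 2 := by
    rw [zetaRem₁]
    refine (norm_add_le _ _).trans ?_
    refine (add_le_add_left (norm_sub_le _ _) _).trans ?_
    rw [norm_mul, norm_mul]
    calc _ ≤ 9 * e ^ 2 + e ^ 2 * K + 14 * G * e ^ 2 * K := by
          gcongr
          exact hs1.trans he2
      _ = _ := by rw [hK₁]; ring
  have hr : ‖zetaRem Y s‖ ≤ K₂ * e ^ 4 := by
    rw [zetaRem_eq Y (by rw [hre]; linarith) hsne]
    refine (norm_sub_le _ _).trans ?_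
    rw [norm_mul]
    have : ‖riemannZeta s - zetaSum Y s‖ ≤ (9 + K) * e ^ 2 := by
      refine (norm_sub_le _ _).trans ?_
      nlinarith
    calc _ ≤ 2 * G * e ^ 2 * ((9 + K) * e ^ 2) + K * 1 := by
          rw [mul_one]
          gcongr
      _ ≤ 2 * G * e ^ 2 * ((9 + K) * e ^ 2) + K * e ^ 4 := by
          gcongr
          exact one_le_pow₀ he0
      _ = _ := by rw [hK₂]; ring
  have hw : ‖Complex.exp ((s - 1 / 2 - T * Complex.I) ^ 2 / T ^ 2)‖ * e ^ 15 ≤ V :=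
    norm_exp_kernel_mul_le x y T hT hx1 hx2
  have hy2 : 1 + y ^ 2 ≤ 3 * e := by
    have := Real.quadratic_le_exp_of_nonneg hy0
    rw [← sq_abs y]
    nlinarith
  rw [quarticKernel, norm_mul, norm_mul, norm_mul, norm_pow, norm_pow, norm_pow,
    ← div_eq_mul_inv, le_div_iff₀ (by positivity)]
  calc _ ≤ (K₁ * e ^ 2) ^ 2 * (K₂ * e ^ 4) ^ 2 * (2 * e) ^ 2 *
        ‖Complex.exp ((s - 1 / 2 - T * Complex.I) ^ 2 / T ^ 2)‖ * (3 * e) := by gcongr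
    _ = K₁ ^ 2 * K₂ ^ 2 * 4 *
        (‖Complex.exp ((s - 1 / 2 - T * Complex.I) ^ 2 / T ^ 2)‖ * e ^ 15) * 3 := by ring
    _ ≤ _ := by gcongr

lemma integrable_of_decay {f : ℝ → ℂ} (hf : Continuous f) {C : ℝ}
    (hC : ∀ y : ℝ, 1 ≤ |y| → ‖f y‖ ≤ C * (1 + y ^ 2)⁻¹) : MeasureTheory.Integrable f := by
  obtain ⟨D, hD⟩ := (isCompact_Icc (a := (-1 : ℝ)) (b := 1)).exists_bound_of_continuousOn
    hf.continuousOn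
  refine MeasureTheory.Integrable.mono' (integrable_inv_one_add_sq.const_mul (max C (2 * D)))
    hf.aestronglyMeasurable (Filter.Eventually.of_forall fun y => ?_)
  rcases le_total 1 |y| with h | h
  · refine (hC y h).trans ?_
    gcongr
    exact le_max_left _ _
  · have h1 := hD y (abs_le.1 h)
    have hD0 : 0 ≤ D := (norm_nonneg _).trans h1
    rw [← div_eq_mul_inv, le_div_iff₀ (by positivity)]
    have : y ^ 2 ≤ 1 := by rw [← sq_abs]; exact pow_le_one₀ (abs_nonneg _) h
    calc ‖f y‖ * (1 + y ^ 2) ≤ D * 2 := by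
          gcongr
          linarith
      _ = 2 * D := by ring
      _ ≤ _ := le_max_right _ _

lemma integrable_quarticKernel (Y : ℕ) (T : ℝ) (hT : 1 ≤ T) (x : ℝ) (hx1 : 1 / 2 ≤ x)
    (hx2 : x ≤ 3 / 2) :
    MeasureTheory.Integrable fun y : ℝ => quarticKernel Y T (x + y * Complex.I) := by
  obtain ⟨C, hC⟩ := norm_quarticKernel_decay Y T hT
  refine integrable_of_decay ?_ (fun y hy => hC x y hx1 hx2 hy)
  refine continuous_iff_continuousAt.2 fun y => ?_
  refine ContinuousAt.comp (f := fun y : ℝ => (x : ℂ) + y * Complex.I)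
    (differentiableAt_quarticKernel Y T _ ?_ ?_).continuousAt (by fun_prop)
  · simp
    linarith
  · simp
    linarith

lemma continuous_zetaRem (Y : ℕ) :
    Continuous fun t : ℝ => zetaRem Y (1 / 2 + t * Complex.I) := by
  refine continuous_iff_continuousAt.2 fun t => ?_
  have hd : DifferentiableAt ℂ (zetaRem Y) (1 / 2 + t * Complex.I) := by
    have h0 : 0 < (1 / 2 + t * Complex.I : ℂ).re := by simp
    have hne : (1 - (1 / 2 + t * Complex.I) : ℂ) ≠ 1 := by
      intro h
      have := congrArg Complex.re h
      norm_num at this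
    have h1 := differentiableAt_zetaFactor _ h0
    have h2 : DifferentiableAt ℂ (fun s => riemannZeta (1 - s)) (1 / 2 + t * Complex.I) :=
      DifferentiableAt.comp _ (differentiableAt_riemannZeta hne) (by fun_prop)
    have h3 := differentiable_zetaSum Y (1 / 2 + t * Complex.I)
    have h4 : Differentiable ℂ fun s => zetaSum Y (1 - s) :=
      (differentiable_zetaSum Y).comp (by fun_prop : Differentiable ℂ fun s : ℂ => 1 - s)
    have h5 := h4 (1 / 2 + t * Complex.I)
    unfold zetaRem
    fun_prop
  exact ContinuousAt.comp (f := fun t : ℝ => (1 / 2 : ℂ) + t * Complex.I) hd.continuousAt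
    (by fun_prop)

lemma integral_zetaRem_le (Y : ℕ) (T : ℝ) (hT : 1 ≤ T) :
    T ^ 4 * exp (-1) * ∫ t in T..(2 * T), ‖zetaRem Y (1 / 2 + t * Complex.I)‖ ^ 4 ≤
      ∫ t : ℝ, ‖quarticKernel Y T ((3 / 2 : ℝ) + t * Complex.I)‖ := by
  have hT0 : 0 < T := by linarith
  obtain ⟨C, hC⟩ := norm_quarticKernel_decay Y T hT
  have hshift : ∫ y : ℝ, quarticKernel Y T ((1 / 2 : ℝ) + y * Complex.I) =
      ∫ y : ℝ, quarticKernel Y T ((3 / 2 : ℝ) + y * Complex.I) := by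
    refine integral_vertical_eq_of_differentiableOn (by norm_num) (fun s hs =>
        (differentiableAt_quarticKernel Y T s (by linarith [hs.1])
          (by linarith [hs.2])).differentiableWithinAt)
      (integrable_quarticKernel Y T hT _ (by norm_num) (by norm_num))
      (integrable_quarticKernel Y T hT _ (by norm_num) (by norm_num))
      (g := fun y => C * (1 + y ^ 2)⁻¹) ?_ ?_
    · rw [show (0 : ℝ) = C * 0 by ring]
      refine Filter.Tendsto.const_mul _ (Filter.Tendsto.inv_tendsto_atTop ?_)
      exact Filter.tendsto_atTop_add_const_left _ _ (Filter.tendsto_pow_atTop two_ne_zero)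
    · intro x y hx1 hx2 hy
      rw [sq_abs]
      exact hC x y hx1 hx2 hy
  have hint := integrable_quarticKernel Y T hT (1 / 2) (by norm_num) (by norm_num)
  set F : ℝ → ℝ := fun t => ‖(1 / 2 + t * Complex.I : ℂ)‖ ^ 4 *
    ‖zetaRem Y (1 / 2 + t * Complex.I)‖ ^ 4 * exp (-((t - T) / T) ^ 2) with hF
  have hFeq : ∀ t : ℝ, quarticKernel Y T ((1 / 2 : ℝ) + t * Complex.I) = (F t : ℂ) :=
    quarticKernel_half Y T hT0
  have hF0 : ∀ t, 0 ≤ F t := fun t => by rw [hF]; positivity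
  have hFn : ∀ t : ℝ, ‖quarticKernel Y T ((1 / 2 : ℝ) + t * Complex.I)‖ = F t := fun t => by
    rw [hFeq, Complex.norm_real, Real.norm_eq_abs, abs_of_nonneg (hF0 t)]
  have hFint : MeasureTheory.Integrable F := by
    have := hint.norm
    simpa only [hFn] using this
  have hF1 : ∫ t : ℝ, F t ≤ ∫ t : ℝ, ‖quarticKernel Y T ((3 / 2 : ℝ) + t * Complex.I)‖ := by
    have h1 : (((∫ t : ℝ, F t) : ℝ) : ℂ) = ∫ t : ℝ, quarticKernel Y T ((3 / 2 : ℝ) + t * Complex.I) := by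
      rw [← hshift, ← integral_complex_ofReal]
      exact (MeasureTheory.integral_congr_ae (Filter.Eventually.of_forall hFeq)).symm
    have h2 := MeasureTheory.norm_integral_le_integral_norm (μ := MeasureTheory.volume)
      (fun t : ℝ => quarticKernel Y T ((3 / 2 : ℝ) + t * Complex.I))
    rw [← h1, Complex.norm_real, Real.norm_eq_abs] at h2
    exact (le_abs_self _).trans h2
  refine le_trans ?_ hF1
  have hsub : ∫ t in T..(2 * T), F t ≤ ∫ t : ℝ, F t := by
    rw [intervalIntegral.integral_of_le (by linarith)]
    exact MeasureTheory.setIntegral_le_integral hFint (Filter.Eventually.of_forall hF0)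
  refine le_trans ?_ hsub
  rw [← intervalIntegral.integral_const_mul]
  have hcont := continuous_zetaRem Y
  refine intervalIntegral.integral_mono_on (by linarith)
    ((by fun_prop : Continuous _).intervalIntegrable _ _)
    (hFint.intervalIntegrable) fun t ht => ?_
  have h1 : T ≤ ‖(1 / 2 + t * Complex.I : ℂ)‖ := by
    have := Complex.abs_im_le_norm (1 / 2 + t * Complex.I : ℂ)
    simp at this
    exact ht.1.trans ((le_abs_self t).trans (by simpa using this))
  have h2 : exp (-1) ≤ exp (-((t - T) / T) ^ 2) := by
    refine Real.exp_le_exp.2 (neg_le_neg ?_)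
    refine pow_le_one₀ (div_nonneg (by linarith [ht.1]) hT0.le) ?_
    rw [div_le_one hT0]
    linarith [ht.2]
  calc T ^ 4 * exp (-1) * ‖zetaRem Y (1 / 2 + t * Complex.I)‖ ^ 4
      ≤ ‖(1 / 2 + t * Complex.I : ℂ)‖ ^ 4 * exp (-((t - T) / T) ^ 2) *
        ‖zetaRem Y (1 / 2 + t * Complex.I)‖ ^ 4 := by gcongr
    _ = F t := by rw [hF]; ring

/-- An integral against an exponentially decaying weight is controlled by the integrals over
windows of the length scale of the weight. -/
lemma integral_le_of_window_le {F f : ℝ → ℝ} (τ T M : ℝ) (hT : 0 < T)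
    (hF : MeasureTheory.Integrable F) (hf : Continuous f) (hf0 : ∀ t, 0 ≤ f t)
    (hFf : ∀ t, F t ≤ exp (-|t - τ| / T) * f t)
    (hM : ∀ T₀, ∫ t in T₀..(T₀ + T), f t ≤ M) : ∫ t, F t ≤ 4 * M := by
  have hM0 : 0 ≤ M := (intervalIntegral.integral_nonneg (by linarith) fun t _ => hf0 t).trans (hM 0)
  have hgeo : ∀ n : ℕ, ∑ k ∈ Finset.range n, exp (-(k : ℝ)) * M ≤ 2 * M := by
    intro n
    rw [← Finset.sum_mul]
    gcongr
    have h1 : ∀ k : ℕ, exp (-(k : ℝ)) ≤ (1 / 2 : ℝ) ^ k := by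
      intro k
      have : exp (-(k : ℝ)) = (exp (-1)) ^ k := by rw [← Real.exp_nat_mul]; ring_nf
      rw [this]
      gcongr
      rw [Real.exp_neg, one_div]
      gcongr
      linarith [add_one_le_exp (1 : ℝ)]
    calc _ ≤ ∑ k ∈ Finset.range n, (1 / 2 : ℝ) ^ k := Finset.sum_le_sum fun k _ => h1 k
      _ ≤ 2 := by
        have := sum_geometric_two_le n
        simpa using this
  have key : ∀ k : ℕ, ∀ c : ℝ, (∀ t ∈ Set.Icc c (c + T), k * T ≤ |t - τ|) →
      ∫ t in c..(c + T), F t ≤ exp (-(k : ℝ)) * M := by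
    intro k c hc
    calc ∫ t in c..(c + T), F t ≤ ∫ t in c..(c + T), exp (-(k : ℝ)) * f t := by
          refine intervalIntegral.integral_mono_on (by linarith) hF.intervalIntegrable
            ((by fun_prop : Continuous fun t => exp (-(k : ℝ)) * f t).intervalIntegrable _ _)
            fun t ht => (hFf t).trans ?_
          have := hc t ht
          refine mul_le_mul_of_nonneg_right (Real.exp_le_exp.2 ?_) (hf0 t)
          rw [div_le_iff₀ hT]
          linarith
      _ ≤ _ := by
          rw [intervalIntegral.integral_const_mul]
          exact mul_le_mul_of_nonneg_left (hM c) (Real.exp_pos _).le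
  have hright : ∀ n : ℕ, ∫ t in τ..(τ + n * T), F t ≤ 2 * M := by
    intro n
    have h1 := intervalIntegral.sum_integral_adjacent_intervals (f := F)
      (a := fun k : ℕ => τ + k * T) (n := n) (μ := MeasureTheory.volume)
      (fun k _ => hF.intervalIntegrable)
    simp only [Nat.cast_zero, zero_mul, add_zero] at h1
    rw [← h1]
    refine le_trans (Finset.sum_le_sum fun k _ => ?_) (hgeo n)
    have h2 := key k (τ + k * T) (fun t ht => by
      refine le_trans ?_ (le_abs_self _)
      linarith [ht.1])
    rw [show τ + ((k + 1 : ℕ) : ℝ) * T = τ + k * T + T by push_cast; ring]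
    exact h2
  have hleft : ∀ n : ℕ, ∫ t in (τ - n * T)..τ, F t ≤ 2 * M := by
    intro n
    have h1 := intervalIntegral.sum_integral_adjacent_intervals (f := F)
      (a := fun k : ℕ => τ - k * T) (n := n) (μ := MeasureTheory.volume)
      (fun k _ => hF.intervalIntegrable)
    simp only [Nat.cast_zero, zero_mul, sub_zero] at h1
    rw [intervalIntegral.integral_symm, ← h1, ← Finset.sum_neg_distrib]
    refine le_trans (Finset.sum_le_sum fun k _ => ?_) (hgeo n)
    rw [← intervalIntegral.integral_symm]
    have h2 := key k (τ - ((k + 1 : ℕ) : ℝ) * T) (fun t ht => by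
      have h3 := ht.2
      push_cast at h3
      rw [abs_sub_comm]
      refine le_trans ?_ (le_abs_self _)
      linarith)
    rw [show τ - ((k + 1 : ℕ) : ℝ) * T + T = τ - k * T by push_cast; ring] at h2
    exact h2
  have hlim := MeasureTheory.intervalIntegral_tendsto_integral hF
    (a := fun n : ℕ => τ - n * T) (b := fun n : ℕ => τ + n * T) (l := Filter.atTop)
    (by
      have h1 : Filter.Tendsto (fun n : ℕ => (n : ℝ) * T) Filter.atTop Filter.atTop :=
        tendsto_natCast_atTop_atTop.atTop_mul_const hT
      simpa [sub_eq_add_neg] using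
        Filter.tendsto_atBot_add_const_left _ τ (Filter.tendsto_neg_atTop_atBot.comp h1))
    (Filter.tendsto_atTop_add_const_left _ _ (tendsto_natCast_atTop_atTop.atTop_mul_const hT))
  refine le_of_tendsto' hlim fun n => ?_
  rw [← intervalIntegral.integral_add_adjacent_intervals (b := τ) hF.intervalIntegrable
    hF.intervalIntegrable]
  linarith [hright n, hleft n]

lemma exists_nat_sq_near (T : ℝ) (hT : 1 ≤ T) :
    ∃ Y : ℕ, 1 ≤ Y ∧ T ≤ (Y : ℝ) ^ 2 ∧ (Y : ℝ) ^ 2 ≤ 4 * T := by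
  have h0 : 0 ≤ T := by linarith
  have h1 : 1 ≤ √T := Real.one_le_sqrt.2 hT
  have h2 := Nat.le_ceil √T
  have h3 := Nat.ceil_lt_add_one (Real.sqrt_nonneg T)
  have h4 := Real.sq_sqrt h0
  refine ⟨⌈√T⌉₊, Nat.one_le_ceil_iff.2 (by linarith), ?_, ?_⟩
  · calc T = √T ^ 2 := h4.symm
      _ ≤ _ := by gcongr
  · calc (⌈√T⌉₊ : ℝ) ^ 2 ≤ (2 * √T) ^ 2 := by
          gcongr
          linarith
      _ = 4 * T := by rw [mul_pow, h4]; norm_num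

lemma exists_two_pow_near (T : ℝ) (hT : 1 ≤ T) :
    ∃ J : ℕ, T ^ 2 ≤ (2 : ℝ) ^ J ∧ (J : ℝ) ≤ 1 + 3 * log T := by
  obtain ⟨n, h1, h2⟩ := exists_nat_pow_near (one_le_pow₀ hT : (1 : ℝ) ≤ T ^ 2) one_lt_two
  refine ⟨n + 1, h2.le, ?_⟩
  have := le_three_mul_log_of_two_pow_le n T hT h1
  push_cast
  linarith

lemma pow_ten_mul_exp_le (r : ℝ) :
    (|r| + 4) ^ 10 * exp (-r ^ 2) ≤ (Nat.factorial 10 : ℝ) * exp 5 * exp (-|r|) := by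
  have h1 := Real.pow_div_factorial_le_exp (|r| + 4) (by positivity) 10
  rw [div_le_iff₀ (by positivity)] at h1
  calc (|r| + 4) ^ 10 * exp (-r ^ 2) ≤ exp (|r| + 4) * (Nat.factorial 10 : ℝ) * exp (-r ^ 2) := by
        gcongr
    _ = (Nat.factorial 10 : ℝ) * exp (|r| + 4 + -r ^ 2) := by rw [Real.exp_add (|r| + 4)]; ring
    _ ≤ (Nat.factorial 10 : ℝ) * exp (5 + -|r|) := by
        gcongr ?_ * exp ?_
        rw [← sq_abs r]
        nlinarith [sq_nonneg (|r| - 1)]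
    _ = _ := by rw [Real.exp_add 5]; ring

lemma add_add_pow_four_le (u v w : ℝ) : (u + v + w) ^ 4 ≤ 27 * (u ^ 4 + v ^ 4 + w ^ 4) := by
  have h1 : (u + v + w) ^ 2 ≤ 3 * (u ^ 2 + v ^ 2 + w ^ 2) := by
    nlinarith [sq_nonneg (u - v), sq_nonneg (v - w), sq_nonneg (u - w)]
  have h2 : (u ^ 2 + v ^ 2 + w ^ 2) ^ 2 ≤ 3 * (u ^ 4 + v ^ 4 + w ^ 4) := by
    nlinarith [sq_nonneg (u ^ 2 - v ^ 2), sq_nonneg (v ^ 2 - w ^ 2), sq_nonneg (u ^ 2 - w ^ 2)]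
  calc (u + v + w) ^ 4 = ((u + v + w) ^ 2) ^ 2 := by ring
    _ ≤ (3 * (u ^ 2 + v ^ 2 + w ^ 2)) ^ 2 := by gcongr
    _ = 9 * (u ^ 2 + v ^ 2 + w ^ 2) ^ 2 := by ring
    _ ≤ _ := by linarith

lemma norm_quarticKernel_le (Y : ℕ) (hY : 1 ≤ Y) (T : ℝ) (hT : 1 ≤ T) (N : ℕ) (hYN : Y ≤ N)
    (hN : T ^ 2 ≤ N) (t : ℝ) :
    ‖quarticKernel Y T ((3 / 2 : ℝ) + t * Complex.I)‖ ≤ exp (-|t - T| / T) *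
      ((Nat.factorial 10 : ℝ) * exp 6 * 27 * T ^ 2 *
        (T ^ 4 * ‖∑ n ∈ Finset.Ico Y N, (n : ℂ) ^ (-(((3 / 2 : ℝ) : ℂ) + t * Complex.I))‖ ^ 4 +
          5 ^ 4 + 7 ^ 4 * ‖zetaSum Y (((-1 / 2 : ℝ) : ℂ) + t * Complex.I)‖ ^ 4)) := by
  have hT0 : 0 < T := by linarith
  set s : ℂ := ((3 / 2 : ℝ) : ℂ) + t * Complex.I with hs
  set P := ∑ n ∈ Finset.Ico Y N, (n : ℂ) ^ (-s) with hP
  have hre : s.re = 3 / 2 := by simp [hs]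
  have him : s.im = t := by simp [hs]
  have hA : ‖zetaSum Y (1 - s)‖ = ‖zetaSum Y (((-1 / 2 : ℝ) : ℂ) + t * Complex.I)‖ := by
    rw [← Complex.norm_conj, ← zetaSum_conj]
    congr 2
    rw [map_sub, map_one, hs, map_add, map_mul, Complex.conj_ofReal, Complex.conj_ofReal,
      Complex.conj_I]
    push_cast
    ring
  set A := ‖zetaSum Y (((-1 / 2 : ℝ) : ℂ) + t * Complex.I)‖
  set r := (t - T) / T with hr
  have hrabs : |t - T| / T = |r| := by rw [hr, abs_div, abs_of_pos hT0]
  have ht : |t| ≤ T * (|r| + 1) := by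
    calc |t| = |(t - T) + T| := by ring_nf
      _ ≤ |t - T| + |T| := abs_add_le _ _
      _ = T * (|r| + 1) := by rw [← hrabs, abs_of_pos hT0]; field_simp
  have hr0 := abs_nonneg r
  set p := |r| + 4 with hp
  have hs0 : ‖s‖ ≤ p * T := by
    refine (Complex.norm_le_abs_re_add_abs_im _).trans ?_
    rw [hre, him, abs_of_nonneg (by norm_num)]
    nlinarith
  have hs1 : ‖s - 1‖ ≤ p * T := by
    refine (Complex.norm_le_abs_re_add_abs_im _).trans ?_
    simp only [Complex.sub_re, Complex.sub_im, Complex.one_re, Complex.one_im, hre, him, sub_zero]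
    rw [abs_of_nonneg (by norm_num)]
    nlinarith
  have hsne : s ≠ 1 := by
    intro h
    rw [h] at hre
    norm_num at hre
  have hN1 : 1 ≤ N := hY.trans hYN
  have hNr : (1 : ℝ) ≤ N := by exact_mod_cast hN1
  have hz : ‖s - 1‖ * ‖riemannZeta s - zetaSum Y s‖ ≤ p * T * ‖P‖ + 5 * p ^ 2 := by
    have h1 := norm_zeta_sub_sum_le (s := s) (by rw [hre]; norm_num) N hN1
    rw [← sub_one_mul_riemannZeta hsne, ← mul_sub] at h1
    have h2 : zetaSum Y s + P = ∑ m ∈ Finset.Ico 1 N, (m : ℂ) ^ (-s) :=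
      Finset.sum_Ico_consecutive _ hY hYN
    have h3 : (N : ℝ) ^ (1 - s.re) ≤ 1 := by
      rw [hre]
      exact rpow_le_one_of_one_le_of_nonpos hNr (by norm_num)
    have h4 : (N : ℝ) ^ (-s.re) ≤ (T ^ 2)⁻¹ := by
      calc (N : ℝ) ^ (-s.re) ≤ (N : ℝ) ^ (-1 : ℝ) :=
            rpow_le_rpow_of_exponent_le hNr (by rw [hre]; norm_num)
        _ = (N : ℝ)⁻¹ := rpow_neg_one _
        _ ≤ _ := by gcongr
    have h5 : ‖s - 1‖ * ‖s‖ * (N : ℝ) ^ (-s.re) ≤ p ^ 2 := by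
      calc ‖s - 1‖ * ‖s‖ * (N : ℝ) ^ (-s.re) ≤ (p * T) * (p * T) * (T ^ 2)⁻¹ := by gcongr
        _ = p ^ 2 := by field_simp
    have h6 : (1 : ℝ) ≤ p ^ 2 := one_le_pow₀ (by linarith)
    rw [← norm_mul]
    have h7 : (s - 1) * (riemannZeta s - zetaSum Y s) = (s - 1) * P +
        (s - 1) * (riemannZeta s - ∑ m ∈ Finset.Ico 1 N, (m : ℂ) ^ (-s)) := by
      rw [← h2]
      ring
    rw [h7]
    refine (norm_add_le _ _).trans ?_
    rw [norm_mul (s - 1) P]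
    have h8 : ‖s - 1‖ * ‖P‖ ≤ p * T * ‖P‖ := by gcongr
    linarith
  have h1 := norm_quarticKernel_three_halves Y T hT t s hs
  rw [hA] at h1
  refine h1.trans ?_
  have hp2 : p ≤ p ^ 2 := le_self_pow₀ (by linarith) (by norm_num)
  have hp21 : 1 ≤ p ^ 2 := one_le_pow₀ (by linarith)
  have hA0 : 0 ≤ A := norm_nonneg _
  have h2 : ‖s - 1‖ * ‖riemannZeta s - zetaSum Y s‖ + 7 * A ≤
      p ^ 2 * (T * ‖P‖ + 5 + 7 * A) := by
    calc _ ≤ p * T * ‖P‖ + 5 * p ^ 2 + 1 * (7 * A) := by linarith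
      _ ≤ p ^ 2 * T * ‖P‖ + 5 * p ^ 2 + p ^ 2 * (7 * A) := by gcongr
      _ = _ := by ring
  calc _ ≤ (p ^ 2 * (T * ‖P‖ + 5 + 7 * A)) ^ 4 * (p * T) ^ 2 * (exp 1 * exp (-r ^ 2)) := by gcongr
    _ = (p ^ 10 * exp (-r ^ 2)) * (exp 1 * T ^ 2 * (T * ‖P‖ + 5 + 7 * A) ^ 4) := by ring
    _ ≤ ((Nat.factorial 10 : ℝ) * exp 5 * exp (-|r|)) * (exp 1 * T ^ 2 *
        (27 * ((T * ‖P‖) ^ 4 + 5 ^ 4 + (7 * A) ^ 4))) := by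
        gcongr ?_ * (_ * ?_)
        · exact pow_ten_mul_exp_le r
        · exact add_add_pow_four_le _ _ _
    _ = _ := by
        rw [neg_div, hrabs, show (6 : ℝ) = 5 + 1 by norm_num, Real.exp_add 5 1]
        ring

lemma norm_sum_range_pow_four_le (J : ℕ) (z : ℕ → ℂ) :
    ‖∑ i ∈ Finset.range J, z i‖ ^ 4 ≤ (J : ℝ) ^ 3 * ∑ i ∈ Finset.range J, ‖z i‖ ^ 4 := by
  rcases Nat.eq_zero_or_pos J with rfl | hJ
  · simp
  have h := pow_sum_div_card_le_sum_pow (s := Finset.range J) (f := fun i => ‖z i‖)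
    (fun i _ => norm_nonneg _) 3
  rw [Finset.card_range, div_le_iff₀ (by positivity)] at h
  calc _ ≤ (∑ i ∈ Finset.range J, ‖z i‖) ^ 4 := by
        gcongr
        exact norm_sum_le _ _
    _ ≤ _ := by rw [mul_comm]; exact h

lemma continuous_sum_cpow (A B : ℕ) (hA : 1 ≤ A) (σ : ℝ) :
    Continuous fun t : ℝ => ∑ n ∈ Finset.Ico A B, (n : ℂ) ^ (-((σ : ℂ) + t * Complex.I)) := by
  refine continuous_finsetSum _ fun n hn => ?_
  have hn0 : (n : ℂ) ≠ 0 := by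
    have := (Finset.mem_Ico.1 hn).1
    exact_mod_cast (by omega : n ≠ 0)
  exact Continuous.const_cpow (by fun_prop) (Or.inl hn0)

lemma integral_tail_sum_pow_four_le (θ : ℝ) (hθ : 0 < θ) (hθ1 : θ ≤ 1) : ∃ C : ℝ, 0 < C ∧
    ∀ T : ℝ, 1 ≤ T → ∀ Y : ℕ, 1 ≤ Y → T ≤ (Y : ℝ) ^ 2 → ∀ J : ℕ, ∀ T₀ : ℝ,
      ∫ t in T₀..(T₀ + T), ‖∑ n ∈ Finset.Ico Y (2 ^ J * Y),
        (n : ℂ) ^ (-(((3 / 2 : ℝ) : ℂ) + t * Complex.I))‖ ^ 4 ≤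
          C * ((J : ℝ) ^ 4 * T ^ (θ - 1)) := by
  obtain ⟨C, hC, h⟩ := integral_norm_pow_sum_cpow_le 2 θ hθ
  refine ⟨20 * C, by positivity, fun T hT Y hY hTY J T₀ => ?_⟩
  have hT0 : 0 < T := by linarith
  set z : ℕ → ℝ → ℂ := fun i t => ∑ n ∈ Finset.Ico (2 ^ i * Y) (2 ^ (i + 1) * Y),
    (n : ℂ) ^ (-(((3 / 2 : ℝ) : ℂ) + t * Complex.I)) with hz
  have hY' : ∀ i, 1 ≤ 2 ^ i * Y := fun i => Nat.mul_pos (by positivity) hY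
  have hzc : ∀ i, Continuous (z i) := fun i => continuous_sum_cpow _ _ (hY' i) _
  have hsum : ∀ t : ℝ, ∑ n ∈ Finset.Ico Y (2 ^ J * Y),
      (n : ℂ) ^ (-(((3 / 2 : ℝ) : ℂ) + t * Complex.I)) = ∑ i ∈ Finset.range J, z i t := by
    intro t
    have hmono : Monotone fun i : ℕ => 2 ^ i * Y := fun i j hij =>
      Nat.mul_le_mul_right _ (Nat.pow_le_pow_right (by norm_num) hij)
    rw [Finset.range_eq_Ico]
    induction J with
    | zero => simp
    | succ n ih =>
      rw [Finset.sum_Ico_succ_top (Nat.zero_le _), ← ih, hz]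
      refine (Finset.sum_Ico_consecutive _ ?_ ?_).symm
      · simpa using hmono (Nat.zero_le n)
      · exact hmono (Nat.le_succ n)
  have hblock : ∀ i, ∫ t in T₀..(T₀ + T), ‖z i t‖ ^ 4 ≤ 20 * C * T ^ (θ - 1) := by
    intro i
    set A := 2 ^ i * Y with hA
    have hA1 : (1 : ℝ) ≤ A := by exact_mod_cast hY' i
    have hA0 : (0 : ℝ) < A := by linarith
    have hTA : T ≤ (A : ℝ) ^ 2 := by
      refine hTY.trans ?_
      gcongr
      exact Nat.le_mul_of_pos_left _ (by positivity)
    have hB : 2 ^ (i + 1) * Y = 2 * A := by rw [hA]; ring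
    have h1 := h A (2 * A) (hY' i) (by omega) (3 / 2) (((A : ℝ) ^ 2) ^ (-2 : ℝ)) (by positivity)
      (fun n hn hAn _ => by
        rw [show (1 - 2 * (3 / 2) : ℝ) = -2 by norm_num]
        exact rpow_le_rpow_of_nonpos (by positivity) (by exact_mod_cast hAn) (by norm_num))
      T₀ T hT0.le
    have h2 : ∀ t, z i t = ∑ n ∈ Finset.Ico A (2 * A),
        (n : ℂ) ^ (-(((3 / 2 : ℝ) : ℂ) + t * Complex.I)) := fun t => by rw [← hB]
    simp only [h2]
    refine h1.trans ?_
    push_cast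
    have h3 : ((2 * A : ℝ) ^ 2) ^ θ ≤ 4 * ((A : ℝ) ^ 2) ^ θ := by
      rw [mul_pow, mul_rpow (by norm_num) (by positivity)]
      gcongr
      calc ((2 : ℝ) ^ 2) ^ θ ≤ ((2 : ℝ) ^ 2) ^ (1 : ℝ) :=
            rpow_le_rpow_of_exponent_le (by norm_num) hθ1
        _ = 4 := by norm_num
    calc C * ((T + (2 * A : ℝ) ^ 2) * ((2 * A : ℝ) ^ 2) ^ θ * ((A : ℝ) ^ 2) ^ (-2 : ℝ))
        ≤ C * ((5 * (A : ℝ) ^ 2) * (4 * ((A : ℝ) ^ 2) ^ θ) * ((A : ℝ) ^ 2) ^ (-2 : ℝ)) := by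
          gcongr
          linarith
      _ = 20 * C * (((A : ℝ) ^ 2) ^ (1 : ℝ) * ((A : ℝ) ^ 2) ^ θ * ((A : ℝ) ^ 2) ^ (-2 : ℝ)) := by
          rw [rpow_one]
          ring
      _ = 20 * C * ((A : ℝ) ^ 2) ^ (θ - 1) := by
          rw [← rpow_add (by positivity), ← rpow_add (by positivity)]
          congr 2
          ring
      _ ≤ 20 * C * T ^ (θ - 1) :=
          mul_le_mul_of_nonneg_left (rpow_le_rpow_of_nonpos hT0 hTA (by linarith)) (by positivity)
  simp only [hsum]
  calc ∫ t in T₀..(T₀ + T), ‖∑ i ∈ Finset.range J, z i t‖ ^ 4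
      ≤ ∫ t in T₀..(T₀ + T), (J : ℝ) ^ 3 * ∑ i ∈ Finset.range J, ‖z i t‖ ^ 4 := by
        refine intervalIntegral.integral_mono_on (by linarith)
          (Continuous.intervalIntegrable (by fun_prop) _ _)
          (Continuous.intervalIntegrable (by fun_prop) _ _)
          fun t _ => norm_sum_range_pow_four_le J fun i => z i t
    _ = (J : ℝ) ^ 3 * ∑ i ∈ Finset.range J, ∫ t in T₀..(T₀ + T), ‖z i t‖ ^ 4 := by
        rw [intervalIntegral.integral_const_mul, intervalIntegral.integral_finsetSum]
        exact fun i _ => Continuous.intervalIntegrable (by fun_prop) _ _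
    _ ≤ (J : ℝ) ^ 3 * ∑ i ∈ Finset.range J, 20 * C * T ^ (θ - 1) := by
        gcongr with i
        exact hblock i
    _ = _ := by
        rw [Finset.sum_const, Finset.card_range, nsmul_eq_mul]
        ring

lemma integral_zetaSum_pow_four_le (θ : ℝ) (hθ : 0 < θ) (hθ1 : θ ≤ 1) : ∃ C : ℝ, 0 < C ∧
    ∀ T : ℝ, 1 ≤ T → ∀ Y : ℕ, 1 ≤ Y → (Y : ℝ) ^ 2 ≤ 4 * T → ∀ T₀ : ℝ,
      ∫ t in T₀..(T₀ + T), ‖zetaSum Y (((-1 / 2 : ℝ) : ℂ) + t * Complex.I)‖ ^ 4 ≤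
          C * T ^ (3 + θ) ∧
      ∫ t in T₀..(T₀ + T), ‖zetaSum Y (((1 / 2 : ℝ) : ℂ) + t * Complex.I)‖ ^ 4 ≤
          C * T ^ (1 + θ) := by
  obtain ⟨C, hC, h⟩ := integral_norm_pow_sum_cpow_le 2 θ hθ
  refine ⟨320 * C, by positivity, fun T hT Y hY hYT T₀ => ?_⟩
  have hT0 : 0 < T := by linarith
  have hY1 : (1 : ℝ) ≤ Y := by exact_mod_cast hY
  have h3 : ((Y : ℝ) ^ 2) ^ θ ≤ 4 * T ^ θ := by
    calc ((Y : ℝ) ^ 2) ^ θ ≤ (4 * T) ^ θ := by gcongr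
      _ = 4 ^ θ * T ^ θ := mul_rpow (by norm_num) hT0.le
      _ ≤ 4 ^ (1 : ℝ) * T ^ θ := by
          gcongr
          norm_num
      _ = 4 * T ^ θ := by rw [rpow_one]
  have key : ∀ σ W : ℝ, 0 ≤ W →
      (∀ n : ℕ, 0 < n → 1 ^ 2 ≤ n → n ≤ Y ^ 2 → (n : ℝ) ^ (1 - 2 * σ) ≤ W) →
      ∫ t in T₀..(T₀ + T), ‖zetaSum Y ((σ : ℂ) + t * Complex.I)‖ ^ 4 ≤
        20 * C * T ^ (1 + θ) * W := by
    intro σ W hW0 hW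
    refine (h 1 Y le_rfl hY σ W hW0 hW T₀ T hT0.le).trans ?_
    calc C * ((T + (Y : ℝ) ^ 2) * ((Y : ℝ) ^ 2) ^ θ * W) ≤ C * ((5 * T) * (4 * T ^ θ) * W) := by
          gcongr
          linarith
      _ = 20 * C * (T ^ (1 : ℝ) * T ^ θ) * W := by
          rw [rpow_one]
          ring
      _ = _ := by rw [← rpow_add hT0]
  constructor
  · refine (key (-1 / 2) (16 * T ^ 2) (by positivity) fun n hn _ hnY => ?_).trans (le_of_eq ?_)
    · have hn2 : (n : ℝ) ≤ (Y : ℝ) ^ 2 := by exact_mod_cast hnY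
      rw [show (1 - 2 * (-1 / 2) : ℝ) = (2 : ℕ) by norm_num, rpow_natCast]
      calc (n : ℝ) ^ 2 ≤ (4 * T) ^ 2 := by
            gcongr
            linarith
        _ = 16 * T ^ 2 := by ring
    · rw [show (3 + θ : ℝ) = (1 + θ) + (2 : ℕ) by push_cast; ring, rpow_add hT0 (1 + θ), rpow_natCast]
      ring
  · refine (key (1 / 2) 1 zero_le_one fun n hn _ hnY => ?_).trans ?_
    · norm_num
    · rw [mul_one]
      gcongr
      norm_num

lemma continuous_zetaSum (Y : ℕ) (σ : ℝ) :
    Continuous fun t : ℝ => zetaSum Y ((σ : ℂ) + t * Complex.I) :=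
  continuous_sum_cpow 1 Y le_rfl σ

lemma integral_quarticKernel_le (θ : ℝ) (hθ : 0 < θ) (hθ1 : θ ≤ 1) : ∃ C : ℝ, 0 < C ∧
    ∀ T : ℝ, 1 ≤ T → ∀ Y : ℕ, 1 ≤ Y → T ≤ (Y : ℝ) ^ 2 → (Y : ℝ) ^ 2 ≤ 4 * T →
      ∫ t : ℝ, ‖quarticKernel Y T ((3 / 2 : ℝ) + t * Complex.I)‖ ≤ C * T ^ (5 + 5 * θ) := by
  obtain ⟨C₁, hC₁, h₁⟩ := integral_tail_sum_pow_four_le θ hθ hθ1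
  obtain ⟨C₂, hC₂, h₂⟩ := integral_zetaSum_pow_four_le θ hθ hθ1
  set D : ℝ := (Nat.factorial 10 : ℝ) * exp 6 * 27 with hD
  set K : ℝ := 3 * (1 + 1 / θ) with hK
  have hD0 : 0 < D := by rw [hD]; positivity
  refine ⟨4 * (D * (C₁ * K ^ 4 + 5 ^ 4 + 7 ^ 4 * C₂)), by positivity,
    fun T hT Y hY hTY hYT => ?_⟩
  have hT0 : 0 < T := by linarith
  obtain ⟨J, hJ1, hJ2⟩ := exists_two_pow_near T hT
  have hJK : (J : ℝ) ≤ K * T ^ θ := by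
    have := one_add_log_le_rpow θ hθ T hT
    have h0 := Real.log_nonneg hT
    calc (J : ℝ) ≤ 3 * (1 + log T) := by linarith
      _ ≤ 3 * ((1 + 1 / θ) * T ^ θ) := by gcongr
      _ = _ := by rw [hK]; ring
  have hYN : Y ≤ 2 ^ J * Y := Nat.le_mul_of_pos_left _ (by positivity)
  have hN : T ^ 2 ≤ ((2 ^ J * Y : ℕ) : ℝ) := by
    push_cast
    refine hJ1.trans (le_mul_of_one_le_right (by positivity) (by exact_mod_cast hY))
  set P : ℝ → ℂ := fun t => ∑ n ∈ Finset.Ico Y (2 ^ J * Y),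
    (n : ℂ) ^ (-(((3 / 2 : ℝ) : ℂ) + t * Complex.I)) with hP
  have hPc : Continuous P := continuous_sum_cpow _ _ hY _
  have hAc := continuous_zetaSum Y (-1 / 2)
  set A : ℝ → ℂ := fun t => zetaSum Y (((-1 / 2 : ℝ) : ℂ) + t * Complex.I) with hA
  have hmain := integral_le_of_window_le (F := fun t : ℝ =>
      ‖quarticKernel Y T ((3 / 2 : ℝ) + t * Complex.I)‖)
    (f := fun t => D * T ^ 2 * (T ^ 4 * ‖P t‖ ^ 4 + 5 ^ 4 + 7 ^ 4 * ‖A t‖ ^ 4)) T T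
    ((D * (C₁ * K ^ 4 + 5 ^ 4 + 7 ^ 4 * C₂)) * T ^ (5 + 5 * θ)) hT0
    (integrable_quarticKernel Y T hT _ (by norm_num) (by norm_num)).norm (by fun_prop)
    (fun t => by positivity) (fun t => norm_quarticKernel_le Y hY T hT _ hYN hN t) ?_
  · linarith
  · intro T₀
    have hP4 := h₁ T hT Y hY hTY J T₀
    have hA4 := (h₂ T hT Y hY hYT T₀).1
    rw [intervalIntegral.integral_const_mul, intervalIntegral.integral_add
      (Continuous.intervalIntegrable (by fun_prop) _ _)
      (Continuous.intervalIntegrable (by fun_prop) _ _), intervalIntegral.integral_add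
      (Continuous.intervalIntegrable (by fun_prop) _ _)
      (Continuous.intervalIntegrable (by fun_prop) _ _), intervalIntegral.integral_const_mul,
      intervalIntegral.integral_const_mul, intervalIntegral.integral_const, add_sub_cancel_left,
      smul_eq_mul]
    have hJ4 : (J : ℝ) ^ 4 * T ^ (θ - 1) ≤ K ^ 4 * T ^ (5 * θ - 1) := by
      calc (J : ℝ) ^ 4 * T ^ (θ - 1) ≤ (K * T ^ θ) ^ 4 * T ^ (θ - 1) := by gcongr
        _ = K ^ 4 * (T ^ (θ * (4 : ℕ)) * T ^ (θ - 1)) := by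
            rw [rpow_mul_natCast hT0.le]
            ring
        _ = _ := by
            rw [← rpow_add hT0]
            congr 2
            push_cast
            ring
    have e1 : T ^ 4 * (C₁ * (K ^ 4 * T ^ (5 * θ - 1))) = C₁ * K ^ 4 * T ^ (3 + 5 * θ) := by
      rw [show (3 + 5 * θ : ℝ) = (5 * θ - 1) + (4 : ℕ) by push_cast; ring, rpow_add hT0,
        rpow_natCast]
      ring
    have e2 : T ≤ T ^ (3 + 5 * θ) := by
      conv_lhs => rw [← rpow_one T]
      exact rpow_le_rpow_of_exponent_le hT (by linarith)
    have e3 : T ^ (3 + θ) ≤ T ^ (3 + 5 * θ) := rpow_le_rpow_of_exponent_le hT (by linarith)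
    calc _ ≤ D * T ^ 2 * (T ^ 4 * (C₁ * (K ^ 4 * T ^ (5 * θ - 1))) + T * 5 ^ 4 +
          7 ^ 4 * (C₂ * T ^ (3 + θ))) := by
          gcongr
          exact hP4.trans (by gcongr)
      _ ≤ D * T ^ 2 * (C₁ * K ^ 4 * T ^ (3 + 5 * θ) + T ^ (3 + 5 * θ) * 5 ^ 4 +
          7 ^ 4 * (C₂ * T ^ (3 + 5 * θ))) := by
          rw [e1]
          gcongr
      _ = _ := by
          rw [show (5 + 5 * θ : ℝ) = (3 + 5 * θ) + (2 : ℕ) by push_cast; ring,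
            rpow_add hT0 (3 + 5 * θ), rpow_natCast]
          ring

lemma norm_zeta_half_le (Y : ℕ) (t : ℝ) : ‖riemannZeta (1 / 2 + t * Complex.I)‖ ≤
    ‖zetaRem Y (1 / 2 + t * Complex.I)‖ +
      2 * ‖zetaSum Y (((1 / 2 : ℝ) : ℂ) + t * Complex.I)‖ := by
  have e : (((1 / 2 : ℝ) : ℂ) + t * Complex.I) = 1 / 2 + t * Complex.I := by push_cast; ring
  rw [e]
  set s : ℂ := 1 / 2 + t * Complex.I with hs
  have hc : 1 - s = (starRingEnd ℂ) s := by
    rw [← e, map_add, map_mul, Complex.conj_ofReal, Complex.conj_ofReal, Complex.conj_I]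
    push_cast
    ring
  have h1 : (starRingEnd ℂ) (riemannZeta s) =
      zetaRem Y s + (starRingEnd ℂ) (zetaSum Y s) + zetaFactor s * zetaSum Y s := by
    rw [zetaRem, hc, riemannZeta_conj, zetaSum_conj]
    ring
  rw [← Complex.norm_conj, h1]
  refine (norm_add_le _ _).trans ?_
  have h2 := norm_add_le (zetaRem Y s) ((starRingEnd ℂ) (zetaSum Y s))
  rw [Complex.norm_conj] at h2
  rw [norm_mul, norm_zetaFactor_half, one_mul]
  linarith

lemma continuous_zeta_vertical (σ : ℝ) (hσ : σ ≠ 1) :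
    Continuous fun t : ℝ => riemannZeta ((σ : ℂ) + t * Complex.I) := by
  refine continuous_iff_continuousAt.2 fun t => ?_
  refine ContinuousAt.comp (f := fun t : ℝ => (σ : ℂ) + t * Complex.I)
    (differentiableAt_riemannZeta fun h => hσ ?_).continuousAt (by fun_prop)
  simpa using congrArg Complex.re h

/-- The fourth moment of the zeta-function on the critical line. -/
theorem integral_zeta_pow_four_le (θ : ℝ) (hθ : 0 < θ) : ∃ C : ℝ, 0 < C ∧ ∀ T : ℝ, 1 ≤ T →
    ∫ t in T..(2 * T), ‖riemannZeta (((1 / 2 : ℝ) : ℂ) + t * Complex.I)‖ ^ 4 ≤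
      C * T ^ (1 + θ) := by
  set η := min (θ / 5) 1 with hη
  have hη0 : 0 < η := by rw [hη]; positivity
  have hη1 : η ≤ 1 := min_le_right _ _
  have hηθ : 5 * η ≤ θ := by linarith [min_le_left (θ / 5) 1]
  obtain ⟨C₁, hC₁, h₁⟩ := integral_quarticKernel_le η hη0 hη1
  obtain ⟨C₂, hC₂, h₂⟩ := integral_zetaSum_pow_four_le η hη0 hη1
  refine ⟨8 * (exp 1 * C₁) + 128 * C₂, by positivity, fun T hT => ?_⟩
  have hT0 : 0 < T := by linarith
  obtain ⟨Y, hY, hTY, hYT⟩ := exists_nat_sq_near T hT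
  have hR := (integral_zetaRem_le Y T hT).trans (h₁ T hT Y hY hTY hYT)
  have hA := (h₂ T hT Y hY hYT T).2
  rw [← two_mul] at hA
  have hRc := continuous_zetaRem Y
  have hAc := continuous_zetaSum Y (1 / 2)
  set R := ∫ t in T..(2 * T), ‖zetaRem Y (1 / 2 + t * Complex.I)‖ ^ 4 with hRdef
  have hR2 : R ≤ exp 1 * C₁ * T ^ (1 + 5 * η) := by
    rw [show (5 + 5 * η : ℝ) = (1 + 5 * η) + (4 : ℕ) by push_cast; ring, rpow_add hT0 (1 + 5 * η),
      rpow_natCast] at hR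
    have h4 : exp 1 * exp (-1) = 1 := by rw [← Real.exp_add]; simp
    have hT4 : 0 < T ^ 4 := by positivity
    refine le_of_mul_le_mul_left ?_ hT4
    calc T ^ 4 * R = exp 1 * (T ^ 4 * exp (-1) * R) := by linear_combination (-T ^ 4 * R) * h4
      _ ≤ exp 1 * (C₁ * (T ^ (1 + 5 * η) * T ^ 4)) := by gcongr
      _ = _ := by ring
  have hpt : ∀ t : ℝ, ‖riemannZeta (((1 / 2 : ℝ) : ℂ) + t * Complex.I)‖ ^ 4 ≤
      8 * ‖zetaRem Y (1 / 2 + t * Complex.I)‖ ^ 4 +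
        128 * ‖zetaSum Y (((1 / 2 : ℝ) : ℂ) + t * Complex.I)‖ ^ 4 := by
    intro t
    have h := norm_zeta_half_le Y t
    have e : (((1 / 2 : ℝ) : ℂ) + t * Complex.I) = 1 / 2 + t * Complex.I := by push_cast; ring
    rw [← e] at h ⊢
    set u := ‖zetaRem Y (((1 / 2 : ℝ) : ℂ) + t * Complex.I)‖
    set v := ‖zetaSum Y (((1 / 2 : ℝ) : ℂ) + t * Complex.I)‖
    have h1 := add_pow_le (norm_nonneg (zetaRem Y (((1 / 2 : ℝ) : ℂ) + t * Complex.I)))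
      (by positivity : 0 ≤ 2 * v) 4
    calc _ ≤ (u + 2 * v) ^ 4 := by gcongr
      _ ≤ 2 ^ (4 - 1) * (u ^ 4 + (2 * v) ^ 4) := h1
      _ = _ := by ring
  have hTθ : T ^ (1 + 5 * η) ≤ T ^ (1 + θ) := rpow_le_rpow_of_exponent_le hT (by linarith)
  have hTη : T ^ (1 + η) ≤ T ^ (1 + θ) := rpow_le_rpow_of_exponent_le hT (by linarith)
  have hζ := continuous_zeta_vertical (1 / 2) (by norm_num)
  calc _ ≤ ∫ t in T..(2 * T), (8 * ‖zetaRem Y (1 / 2 + t * Complex.I)‖ ^ 4 +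
        128 * ‖zetaSum Y (((1 / 2 : ℝ) : ℂ) + t * Complex.I)‖ ^ 4) := by
        refine intervalIntegral.integral_mono_on (by linarith)
          (Continuous.intervalIntegrable (by fun_prop) _ _)
          (Continuous.intervalIntegrable (by fun_prop) _ _) fun t _ => hpt t
    _ ≤ 8 * (exp 1 * C₁ * T ^ (1 + 5 * η)) + 128 * (C₂ * T ^ (1 + η)) := by
        rw [intervalIntegral.integral_add (Continuous.intervalIntegrable (by fun_prop) _ _)
          (Continuous.intervalIntegrable (by fun_prop) _ _), intervalIntegral.integral_const_mul,
          intervalIntegral.integral_const_mul]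
        gcongr
    _ ≤ 8 * (exp 1 * C₁ * T ^ (1 + θ)) + 128 * (C₂ * T ^ (1 + θ)) := by gcongr
    _ = _ := by ring

lemma sum_pow_le_card_pow_mul (s : Finset ℕ) (f : ℕ → ℝ) (hf : ∀ i ∈ s, 0 ≤ f i) (l : ℕ)
    (hl : 1 ≤ l) : (∑ i ∈ s, f i) ^ l ≤ (s.card : ℝ) ^ l * ∑ i ∈ s, f i ^ l := by
  obtain ⟨m, rfl⟩ : ∃ m, l = m + 1 := ⟨l - 1, by omega⟩
  rcases s.eq_empty_or_nonempty with rfl | hs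
  · simp
  have hc : (1 : ℝ) ≤ s.card := by exact_mod_cast hs.card_pos
  have h := pow_sum_div_card_le_sum_pow hf m
  rw [div_le_iff₀ (by positivity)] at h
  have h0 : 0 ≤ ∑ i ∈ s, f i ^ (m + 1) := Finset.sum_nonneg fun i hi => pow_nonneg (hf i hi) _
  calc _ ≤ (∑ i ∈ s, f i ^ (m + 1)) * (s.card : ℝ) ^ m := h
    _ ≤ (∑ i ∈ s, f i ^ (m + 1)) * (s.card : ℝ) ^ (m + 1) := by
        gcongr
        exact Nat.le_succ m
    _ = _ := mul_comm _ _

lemma exists_pow_between (η : ℝ) (hη : 0 < η) (T : ℝ) (hT : 1 ≤ T) (N : ℝ) (hN1 : T ^ η ≤ N)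
    (hN2 : N ≤ 2 * T ^ (3 / 5 : ℝ)) : ∃ j : ℕ, 3 ≤ j ∧ j ≤ ⌈1 / η⌉₊ + 3 ∧
      T ^ (4 / 5 : ℝ) ≤ N ^ j ∧ N ^ j ≤ 8 * T ^ (9 / 5 : ℝ) := by
  have hT0 : 0 < T := by linarith
  have hN0 : 1 ≤ N := (one_le_rpow hT hη.le).trans hN1
  have hex : T ^ (4 / 5 : ℝ) ≤ N ^ (⌈1 / η⌉₊ + 3) := by
    calc T ^ (4 / 5 : ℝ) ≤ T ^ (η * ((⌈1 / η⌉₊ + 3 : ℕ) : ℝ)) := by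
          refine rpow_le_rpow_of_exponent_le hT ?_
          have h1 := Nat.le_ceil (1 / η)
          push_cast
          calc (4 / 5 : ℝ) ≤ η * (1 / η) := by
                rw [mul_one_div_cancel hη.ne']
                norm_num
            _ ≤ _ := by
                gcongr
                linarith
      _ = (T ^ η) ^ (⌈1 / η⌉₊ + 3) := by rw [rpow_mul_natCast hT0.le]
      _ ≤ _ := by gcongr
  have hex' : ∃ j : ℕ, 3 ≤ j ∧ T ^ (4 / 5 : ℝ) ≤ N ^ j := ⟨_, by omega, hex⟩
  classical
  obtain ⟨h3, hj⟩ := Nat.find_spec hex'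
  refine ⟨Nat.find hex', h3, Nat.find_min' hex' ⟨by omega, hex⟩, hj, ?_⟩
  rcases h3.eq_or_lt with h | h
  · rw [← h]
    calc N ^ 3 ≤ (2 * T ^ (3 / 5 : ℝ)) ^ 3 := by gcongr
      _ = 8 * T ^ ((3 / 5 : ℝ) * (3 : ℕ)) := by
          rw [rpow_mul_natCast hT0.le]
          ring
      _ = _ := by norm_num
  · have hmin := Nat.find_min hex' (m := Nat.find hex' - 1) (by omega)
    push Not at hmin
    have h1 := (hmin (by omega)).le
    have h2 : Nat.find hex' = (Nat.find hex' - 1) + 1 := by omega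
    rw [h2, pow_succ]
    calc _ ≤ T ^ (4 / 5 : ℝ) * (2 * T ^ (3 / 5 : ℝ)) := by gcongr
      _ = 2 * T ^ (7 / 5 : ℝ) := by
          rw [mul_left_comm, ← rpow_add hT0]
          norm_num
      _ ≤ 8 * T ^ (9 / 5 : ℝ) := by
          gcongr
          · norm_num
          · norm_num

lemma integral_dyadicBlock_pow_le (j : ℕ) : ∃ C : ℝ, 0 < C ∧ ∀ σ : ℝ, 47 / 50 ≤ σ → ∀ k : ℕ,
    ∀ T : ℝ, 1 ≤ T → T ^ (4 / 5 : ℝ) ≤ ((2 : ℝ) ^ k) ^ j → ((2 : ℝ) ^ k) ^ j ≤ 8 * T ^ (9 / 5 : ℝ) →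
      ∫ t in T..(2 * T), ‖dyadicBlock k ((σ : ℂ) + t * Complex.I)‖ ^ (2 * j) ≤
        C * T ^ (1 / 3 : ℝ) := by
  obtain ⟨C, hC, h⟩ := integral_norm_pow_sum_cpow_le j (1 / 100) (by norm_num)
  refine ⟨C * (4 ^ j * 9), by positivity, fun σ hσ k T hT hM1 hM2 => ?_⟩
  have hT0 : 0 < T := by linarith
  set M : ℝ := ((2 : ℝ) ^ k) ^ j with hM
  have hM0 : 1 ≤ M := one_le_pow₀ (one_le_pow₀ (by norm_num))
  have h1 := h (2 ^ k) (2 ^ (k + 1)) Nat.one_le_two_pow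
    (Nat.pow_le_pow_right (by norm_num) (Nat.le_succ k)) σ (M ^ (-(22 / 25) : ℝ)) (by positivity)
    (fun n hn hn1 _ => by
      have hn2 : M ≤ (n : ℝ) := by rw [hM]; exact_mod_cast hn1
      calc (n : ℝ) ^ (1 - 2 * σ) ≤ M ^ (1 - 2 * σ) :=
            rpow_le_rpow_of_nonpos (by linarith) hn2 (by linarith)
        _ ≤ _ := rpow_le_rpow_of_exponent_le hM0 (by linarith)) T T hT0.le
  rw [← two_mul] at h1
  refine h1.trans ?_
  have hB : (((2 ^ (k + 1) : ℕ) : ℝ)) ^ j = 2 ^ j * M := by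
    push_cast
    rw [pow_succ, mul_pow, mul_comm]
  rw [hB]
  have h2j : (1 : ℝ) ≤ 2 ^ j := one_le_pow₀ (by norm_num)
  have h2 : ((2 : ℝ) ^ j * M) ^ (1 / 100 : ℝ) ≤ 2 ^ j * M ^ (1 / 100 : ℝ) := by
    rw [mul_rpow (by positivity) (by positivity)]
    gcongr
    calc ((2 : ℝ) ^ j) ^ (1 / 100 : ℝ) ≤ ((2 : ℝ) ^ j) ^ (1 : ℝ) :=
          rpow_le_rpow_of_exponent_le h2j (by norm_num)
      _ = _ := rpow_one _
  have h3 : T * M ^ (-(87 / 100) : ℝ) ≤ T ^ (1 / 3 : ℝ) := by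
    calc T * M ^ (-(87 / 100) : ℝ) ≤ T ^ (1 : ℝ) * (T ^ (4 / 5 : ℝ)) ^ (-(87 / 100) : ℝ) := by
          rw [rpow_one]
          exact mul_le_mul_of_nonneg_left
            (rpow_le_rpow_of_nonpos (by positivity) hM1 (by norm_num)) hT0.le
      _ = T ^ (1 + 4 / 5 * (-(87 / 100)) : ℝ) := by rw [← rpow_mul hT0.le, ← rpow_add hT0]
      _ ≤ _ := rpow_le_rpow_of_exponent_le hT (by norm_num)
  have h4 : M ^ (13 / 100 : ℝ) ≤ 8 * T ^ (1 / 3 : ℝ) := by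
    calc M ^ (13 / 100 : ℝ) ≤ (8 * T ^ (9 / 5 : ℝ)) ^ (13 / 100 : ℝ) := by gcongr
      _ = 8 ^ (13 / 100 : ℝ) * T ^ (9 / 5 * (13 / 100) : ℝ) := by
          rw [mul_rpow (by norm_num) (by positivity), ← rpow_mul hT0.le]
      _ ≤ 8 ^ (1 : ℝ) * T ^ (1 / 3 : ℝ) := by
          gcongr
          · norm_num
          · norm_num
          · norm_num
      _ = _ := by rw [rpow_one]
  calc C * ((T + 2 ^ j * M) * (2 ^ j * M) ^ (1 / 100 : ℝ) * M ^ (-(22 / 25) : ℝ))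
      ≤ C * ((2 ^ j * T + 2 ^ j * M) * (2 ^ j * M ^ (1 / 100 : ℝ)) * M ^ (-(22 / 25) : ℝ)) := by
        gcongr
        exact le_mul_of_one_le_left hT0.le h2j
    _ = C * ((2 ^ j * 2 ^ j) * (T * (M ^ (1 / 100 : ℝ) * M ^ (-(22 / 25) : ℝ)) +
          M ^ (1 : ℝ) * M ^ (1 / 100 : ℝ) * M ^ (-(22 / 25) : ℝ))) := by
        rw [rpow_one]
        ring
    _ = C * (4 ^ j * (T * M ^ (-(87 / 100) : ℝ) + M ^ (13 / 100 : ℝ))) := by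
        rw [← rpow_add (by linarith), ← rpow_add (by linarith), ← rpow_add (by linarith),
          ← mul_pow]
        norm_num
    _ ≤ C * (4 ^ j * (T ^ (1 / 3 : ℝ) + 8 * T ^ (1 / 3 : ℝ))) := by gcongr
    _ = _ := by ring

lemma continuous_dyadicBlock (k : ℕ) (σ : ℝ) :
    Continuous fun t : ℝ => dyadicBlock k ((σ : ℂ) + t * Complex.I) :=
  continuous_sum_cpow _ _ Nat.one_le_two_pow _

lemma integral_zeta_mul_dyadicBlock_le (η θ : ℝ) (hη : 0 < η) (hθ : 0 < θ) : ∃ C : ℝ, 0 < C ∧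
    ∀ σ : ℝ, 47 / 50 ≤ σ → ∀ k : ℕ, ∀ T : ℝ, 1 ≤ T → T ^ η ≤ (2 : ℝ) ^ k →
      (2 : ℝ) ^ k ≤ 2 * T ^ (3 / 5 : ℝ) → ∀ l : ℕ, l ≤ 6 →
      ∫ t in T..(2 * T), ‖riemannZeta (((1 / 2 : ℝ) : ℂ) + t * Complex.I)‖ ^ 4 *
        ‖dyadicBlock k ((σ : ℂ) + t * Complex.I)‖ ^ l ≤ C * T ^ (1 + θ) := by
  obtain ⟨C₁, hC₁, h₁⟩ := integral_zeta_pow_four_le θ hθ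
  obtain ⟨C₂, hC₂, h₂⟩ := norm_zeta_le_sixth (θ / 4) (1 / 2) (by positivity)
  choose D hD0 hD using integral_dyadicBlock_pow_le
  set E := ∑ j ∈ Finset.range (⌈1 / η⌉₊ + 4), D j with hE
  have hE0 : 0 ≤ E := Finset.sum_nonneg fun j _ => (hD0 j).le
  refine ⟨C₁ + C₂ ^ 4 * 2 ^ (2 / 3 + θ) * E, by positivity, fun σ hσ k T hT hk1 hk2 l hl => ?_⟩
  have hT0 : 0 < T := by linarith
  obtain ⟨j, hj3, hj, hM1, hM2⟩ := exists_pow_between η hη T hT _ hk1 hk2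
  have hDj : D j ≤ E := Finset.single_le_sum (fun i _ => (hD0 i).le)
    (Finset.mem_range.2 (by omega))
  have hmom := hD j σ hσ k T hT hM1 hM2
  have hζ := continuous_zeta_vertical (1 / 2) (by norm_num)
  have hb := continuous_dyadicBlock k σ
  set S := C₂ ^ 4 * 2 ^ (2 / 3 + θ) * T ^ (2 / 3 + θ) with hS
  have hsup : ∀ t ∈ Set.Icc T (2 * T),
      ‖riemannZeta (((1 / 2 : ℝ) : ℂ) + t * Complex.I)‖ ^ 4 ≤ S := by
    intro t ht
    have ht0 : 0 < t := hT0.trans_le ht.1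
    have h := h₂ (1 / 2) t le_rfl le_rfl (by rw [abs_of_pos ht0]; linarith [ht.1])
    rw [abs_of_pos ht0] at h
    calc _ ≤ (C₂ * t ^ (1 / 6 + θ / 4)) ^ 4 := by gcongr
      _ = C₂ ^ 4 * t ^ ((1 / 6 + θ / 4) * (4 : ℕ)) := by rw [mul_pow, rpow_mul_natCast ht0.le]
      _ = C₂ ^ 4 * t ^ (2 / 3 + θ) := by
          congr 2
          push_cast
          ring
      _ ≤ C₂ ^ 4 * (2 * T) ^ (2 / 3 + θ) := by
          gcongr
          exact ht.2
      _ = _ := by rw [mul_rpow (by norm_num) hT0.le, hS]; ring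
  have hpt : ∀ t ∈ Set.Icc T (2 * T),
      ‖riemannZeta (((1 / 2 : ℝ) : ℂ) + t * Complex.I)‖ ^ 4 *
        ‖dyadicBlock k ((σ : ℂ) + t * Complex.I)‖ ^ l ≤
      ‖riemannZeta (((1 / 2 : ℝ) : ℂ) + t * Complex.I)‖ ^ 4 +
        S * ‖dyadicBlock k ((σ : ℂ) + t * Complex.I)‖ ^ (2 * j) := by
    intro t ht
    set b := ‖dyadicBlock k ((σ : ℂ) + t * Complex.I)‖ with hbdef
    have hb0 : 0 ≤ b := norm_nonneg _
    have h1 : b ^ l ≤ 1 + b ^ (2 * j) := by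
      rcases le_total b 1 with h | h
      · exact (pow_le_one₀ hb0 h).trans (by linarith [pow_nonneg hb0 (2 * j)])
      · exact (pow_le_pow_right₀ h (by omega : l ≤ 2 * j)).trans (by linarith)
    calc _ ≤ ‖riemannZeta (((1 / 2 : ℝ) : ℂ) + t * Complex.I)‖ ^ 4 * (1 + b ^ (2 * j)) := by gcongr
      _ = ‖riemannZeta (((1 / 2 : ℝ) : ℂ) + t * Complex.I)‖ ^ 4 +
          ‖riemannZeta (((1 / 2 : ℝ) : ℂ) + t * Complex.I)‖ ^ 4 * b ^ (2 * j) := by ring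
      _ ≤ _ := by
          gcongr
          exact hsup t ht
  calc _ ≤ ∫ t in T..(2 * T), (‖riemannZeta (((1 / 2 : ℝ) : ℂ) + t * Complex.I)‖ ^ 4 +
        S * ‖dyadicBlock k ((σ : ℂ) + t * Complex.I)‖ ^ (2 * j)) := by
        refine intervalIntegral.integral_mono_on (by linarith)
          (Continuous.intervalIntegrable (by fun_prop) _ _)
          (Continuous.intervalIntegrable (by fun_prop) _ _) hpt
    _ ≤ C₁ * T ^ (1 + θ) + S * (E * T ^ (1 / 3 : ℝ)) := by
        rw [intervalIntegral.integral_add (Continuous.intervalIntegrable (by fun_prop) _ _)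
          (Continuous.intervalIntegrable (by fun_prop) _ _), intervalIntegral.integral_const_mul]
        gcongr
        · exact h₁ T hT
        · exact hmom.trans (by gcongr)
    _ = _ := by
        rw [hS, show (1 + θ : ℝ) = (2 / 3 + θ) + 1 / 3 by ring, rpow_add hT0 (2 / 3 + θ)]
        ring

/-- The dyadic blocks of `ζ` on height `T` that are neither trivially small nor long. -/
noncomputable def midBlocks (η T : ℝ) : Finset ℕ :=
  (Finset.range (⌊3 * log (2 * T)⌋₊ + 1)).filter fun k =>
    T ^ η ≤ (2 : ℝ) ^ k ∧ (2 : ℝ) ^ k ≤ 2 * T ^ (3 / 5 : ℝ)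

lemma norm_zeta_le_midBlocks (η : ℝ) (hη : 0 < η) (σ : ℝ) (hσ : 47 / 50 ≤ σ) (hσ1 : σ ≤ 1)
    (T t : ℝ) (hT : 1 ≤ T) (ht : t ∈ Set.Icc T (2 * T)) :
    ‖riemannZeta ((σ : ℂ) + t * Complex.I)‖ ≤
      117 * ((⌊3 * log (2 * T)⌋₊ + 1 : ℕ) : ℝ) * T ^ η +
        ∑ k ∈ midBlocks η T, ‖dyadicBlock k ((σ : ℂ) + t * Complex.I)‖ := by
  have hT0 : 0 < T := by linarith
  obtain ⟨ht1, ht2⟩ := ht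
  have ht11 : 1 ≤ t := hT.trans ht1
  have ht0 : 0 < t := by linarith
  obtain ⟨K, hK1, hK2⟩ := norm_zeta_le_sum_dyadicBlock σ t (by linarith) ht11
  have hK3 := le_three_mul_log_of_two_pow_le K t ht11 hK1
  have hK4 : K ≤ ⌊3 * log (2 * T)⌋₊ := by
    refine Nat.le_floor (hK3.trans ?_)
    gcongr
  set R := ⌊3 * log (2 * T)⌋₊ + 1 with hR
  set b : ℕ → ℝ := fun k => ‖dyadicBlock k ((σ : ℂ) + t * Complex.I)‖ with hb
  have hTη : 1 ≤ T ^ η := one_le_rpow hT hη.le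
  have hterm : ∀ k ∈ Finset.range (K + 1), b k ≤
      105 * T ^ η + (if T ^ η ≤ (2 : ℝ) ^ k ∧ (2 : ℝ) ^ k ≤ 2 * T ^ (3 / 5 : ℝ) then b k else 0) := by
    intro k hk
    have hkK : k ≤ K := Nat.lt_succ_iff.1 (Finset.mem_range.1 hk)
    have hkt : (2 : ℝ) ^ k ≤ t ^ 2 := (pow_le_pow_right₀ (by norm_num) hkK).trans hK1
    split_ifs with h
    · linarith
    · rw [add_zero]
      rcases lt_or_ge ((2 : ℝ) ^ k) (T ^ η) with h1 | h1
      · have : b k ≤ 2 ^ k := by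
          have := norm_sum_le_of_le (Finset.Ico (2 ^ k : ℕ) (2 ^ (k + 1)))
            (f := fun n => (n : ℂ) ^ (-((σ : ℂ) + t * Complex.I))) (n := fun _ => (1 : ℝ))
            (fun n hn => ?_)
          · rw [Finset.sum_const, Nat.card_Ico, nsmul_eq_mul, mul_one, pow_succ,
              Nat.mul_two, Nat.add_sub_cancel] at this
            push_cast at this
            rw [hb]
            simp only [dyadicBlock, pow_succ, Nat.mul_two]
            exact this
          · have hn1 : 1 ≤ n := Nat.one_le_two_pow.trans (Finset.mem_Ico.1 hn).1
            rw [Complex.norm_natCast_cpow_of_pos hn1]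
            refine rpow_le_one_of_one_le_of_nonpos (by exact_mod_cast hn1) ?_
            simp
            linarith
        linarith
      · have h2 : 2 * T ^ (3 / 5 : ℝ) < 2 ^ k := by
          by_contra hcon
          exact h ⟨h1, not_lt.1 hcon⟩
        have h3 : t ^ (3 / 5 : ℝ) ≤ 2 ^ k := by
          calc t ^ (3 / 5 : ℝ) ≤ (2 * T) ^ (3 / 5 : ℝ) := by gcongr
            _ = 2 ^ (3 / 5 : ℝ) * T ^ (3 / 5 : ℝ) := mul_rpow (by norm_num) hT0.le
            _ ≤ 2 ^ (1 : ℝ) * T ^ (3 / 5 : ℝ) := by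
                gcongr
                · norm_num
                · norm_num
            _ ≤ _ := by rw [rpow_one]; exact h2.le
        rcases le_total ((2 : ℝ) ^ k) t with h4 | h4
        · have := norm_dyadicBlock_le_of_rpow_le k σ t (by linarith) ht11 h4 h3
          exact this.trans (by linarith)
        · have := norm_dyadicBlock_le_of_le k σ t (by linarith) ht0 h4 hkt
          exact this.trans (by linarith)
  have hKR : ((K + 1 : ℕ) : ℝ) ≤ R := by exact_mod_cast (by omega : K + 1 ≤ R)
  have hR1 : (1 : ℝ) ≤ R := by exact_mod_cast (by omega : 1 ≤ R)
  have hmid : ∑ k ∈ Finset.range (K + 1),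
      (if T ^ η ≤ (2 : ℝ) ^ k ∧ (2 : ℝ) ^ k ≤ 2 * T ^ (3 / 5 : ℝ) then b k else 0) ≤
        ∑ k ∈ midBlocks η T, b k := by
    rw [← Finset.sum_filter, midBlocks]
    refine Finset.sum_le_sum_of_subset_of_nonneg ?_ fun k _ _ => norm_nonneg _
    exact Finset.filter_subset_filter _ (Finset.range_mono (by omega))
  have hsum := Finset.sum_le_sum hterm
  rw [Finset.sum_add_distrib, Finset.sum_const, Finset.card_range, nsmul_eq_mul] at hsum
  have h5 : ((K + 1 : ℕ) : ℝ) * (105 * T ^ η) ≤ R * (105 * T ^ η) := by gcongr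
  have h6 : 1 ≤ (R : ℝ) * T ^ η := one_le_mul_of_one_le_of_one_le hR1 hTη
  linarith

/-- The mixed moment of the zeta-function. -/
theorem integral_mixed_moment_le (l : ℕ) (hl1 : 1 ≤ l) (hl6 : l ≤ 6) (σ : ℝ) (hσ : 47 / 50 ≤ σ)
    (hσ1 : σ < 1) (θ : ℝ) (hθ : 0 < θ) : ∃ C : ℝ, 0 < C ∧ ∀ T : ℝ, 1 ≤ T →
      ∫ t in T..(2 * T), ‖riemannZeta (((1 / 2 : ℝ) : ℂ) + t * Complex.I)‖ ^ 4 *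
        ‖riemannZeta ((σ : ℂ) + t * Complex.I)‖ ^ l ≤ C * T ^ (1 + θ) := by
  have hl0 : (1 : ℝ) ≤ l := by exact_mod_cast hl1
  set η := θ / (2 * l + 1) with hηdef
  have hη : 0 < η := by rw [hηdef]; positivity
  have hηθ : η * (2 * l + 1) = θ := by rw [hηdef]; field_simp
  obtain ⟨C₁, hC₁, h₁⟩ := integral_zeta_pow_four_le η hη
  obtain ⟨C₂, hC₂, h₂⟩ := integral_zeta_mul_dyadicBlock_le η η hη hη
  set K : ℝ := 4 * (1 + 1 / η) with hK
  refine ⟨2 ^ (l - 1) * ((117 * K) ^ l * C₁ + K ^ (l + 1) * C₂), by positivity, fun T hT => ?_⟩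
  have hT0 : 0 < T := by linarith
  set R := ⌊3 * log (2 * T)⌋₊ + 1 with hR
  have hRK : (R : ℝ) ≤ K * T ^ η := by
    have h0 := Real.log_nonneg hT
    have h1 := one_add_log_le_rpow η hη T hT
    have h2 : log (2 * T) = log 2 + log T := Real.log_mul (by norm_num) hT0.ne'
    have h3 := Real.log_two_lt_d9
    have h4 := Nat.floor_le (by rw [h2]; positivity : 0 ≤ 3 * log (2 * T))
    calc (R : ℝ) ≤ 4 * (1 + log T) := by
          rw [hR]
          push_cast
          linarith
      _ ≤ 4 * ((1 + 1 / η) * T ^ η) := by gcongr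
      _ = _ := by rw [hK]; ring
  have hcard : ((midBlocks η T).card : ℝ) ≤ R := by
    exact_mod_cast (Finset.card_filter_le _ _).trans (Finset.card_range R).le
  set Z : ℝ → ℝ := fun t => ‖riemannZeta (((1 / 2 : ℝ) : ℂ) + t * Complex.I)‖ ^ 4 with hZ
  set b : ℕ → ℝ → ℝ := fun k t => ‖dyadicBlock k ((σ : ℂ) + t * Complex.I)‖ with hb
  have hZc : Continuous Z := (continuous_zeta_vertical (1 / 2) (by norm_num)).norm.pow 4
  have hbc : ∀ k, Continuous (b k) := fun k => (continuous_dyadicBlock k σ).norm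
  have hζc := continuous_zeta_vertical σ hσ1.ne
  have hZ0 : ∀ t, 0 ≤ Z t := fun t => by positivity
  set U : ℝ := 117 * R * T ^ η with hU
  have hU0 : 0 ≤ U := by positivity
  have hpt : ∀ t ∈ Set.Icc T (2 * T), Z t * ‖riemannZeta ((σ : ℂ) + t * Complex.I)‖ ^ l ≤
      2 ^ (l - 1) * (U ^ l * Z t + (R : ℝ) ^ l * ∑ k ∈ midBlocks η T, Z t * b k t ^ l) := by
    intro t ht
    have h1 := norm_zeta_le_midBlocks η hη σ hσ hσ1.le T t hT ht
    have hb0 : 0 ≤ ∑ k ∈ midBlocks η T, b k t := Finset.sum_nonneg fun k _ => norm_nonneg _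
    have hb1 : 0 ≤ ∑ k ∈ midBlocks η T, b k t ^ l :=
      Finset.sum_nonneg fun k _ => pow_nonneg (norm_nonneg _) l
    have h2 := sum_pow_le_card_pow_mul (midBlocks η T) (fun k => b k t)
      (fun k _ => norm_nonneg _) l hl1
    rw [← Finset.mul_sum]
    calc _ ≤ Z t * (U + ∑ k ∈ midBlocks η T, b k t) ^ l := by gcongr
      _ ≤ Z t * (2 ^ (l - 1) * (U ^ l + (∑ k ∈ midBlocks η T, b k t) ^ l)) := by
          gcongr
          exact add_pow_le hU0 hb0 l
      _ ≤ Z t * (2 ^ (l - 1) * (U ^ l + (R : ℝ) ^ l * ∑ k ∈ midBlocks η T, b k t ^ l)) := by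
          gcongr
          exact h2.trans (by gcongr)
      _ = _ := by ring
  have hmid : ∑ k ∈ midBlocks η T, ∫ t in T..(2 * T), Z t * b k t ^ l ≤
      R * (C₂ * T ^ (1 + η)) := by
    calc _ ≤ ∑ k ∈ midBlocks η T, C₂ * T ^ (1 + η) := by
          refine Finset.sum_le_sum fun k hk => ?_
          obtain ⟨-, hk1, hk2⟩ := Finset.mem_filter.1 hk
          exact h₂ σ hσ k T hT hk1 hk2 l hl6
      _ = (midBlocks η T).card * (C₂ * T ^ (1 + η)) := by rw [Finset.sum_const, nsmul_eq_mul]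
      _ ≤ _ := by gcongr
  have hpow : ∀ m : ℕ, (T ^ η) ^ m = T ^ (η * m) := fun m => (rpow_mul_natCast hT0.le η m).symm
  calc _ ≤ ∫ t in T..(2 * T), 2 ^ (l - 1) * (U ^ l * Z t +
        (R : ℝ) ^ l * ∑ k ∈ midBlocks η T, Z t * b k t ^ l) := by
        refine intervalIntegral.integral_mono_on (by linarith)
          ((hZc.mul (hζc.norm.pow l)).intervalIntegrable _ _)
          (Continuous.intervalIntegrable (by fun_prop) _ _) hpt
    _ = 2 ^ (l - 1) * (U ^ l * ∫ t in T..(2 * T), Z t) + 2 ^ (l - 1) * ((R : ℝ) ^ l *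
        ∑ k ∈ midBlocks η T, ∫ t in T..(2 * T), Z t * b k t ^ l) := by
        rw [intervalIntegral.integral_const_mul, intervalIntegral.integral_add
          (Continuous.intervalIntegrable (by fun_prop) _ _)
          (Continuous.intervalIntegrable (by fun_prop) _ _), intervalIntegral.integral_const_mul,
          intervalIntegral.integral_const_mul, intervalIntegral.integral_finsetSum, mul_add]
        exact fun i _ => Continuous.intervalIntegrable (by fun_prop) _ _
    _ ≤ 2 ^ (l - 1) * ((117 * (K * T ^ η) * T ^ η) ^ l * (C₁ * T ^ (1 + η))) + 2 ^ (l - 1) *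
        ((K * T ^ η) ^ l * ((K * T ^ η) * (C₂ * T ^ (1 + η)))) := by
        have hUK : U ≤ 117 * (K * T ^ η) * T ^ η := by
          rw [hU]
          gcongr
        have hI0 := intervalIntegral.integral_nonneg (μ := MeasureTheory.volume)
          (by linarith : T ≤ 2 * T) fun t _ => hZ0 t
        have hmid0 : 0 ≤ ∑ k ∈ midBlocks η T, ∫ t in T..(2 * T), Z t * b k t ^ l :=
          Finset.sum_nonneg fun k _ => intervalIntegral.integral_nonneg (by linarith) fun t _ =>
            mul_nonneg (hZ0 t) (pow_nonneg (norm_nonneg _) l)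
        refine add_le_add ?_ ?_
        · refine mul_le_mul_of_nonneg_left ?_ (by positivity)
          exact mul_le_mul (pow_le_pow_left₀ hU0 hUK l) (h₁ T hT) hI0 (by positivity)
        · refine mul_le_mul_of_nonneg_left ?_ (by positivity)
          refine mul_le_mul (pow_le_pow_left₀ (by positivity) hRK l) ?_ hmid0 (by positivity)
          exact hmid.trans (by gcongr)
    _ = 2 ^ (l - 1) * ((117 * K) ^ l * C₁ * ((T ^ η) ^ (2 * l) * T ^ (1 + η))) + 2 ^ (l - 1) *
        (K ^ (l + 1) * C₂ * ((T ^ η) ^ (l + 1) * T ^ (1 + η))) := by ring_nf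
    _ ≤ 2 ^ (l - 1) * ((117 * K) ^ l * C₁ * T ^ (1 + θ)) + 2 ^ (l - 1) *
        (K ^ (l + 1) * C₂ * T ^ (1 + θ)) := by
        rw [hpow, hpow, ← rpow_add hT0, ← rpow_add hT0]
        have e1 : T ^ (η * (2 * l : ℕ) + (1 + η)) ≤ T ^ (1 + θ) :=
          rpow_le_rpow_of_exponent_le hT (by rw [← hηθ]; push_cast; linarith)
        have e2 : T ^ (η * (l + 1 : ℕ) + (1 + η)) ≤ T ^ (1 + θ) :=
          rpow_le_rpow_of_exponent_le hT (by rw [← hηθ]; push_cast; nlinarith)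
        gcongr
    _ = _ := by ring

lemma integrable_mul_of_dyadic_le {f : ℝ → ℝ} (hf : Continuous f) (h0 : ∀ t, 0 ≤ f t)
    (heven : ∀ t, f (-t) = f t)
    (h : ∀ θ : ℝ, 0 < θ → ∃ C : ℝ, 0 < C ∧
      ∀ T : ℝ, 1 ≤ T → ∫ t in T..(2 * T), f t ≤ C * T ^ (1 + θ))
    (θ : ℝ) (hθ : 0 < θ) :
    MeasureTheory.Integrable fun t : ℝ => f t * (1 + |t|) ^ (-(1 + θ)) := by
  obtain ⟨C, hC, hCT⟩ := h (θ / 2) (by linarith)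
  set g : ℝ → ℝ := fun t => f t * (1 + |t|) ^ (-(1 + θ)) with hg
  have hgc : Continuous g := by
    refine hf.mul (Continuous.rpow_const (by fun_prop) fun t => Or.inl ?_)
    positivity
  have hg0 : ∀ t, 0 ≤ g t := fun t => mul_nonneg (h0 t) (by positivity)
  set r : ℝ := (2 : ℝ) ^ (-(θ / 2)) with hr
  have hr0 : 0 < r := by positivity
  have hr1 : r < 1 := rpow_lt_one_of_one_lt_of_neg (by norm_num) (by linarith)
  have hpiece : ∀ k : ℕ, ∫ t in (2 : ℝ) ^ k..(2 : ℝ) ^ (k + 1), g t ≤ C * r ^ k := by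
    intro k
    have hT : (1 : ℝ) ≤ 2 ^ k := one_le_pow₀ (by norm_num)
    have hT0 : (0 : ℝ) < 2 ^ k := by positivity
    have hTT : (2 : ℝ) ^ (k + 1) = 2 * 2 ^ k := by ring
    rw [hTT]
    calc ∫ t in (2 : ℝ) ^ k..2 * 2 ^ k, g t
        ≤ ∫ t in (2 : ℝ) ^ k..2 * 2 ^ k, f t * ((2 : ℝ) ^ k) ^ (-(1 + θ)) := by
          refine intervalIntegral.integral_mono_on (by linarith) (hgc.intervalIntegrable _ _)
            ((hf.mul continuous_const).intervalIntegrable _ _) fun t ht => ?_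
          refine mul_le_mul_of_nonneg_left ?_ (h0 t)
          refine rpow_le_rpow_of_nonpos hT0 ?_ (by linarith)
          have := le_abs_self t
          linarith [ht.1]
      _ ≤ (C * ((2 : ℝ) ^ k) ^ (1 + θ / 2)) * ((2 : ℝ) ^ k) ^ (-(1 + θ)) := by
          rw [intervalIntegral.integral_mul_const]
          exact mul_le_mul_of_nonneg_right (hCT _ hT) (by positivity)
      _ = C * r ^ k := by
          rw [mul_assoc, ← rpow_add hT0, hr, ← rpow_natCast, ← rpow_natCast, ← rpow_mul (by norm_num),
            ← rpow_mul (by norm_num)]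
          ring_nf
  have hsum : ∀ n : ℕ, ∫ t in (1 : ℝ)..(2 : ℝ) ^ n, g t ≤ C * (1 - r)⁻¹ := by
    intro n
    have hle : ∫ t in (1 : ℝ)..(2 : ℝ) ^ n, g t ≤ C * ∑ k ∈ Finset.range n, r ^ k := by
      induction n with
      | zero => simp
      | succ n ih =>
        rw [← intervalIntegral.integral_add_adjacent_intervals (hgc.intervalIntegrable _ ((2 : ℝ) ^ n))
          (hgc.intervalIntegrable _ _), Finset.sum_range_succ, mul_add]
        exact add_le_add ih (hpiece n)
    refine hle.trans (mul_le_mul_of_nonneg_left ?_ hC.le)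
    rw [← tsum_geometric_of_lt_one hr0.le hr1]
    exact (summable_geometric_of_lt_one hr0.le hr1).sum_le_tsum _ fun _ _ => by positivity
  have hIoi : MeasureTheory.IntegrableOn g (Set.Ioi 1) := by
    refine MeasureTheory.integrableOn_Ioi_of_intervalIntegral_norm_bounded (C * (1 - r)⁻¹) 1
      (l := Filter.atTop) (b := fun n : ℕ => (2 : ℝ) ^ n)
      (fun n => (hgc.integrableOn_Ioc)) (tendsto_pow_atTop_atTop_of_one_lt (by norm_num))
      (Filter.Eventually.of_forall fun n => ?_)
    simpa only [norm_of_nonneg (hg0 _)] using hsum n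
  have hIio : MeasureTheory.IntegrableOn g (Set.Iio (-1)) := by
    have := (MeasureTheory.Measure.measurePreserving_neg (MeasureTheory.volume : MeasureTheory.Measure ℝ)).integrableOn_comp_preimage
      (Homeomorph.neg ℝ).measurableEmbedding (f := g) (s := Set.Ioi 1)
    have h2 := this.2 hIoi
    have h3 : g ∘ Neg.neg = g := by
      funext t
      simp [hg, heven]
    rw [h3] at h2
    convert h2 using 1
    ext t
    simp [lt_neg]
  have hun : (Set.univ : Set ℝ) = Set.Iio (-1) ∪ (Set.Icc (-1) 1 ∪ Set.Ioi 1) := by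
    ext t
    simp only [Set.mem_univ, Set.mem_union, Set.mem_Iio, Set.mem_Icc, Set.mem_Ioi, true_iff]
    by_contra! hcon
    exact absurd (hcon.2.1 hcon.1) (by linarith [hcon.2.2])
  rw [← MeasureTheory.integrableOn_univ, hun]
  exact hIio.union ((hgc.integrableOn_Icc).union hIoi)

/-- The function `ζ(s)⁴ ζ(s + a)^ℓ`, the Dirichlet series of the weighted divisor function. -/
noncomputable def zetaProd (l : ℕ) (a : ℝ) (s : ℂ) : ℂ := riemannZeta s ^ 4 * riemannZeta (s + a) ^ l

lemma integrable_zetaProd (l : ℕ) (hl1 : 1 ≤ l) (hl6 : l ≤ 6) (a : ℝ) (ha : 0.440002 ≤ a)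
    (ha2 : a < 1 / 2) (θ : ℝ) (hθ : 0 < θ) :
    MeasureTheory.Integrable fun t : ℝ =>
      ‖zetaProd l a (((1 / 2 : ℝ) : ℂ) + t * Complex.I)‖ * (1 + |t|) ^ (-(1 + θ)) := by
  have heq : ∀ t : ℝ, ‖zetaProd l a (((1 / 2 : ℝ) : ℂ) + t * Complex.I)‖ =
      ‖riemannZeta (((1 / 2 : ℝ) : ℂ) + t * Complex.I)‖ ^ 4 *
      ‖riemannZeta (((1 / 2 + a : ℝ) : ℂ) + t * Complex.I)‖ ^ l := by
    intro t
    rw [zetaProd, norm_mul, norm_pow, norm_pow]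
    congr 4
    push_cast
    ring
  have hconj : ∀ σ t : ℝ, ‖riemannZeta ((σ : ℂ) + ((-t : ℝ) : ℂ) * Complex.I)‖ =
      ‖riemannZeta ((σ : ℂ) + t * Complex.I)‖ := by
    intro σ t
    rw [← Complex.norm_conj (riemannZeta ((σ : ℂ) + t * Complex.I)), ← riemannZeta_conj]
    congr 2
    simp
  simp only [heq]
  refine integrable_mul_of_dyadic_le ?_ (fun t => by positivity) (fun t => ?_)
    (fun η hη => integral_mixed_moment_le l hl1 hl6 (1 / 2 + a) ?_ ?_ η hη) θ hθ
  · exact (((continuous_zeta_vertical (1 / 2) (by norm_num)).norm).pow 4).mul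
      (((continuous_zeta_vertical (1 / 2 + a) (by linarith)).norm).pow l)
  · rw [hconj, hconj]
  · norm_num at ha ⊢; linarith
  · linarith

lemma norm_primitive_le {e : ℝ → ℂ} {K : ℝ} (hK : ∀ x, 1 ≤ x → ‖e x‖ ≤ K * x ^ 2)
    {x : ℝ} (hx : 1 ≤ x) : ‖∫ u in (1 : ℝ)..x, e u‖ ≤ K * x ^ 3 := by
  have hK0 : 0 ≤ K := by simpa using (norm_nonneg _).trans (hK 1 le_rfl)
  have h := intervalIntegral.norm_integral_le_of_norm_le_const (a := 1) (b := x) (f := e)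
    (C := K * x ^ 2) fun u hu => by
      rw [Set.uIoc_of_le hx] at hu
      refine (hK u hu.1.le).trans ?_
      have := hu.1
      have := hu.2
      gcongr
  refine h.trans ?_
  rw [abs_of_nonneg (by linarith)]
  have : x ^ 2 * (x - 1) ≤ x ^ 3 := by nlinarith [sq_nonneg x]
  nlinarith

lemma integrableOn_mul_cpow {e : ℝ → ℂ} (he : Measurable e) {K : ℝ} {m : ℕ} {s : ℂ}
    (hK : ∀ x, 1 ≤ x → ‖e x‖ ≤ K * x ^ m) (hs : (m : ℝ) + 1 < s.re) :
    MeasureTheory.IntegrableOn (fun x : ℝ => e x * (x : ℂ) ^ (-s)) (Set.Ioi 1) := by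
  have hint : MeasureTheory.IntegrableOn (fun x : ℝ => K * x ^ ((m : ℝ) - s.re)) (Set.Ioi 1) :=
    ((integrableOn_Ioi_rpow_of_lt (by linarith) one_pos).const_mul K)
  refine MeasureTheory.Integrable.mono' hint
    (he.mul (Complex.measurable_ofReal.pow_const _)).aestronglyMeasurable ?_
  refine (MeasureTheory.ae_restrict_iff' measurableSet_Ioi).2
    (Filter.Eventually.of_forall fun x hx => ?_)
  have hx0 : 0 < x := one_pos.trans hx
  rw [norm_mul, Complex.norm_cpow_eq_rpow_re_of_pos hx0, Complex.neg_re, rpow_sub hx0,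
    rpow_natCast, rpow_neg hx0.le, div_eq_mul_inv, ← mul_assoc]
  exact mul_le_mul_of_nonneg_right (hK x hx.le) (by positivity)

lemma integral_primitive_mul_cpow {e : ℝ → ℂ} (he : Measurable e) {K : ℝ}
    (hK : ∀ x, 1 ≤ x → ‖e x‖ ≤ K * x ^ 2)
    (hr : ∀ x, 1 ≤ x → ContinuousWithinAt e (Set.Ioi x) x) {s : ℂ} (hs : 2 < s.re)
    (hφm : Measurable fun x : ℝ => ∫ u in (1 : ℝ)..x, e u) :
    (s + 1) * ∫ x in Set.Ioi (1 : ℝ), (∫ u in (1 : ℝ)..x, e u) * (x : ℂ) ^ (-(s + 2)) =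
      ∫ x in Set.Ioi (1 : ℝ), e x * (x : ℂ) ^ (-(s + 1)) := by
  set φ : ℝ → ℂ := fun x => ∫ u in (1 : ℝ)..x, e u with hφ
  have hii : ∀ R, 1 ≤ R → IntervalIntegrable e MeasureTheory.volume 1 R := by
    intro R hR
    rw [intervalIntegrable_iff_integrableOn_Ioc_of_le hR]
    refine MeasureTheory.Integrable.mono' (g := fun _ => K * R ^ 2) (MeasureTheory.integrable_const _)
      he.aestronglyMeasurable ?_
    refine (MeasureTheory.ae_restrict_iff' measurableSet_Ioc).2
      (Filter.Eventually.of_forall fun x hx => (hK x hx.1.le).trans ?_)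
    have hK0 : 0 ≤ K := by simpa using (norm_nonneg _).trans (hK 1 le_rfl)
    have := hx.1
    have := hx.2
    gcongr
  have hi1 := integrableOn_mul_cpow he (m := 2) (s := s + 1) hK
    (by simp; linarith)
  have hi2 := integrableOn_mul_cpow hφm (m := 3) (s := s + 2)
    (fun x hx => norm_primitive_le hK hx) (by simp; linarith)
  have hparts : ∀ R, 1 ≤ R → ∫ x in (1 : ℝ)..R, φ x * (-(s + 1) * (x : ℂ) ^ (-(s + 2))) =
      φ R * (R : ℂ) ^ (-(s + 1)) - φ 1 * ((1 : ℝ) : ℂ) ^ (-(s + 1)) -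
        ∫ x in (1 : ℝ)..R, e x * (x : ℂ) ^ (-(s + 1)) := by
    intro R hR
    have hder : ∀ x ∈ Set.uIcc 1 R, HasDerivAt (fun y : ℝ => (y : ℂ) ^ (-(s + 1)))
        (-(s + 1) * (x : ℂ) ^ (-(s + 2))) x := by
      intro x hx
      rw [Set.uIcc_of_le hR] at hx
      have h1 := hasDerivAt_ofReal_cpow_const (x := x) (by linarith [hx.1]) (r := -(s + 1))
        (by intro h
            have := congrArg Complex.re h
            simp at this
            linarith)
      have h3 : -(s + 2) = -(s + 1) - 1 := by ring
      rwa [h3]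
    refine intervalIntegral.integral_mul_deriv_eq_deriv_mul_of_hasDeriv_right ?_
      (fun x hx => (hder x hx).continuousAt.continuousWithinAt) (fun x hx => ?_)
      (fun x hx => (hder x ?_).hasDerivWithinAt) (hii R hR) ?_
    · exact intervalIntegral.continuousOn_primitive_interval' (hii R hR) Set.left_mem_uIcc
    · rw [min_eq_left hR, max_eq_right hR] at hx
      exact (intervalIntegral.integral_hasDerivWithinAt_right (s := Set.Ici x) (t := Set.Ioi x)
        (hii x hx.1.le) (he.stronglyMeasurable.stronglyMeasurableAtFilter)
        (hr x hx.1.le)).mono Set.Ioi_subset_Ici_self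
    · rw [min_eq_left hR, max_eq_right hR] at hx
      rw [Set.uIcc_of_le hR]
      exact Set.Ioo_subset_Icc_self hx
    · refine ContinuousOn.intervalIntegrable ?_
      refine continuousOn_const.mul fun x hx => ?_
      rw [Set.uIcc_of_le hR] at hx
      refine ContinuousAt.continuousWithinAt ?_
      exact Complex.continuousAt_ofReal_cpow_const _ _ (Or.inr (by linarith [hx.1]))
  have hlim0 : Filter.Tendsto (fun R : ℝ => φ R * (R : ℂ) ^ (-(s + 1))) Filter.atTop (nhds 0) := by
    rw [tendsto_zero_iff_norm_tendsto_zero]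
    have hz : Filter.Tendsto (fun R : ℝ => K * R ^ (-(s.re - 2))) Filter.atTop (nhds 0) := by
      simpa using (tendsto_rpow_neg_atTop (by linarith : 0 < s.re - 2)).const_mul K
    refine squeeze_zero' (Filter.Eventually.of_forall fun _ => norm_nonneg _) ?_ hz
    filter_upwards [Filter.eventually_ge_atTop 1] with R hR
    have hR0 : 0 < R := by linarith
    rw [norm_mul, Complex.norm_cpow_eq_rpow_re_of_pos hR0]
    calc _ ≤ K * R ^ 3 * R ^ (-(s + 1)).re :=
          mul_le_mul_of_nonneg_right (norm_primitive_le hK hR) (by positivity)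
      _ = K * R ^ (-(s.re - 2)) := by
          rw [mul_assoc, ← rpow_natCast R 3, ← rpow_add hR0]
          congr 2
          simp
          ring
  have hL := MeasureTheory.intervalIntegral_tendsto_integral_Ioi 1 hi1 Filter.tendsto_id
  have hR := (MeasureTheory.intervalIntegral_tendsto_integral_Ioi 1 hi2
    Filter.tendsto_id).const_mul (-(s + 1))
  have hφ1 : φ 1 = 0 := by simp [hφ]
  have hR' : Filter.Tendsto (fun R : ℝ => φ R * (R : ℂ) ^ (-(s + 1)) - 
      ∫ x in (1 : ℝ)..R, e x * (x : ℂ) ^ (-(s + 1))) Filter.atTop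
      (nhds (-(s + 1) * ∫ x in Set.Ioi (1 : ℝ), φ x * (x : ℂ) ^ (-(s + 2)))) := by
    refine hR.congr' ?_
    filter_upwards [Filter.eventually_ge_atTop 1] with R hR1
    have := hparts R hR1
    rw [hφ1, zero_mul, sub_zero] at this
    rw [← this, ← intervalIntegral.integral_const_mul]
    refine intervalIntegral.integral_congr fun x _ => ?_
    ring
  have := tendsto_nhds_unique hR' (hlim0.sub hL)
  linear_combination -this

lemma intervalIntegrable_of_sq_bound {e : ℝ → ℂ} (he : Measurable e) {K : ℝ}
    (hK : ∀ x, 1 ≤ x → ‖e x‖ ≤ K * x ^ 2) (he0 : ∀ x, x < 1 → e x = 0) (a b : ℝ) :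
    IntervalIntegrable e MeasureTheory.volume a b := by
  have hK0 : 0 ≤ K := by simpa using (norm_nonneg _).trans (hK 1 le_rfl)
  rw [intervalIntegrable_iff]
  refine MeasureTheory.Integrable.mono' (g := fun x => K * x ^ 2) ?_ he.aestronglyMeasurable
    (Filter.Eventually.of_forall fun x => ?_)
  · exact intervalIntegrable_iff.1 (Continuous.intervalIntegrable (by fun_prop) _ _)
  · rcases lt_or_ge x 1 with h | h
    · rw [he0 x h, norm_zero]
      positivity
    · exact hK x h

lemma primitive_eq_zero {e : ℝ → ℂ} (he0 : ∀ x, x < 1 → e x = 0) {x : ℝ} (hx : x ≤ 1) :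
    ∫ u in (1 : ℝ)..x, e u = 0 := by
  rw [intervalIntegral.integral_symm, intervalIntegral.integral_of_le hx,
    MeasureTheory.integral_Ioc_eq_integral_Ioo, neg_eq_zero]
  refine MeasureTheory.setIntegral_eq_zero_of_forall_eq_zero fun u hu => he0 u hu.2

/-- Perron's formula for the first Riesz mean of `e`, on the line `Re s = 1/2`. -/
theorem primitive_eq_integral_vertical {e : ℝ → ℂ} (he : Measurable e) {K : ℝ}
    (hK : ∀ x, 1 ≤ x → ‖e x‖ ≤ K * x ^ 2) (he0 : ∀ x, x < 1 → e x = 0)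
    (hr : ∀ x, 1 ≤ x → ContinuousWithinAt e (Set.Ioi x) x) {G : ℂ → ℂ}
    (hGd : DifferentiableOn ℂ G {s | 1 / 2 ≤ s.re ∧ s.re ≤ 3})
    (hG : ∀ s : ℂ, s.re = 3 → ∫ x in Set.Ioi (1 : ℝ), e x * (x : ℂ) ^ (-(s + 1)) = G s)
    {K₃ : ℝ} (hG3 : ∀ y : ℝ, 1 ≤ |y| → ‖G ((3 : ℝ) + y * Complex.I)‖ ≤ K₃ * |y|⁻¹)
    {K₄ κ : ℝ} (hκ : κ < 1) (hG4 : ∀ x y : ℝ, 1 / 2 ≤ x → x ≤ 3 → 1 ≤ |y| →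
      ‖G (x + y * Complex.I)‖ ≤ K₄ * |y| ^ κ)
    (hGi : MeasureTheory.Integrable fun t : ℝ =>
      ‖G (((1 / 2 : ℝ) : ℂ) + t * Complex.I)‖ * (1 + |t|)⁻¹) {x : ℝ} (hx : 1 ≤ x) :
    MeasureTheory.Integrable (fun t : ℝ => (x : ℂ) ^ (((1 / 2 : ℝ) : ℂ) + t * Complex.I + 1) *
      (G (((1 / 2 : ℝ) : ℂ) + t * Complex.I) / (((1 / 2 : ℝ) : ℂ) + t * Complex.I + 1))) ∧
    ∫ u in (1 : ℝ)..x, e u = (1 / (2 * π) : ℝ) *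
      ∫ t : ℝ, (x : ℂ) ^ (((1 / 2 : ℝ) : ℂ) + t * Complex.I + 1) *
        (G (((1 / 2 : ℝ) : ℂ) + t * Complex.I) / (((1 / 2 : ℝ) : ℂ) + t * Complex.I + 1)) := by
  have hx0 : 0 < x := by linarith
  set φ : ℝ → ℂ := fun x => ∫ u in (1 : ℝ)..x, e u with hφ
  have hφc : Continuous φ :=
    intervalIntegral.continuous_primitive (intervalIntegrable_of_sq_bound he hK he0) 1
  have hφ0 : ∀ y ≤ 1, φ y = 0 := fun y hy => primitive_eq_zero he0 hy
  have hne : ∀ σ y : ℝ, 0 < σ → (σ : ℂ) + y * Complex.I + 1 ≠ 0 := by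
    intro σ y hσ h
    have := congrArg Complex.re h
    simp at this
    linarith
  have habs : ∀ σ y : ℝ, |y| ≤ ‖(σ : ℂ) + y * Complex.I + 1‖ := by
    intro σ y
    simpa using Complex.abs_im_le_norm ((σ : ℂ) + y * Complex.I + 1)
  have hGc : ∀ σ : ℝ, 1 / 2 ≤ σ → σ ≤ 3 → Continuous fun t : ℝ => G ((σ : ℂ) + t * Complex.I) := by
    intro σ h1 h2
    refine hGd.continuousOn.comp_continuous (by fun_prop) fun t => ?_
    simpa using ⟨by linarith, h2⟩
  have hmel : ∀ s : ℂ, s.re = 3 → mellin φ (-(s + 1)) = G s / (s + 1) := by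
    intro s hs
    have hs1 : s + 1 ≠ 0 := by
      intro h
      have := congrArg Complex.re h
      simp [hs] at this
      linarith
    rw [eq_div_iff hs1, ← hG s hs,
      ← integral_primitive_mul_cpow he hK hr (by linarith) hφc.measurable, mul_comm, mellin]
    congr 1
    rw [MeasureTheory.setIntegral_eq_of_subset_of_forall_sdiff_eq_zero measurableSet_Ioi
      (Set.Ioi_subset_Ioi zero_le_one)]
    · refine MeasureTheory.setIntegral_congr_fun measurableSet_Ioi fun t _ => ?_
      simp only [smul_eq_mul]
      rw [mul_comm]
      congr 2
      ring
    · intro t ht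
      have : t ≤ 1 := not_lt.1 ht.2
      rw [hφ0 t this, smul_zero]
  have hline : ∀ y : ℝ, (((-4 : ℝ) : ℂ) + y * Complex.I) =
      -(((3 : ℝ) + ((-y : ℝ) : ℂ) * Complex.I) + 1) := by
    intro y
    push_cast
    ring
  have hmc : MellinConvergent φ ((-4 : ℝ) : ℂ) := by
    have h := integrableOn_mul_cpow hφc.measurable (m := 3) (s := 5)
      (fun x hx => norm_primitive_le hK hx) (by norm_num)
    refine MeasureTheory.IntegrableOn.of_forall_sdiff_eq_zero (s := Set.Ioi 1) ?_
      measurableSet_Ioi ?_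
    · refine h.congr_fun (fun t _ => ?_) measurableSet_Ioi
      simp only [smul_eq_mul]
      rw [mul_comm]
      congr 2
      norm_num
    · intro t ht
      have : t ≤ 1 := not_lt.1 ht.2
      rw [hφ0 t this, smul_zero]
  set f : ℂ → ℂ := fun s => (x : ℂ) ^ (s + 1) * (G s / (s + 1)) with hf
  have hK30 : 0 ≤ K₃ := by
    have := (norm_nonneg _).trans (hG3 1 (by simp))
    simpa using this
  have hK40 : 0 ≤ K₄ := by
    have := (norm_nonneg _).trans (hG4 1 1 (by norm_num) (by norm_num) (by simp))
    simpa using this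
  have hgc : ∀ σ : ℝ, 1 / 2 ≤ σ → σ ≤ 3 → Continuous fun t : ℝ =>
      G ((σ : ℂ) + t * Complex.I) / ((σ : ℂ) + t * Complex.I + 1) := fun σ h1 h2 =>
    (hGc σ h1 h2).div (by fun_prop) fun t => hne σ t (by linarith)
  have hxp : ∀ σ : ℝ, Continuous fun t : ℝ => (x : ℂ) ^ ((σ : ℂ) + t * Complex.I + 1) := by
    intro σ
    refine Continuous.const_cpow (by fun_prop) (Or.inl ?_)
    exact_mod_cast hx0.ne'
  have hxn : ∀ σ t : ℝ, ‖(x : ℂ) ^ ((σ : ℂ) + t * Complex.I + 1)‖ = x ^ (σ + 1) := by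
    intro σ t
    rw [Complex.norm_cpow_eq_rpow_re_of_pos hx0]
    simp
  have hg3 : MeasureTheory.Integrable fun y : ℝ =>
      G (((3 : ℝ) : ℂ) + y * Complex.I) / (((3 : ℝ) : ℂ) + y * Complex.I + 1) := by
    refine integrable_of_decay (hgc 3 (by norm_num) le_rfl) (C := 2 * K₃) fun y hy => ?_
    have hy0 : 0 < |y| := by linarith
    rw [norm_div]
    calc _ ≤ K₃ * |y|⁻¹ / |y| := by
          gcongr
          · exact hG3 y hy
          · exact habs 3 y
      _ = K₃ * (y ^ 2)⁻¹ := by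
          rw [← sq_abs y]
          field_simp
      _ ≤ K₃ * (2 * (1 + y ^ 2)⁻¹) := by
          refine mul_le_mul_of_nonneg_left ?_ hK30
          have h1 : 1 ≤ y ^ 2 := by rw [← sq_abs]; nlinarith
          rw [inv_le_iff_one_le_mul₀ (by positivity), ← div_eq_mul_inv, div_mul_eq_mul_div,
            le_div_iff₀ (by positivity)]
          linarith
      _ = _ := by ring
  have hf3 : MeasureTheory.Integrable fun y : ℝ => f (((3 : ℝ) : ℂ) + y * Complex.I) :=
    hg3.bdd_mul (c := x ^ ((3 : ℝ) + 1)) (hxp 3).aestronglyMeasurable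
      (Filter.Eventually.of_forall fun t => (hxn 3 t).le)
  have hfh : MeasureTheory.Integrable fun y : ℝ => f (((1 / 2 : ℝ) : ℂ) + y * Complex.I) := by
    refine MeasureTheory.Integrable.bdd_mul (c := x ^ ((1 / 2 : ℝ) + 1)) ?_
      (hxp (1 / 2)).aestronglyMeasurable
      (Filter.Eventually.of_forall fun t => (hxn (1 / 2) t).le)
    refine MeasureTheory.Integrable.mono' (hGi.const_mul 2)
      (hgc (1 / 2) le_rfl (by norm_num)).aestronglyMeasurable
      (Filter.Eventually.of_forall fun t => ?_)
    rw [norm_div, div_eq_mul_inv, mul_left_comm]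
    refine mul_le_mul_of_nonneg_left ?_ (norm_nonneg _)
    have h1 := habs (1 / 2) t
    have h2 : (1 : ℝ) ≤ ‖((1 / 2 : ℝ) : ℂ) + t * Complex.I + 1‖ := by
      refine le_trans ?_ (Complex.re_le_norm _)
      simp
    have h3 : 0 < 1 + |t| := by positivity
    rw [inv_le_iff_one_le_mul₀ (by linarith), ← div_eq_mul_inv, div_mul_eq_mul_div,
      le_div_iff₀ h3]
    linarith
  refine ⟨hfh, ?_⟩
  have hinv := mellinInv_mellin_eq (-4) φ hx0 hmc ?_ hφc.continuousAt
  · rw [mellinInv] at hinv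
    change φ x = _ * ∫ t : ℝ, f (((1 / 2 : ℝ) : ℂ) + t * Complex.I)
    rw [integral_vertical_eq_of_differentiableOn (a := 1 / 2) (b := 3) (by norm_num) ?_ hfh hf3
      (g := fun u => x ^ (4 : ℝ) * (K₄ * u ^ (-(1 - κ)))) ?_ ?_, ← hinv, Complex.real_smul]
    · congr 1
      rw [← MeasureTheory.integral_neg_eq_self]
      refine MeasureTheory.integral_congr_ae (Filter.Eventually.of_forall fun y => ?_)
      simp only [hf, smul_eq_mul]
      rw [hline, neg_neg, neg_neg, hmel _ (by simp)]
    · refine DifferentiableOn.mul ?_ (hGd.div (by fun_prop) ?_)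
      · refine DifferentiableOn.const_cpow (by fun_prop) (Or.inl ?_)
        exact_mod_cast hx0.ne'
      · intro s hs h
        have := congrArg Complex.re h
        simp at this
        linarith [hs.1]
    · simpa using ((tendsto_rpow_neg_atTop (by linarith : 0 < 1 - κ)).const_mul K₄).const_mul
        (x ^ (4 : ℝ))
    · intro σ y h1 h2 hy
      have hy0 : 0 < |y| := by linarith
      rw [hf, norm_mul, hxn, norm_div]
      refine mul_le_mul (rpow_le_rpow_of_exponent_le hx (by linarith)) ?_ (by positivity)
        (by positivity)
      calc _ ≤ K₄ * |y| ^ κ / |y| := by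
            gcongr
            · exact hG4 σ y h1 h2 hy
            · exact habs σ y
        _ = _ := by
            rw [neg_sub, rpow_sub_one hy0.ne', mul_div_assoc]
  · have h := hg3.comp_neg
    refine h.congr (Filter.Eventually.of_forall fun y => ?_)
    simp only
    rw [hline, hmel _ (by simp)]

lemma norm_cpow_add_one_sub_le {x : ℝ} (hx : 1 ≤ x) {w : ℂ} (hw : w.re = 3 / 2) {θ : ℝ}
    (hθ0 : 0 ≤ θ) (hθ1 : θ ≤ 1) :
    ‖((x + 1 : ℝ) : ℂ) ^ w - (x : ℂ) ^ w‖ ≤ 2 * ‖w‖ ^ (1 - θ) * (x + 1) ^ (1 / 2 + θ) := by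
  have hx0 : 0 < x := by linarith
  have hx1 : 0 < x + 1 := by linarith
  have hA : ‖((x + 1 : ℝ) : ℂ) ^ w - (x : ℂ) ^ w‖ ≤ 2 * (x + 1) ^ (3 / 2 : ℝ) := by
    refine (norm_sub_le _ _).trans ?_
    rw [Complex.norm_cpow_eq_rpow_re_of_pos hx1, Complex.norm_cpow_eq_rpow_re_of_pos hx0, hw,
      two_mul]
    gcongr
    linarith
  have hB : ‖((x + 1 : ℝ) : ℂ) ^ w - (x : ℂ) ^ w‖ ≤ ‖w‖ * (x + 1) ^ (1 / 2 : ℝ) := by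
    have h := Convex.norm_image_sub_le_of_norm_hasDerivWithin_le (𝕜 := ℝ)
      (f := fun y : ℝ => (y : ℂ) ^ w) (f' := fun y : ℝ => w * (y : ℂ) ^ (w - 1))
      (s := Set.Icc x (x + 1)) (C := ‖w‖ * (x + 1) ^ (1 / 2 : ℝ)) (x := x) (y := x + 1)
      (fun y hy => (hasDerivAt_ofReal_cpow_const (by linarith [hy.1]) (by
        rintro rfl
        norm_num at hw)).hasDerivWithinAt) (fun y hy => ?_) (convex_Icc _ _)
      (by simp) (by simp)
    · simpa using h
    · have hy0 : 0 < y := by linarith [hy.1]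
      rw [norm_mul, Complex.norm_cpow_eq_rpow_re_of_pos hy0, Complex.sub_re, hw]
      norm_num
      have := hy.2
      gcongr
  set N := ‖((x + 1 : ℝ) : ℂ) ^ w - (x : ℂ) ^ w‖ with hN
  have hN0 : 0 ≤ N := norm_nonneg _
  calc N = N ^ (1 - θ) * N ^ θ := by
        rw [← rpow_add_of_nonneg hN0 (by linarith) hθ0]
        simp
    _ ≤ (‖w‖ * (x + 1) ^ (1 / 2 : ℝ)) ^ (1 - θ) * (2 * (x + 1) ^ (3 / 2 : ℝ)) ^ θ :=
        mul_le_mul (rpow_le_rpow hN0 hB (by linarith)) (rpow_le_rpow hN0 hA hθ0)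
          (by positivity) (by positivity)
    _ = 2 ^ θ * ‖w‖ ^ (1 - θ) * (x + 1) ^ (1 / 2 + θ) := by
        rw [mul_rpow (norm_nonneg _) (by positivity), mul_rpow (by norm_num) (by positivity),
          ← rpow_mul hx1.le, ← rpow_mul hx1.le,
          show (1 / 2 + θ : ℝ) = 1 / 2 * (1 - θ) + 3 / 2 * θ by ring, rpow_add hx1]
        ring
    _ ≤ _ := by
        gcongr
        calc (2 : ℝ) ^ θ ≤ 2 ^ (1 : ℝ) := rpow_le_rpow_of_exponent_le (by norm_num) hθ1
          _ = 2 := rpow_one 2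

lemma norm_integral_unit_le {e : ℝ → ℂ} {G : ℂ → ℂ}
    (hei : ∀ a b, IntervalIntegrable e MeasureTheory.volume a b)
    (hφ : ∀ x : ℝ, 1 ≤ x →
      MeasureTheory.Integrable (fun t : ℝ => (x : ℂ) ^ (((1 / 2 : ℝ) : ℂ) + t * Complex.I + 1) *
        (G (((1 / 2 : ℝ) : ℂ) + t * Complex.I) / (((1 / 2 : ℝ) : ℂ) + t * Complex.I + 1))) ∧
      ∫ u in (1 : ℝ)..x, e u = (1 / (2 * π) : ℝ) *
        ∫ t : ℝ, (x : ℂ) ^ (((1 / 2 : ℝ) : ℂ) + t * Complex.I + 1) *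
          (G (((1 / 2 : ℝ) : ℂ) + t * Complex.I) / (((1 / 2 : ℝ) : ℂ) + t * Complex.I + 1)))
    {θ : ℝ} (hθ0 : 0 < θ) (hθ1 : θ ≤ 1)
    (hGi : MeasureTheory.Integrable fun t : ℝ =>
      ‖G (((1 / 2 : ℝ) : ℂ) + t * Complex.I)‖ * (1 + |t|) ^ (-θ)) :
    ∃ C : ℝ, 0 < C ∧ ∀ x, 1 ≤ x → ‖∫ u in x..(x + 1), e u‖ ≤ C * (x + 1) ^ (1 / 2 + θ) := by
  set J := ∫ t : ℝ, ‖G (((1 / 2 : ℝ) : ℂ) + t * Complex.I)‖ * (1 + |t|) ^ (-θ) with hJ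
  have hJ0 : 0 ≤ J := MeasureTheory.integral_nonneg fun t => by positivity
  refine ⟨4 * J + 1, by positivity, fun x hx => ?_⟩
  have hx1 : 0 < x + 1 := by linarith
  obtain ⟨hi1, he1⟩ := hφ x hx
  obtain ⟨hi2, he2⟩ := hφ (x + 1) (by linarith)
  rw [← intervalIntegral.integral_interval_sub_left (hei 1 (x + 1)) (hei 1 x), he1, he2, ← mul_sub,
    ← MeasureTheory.integral_sub hi2 hi1, norm_mul]
  have hpt : ∀ t : ℝ, ‖((x + 1 : ℝ) : ℂ) ^ (((1 / 2 : ℝ) : ℂ) + t * Complex.I + 1) *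
        (G (((1 / 2 : ℝ) : ℂ) + t * Complex.I) / (((1 / 2 : ℝ) : ℂ) + t * Complex.I + 1)) -
      (x : ℂ) ^ (((1 / 2 : ℝ) : ℂ) + t * Complex.I + 1) *
        (G (((1 / 2 : ℝ) : ℂ) + t * Complex.I) / (((1 / 2 : ℝ) : ℂ) + t * Complex.I + 1))‖ ≤
      4 * (x + 1) ^ (1 / 2 + θ) *
        (‖G (((1 / 2 : ℝ) : ℂ) + t * Complex.I)‖ * (1 + |t|) ^ (-θ)) := by
    intro t
    set w : ℂ := ((1 / 2 : ℝ) : ℂ) + t * Complex.I + 1 with hw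
    set g := G (((1 / 2 : ℝ) : ℂ) + t * Complex.I)
    have hwr : w.re = 3 / 2 := by simp [hw]; norm_num
    have hw1 : |t| ≤ ‖w‖ := by simpa [hw] using Complex.abs_im_le_norm w
    have hw2 : (1 : ℝ) ≤ ‖w‖ := by
      refine le_trans ?_ (Complex.re_le_norm _)
      rw [hwr]
      norm_num
    have hw0 : 0 < ‖w‖ := by linarith
    have hwθ : ‖w‖ ^ (-θ) ≤ 2 * (1 + |t|) ^ (-θ) := by
      have h1 : ((1 + |t|) / 2) ≤ ‖w‖ := by linarith
      calc ‖w‖ ^ (-θ) ≤ ((1 + |t|) / 2) ^ (-θ) :=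
            rpow_le_rpow_of_nonpos (by positivity) h1 (by linarith)
        _ = 2 ^ θ * (1 + |t|) ^ (-θ) := by
            rw [div_rpow (by positivity) (by norm_num), rpow_neg (by norm_num : (0 : ℝ) ≤ 2),
              div_inv_eq_mul, mul_comm]
        _ ≤ 2 ^ (1 : ℝ) * (1 + |t|) ^ (-θ) := by
            gcongr
            norm_num
        _ = _ := by rw [rpow_one]
    rw [← sub_mul, norm_mul, norm_div]
    calc _ ≤ 2 * ‖w‖ ^ (1 - θ) * (x + 1) ^ (1 / 2 + θ) * (‖g‖ / ‖w‖) :=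
          mul_le_mul_of_nonneg_right (norm_cpow_add_one_sub_le hx hwr hθ0.le hθ1) (by positivity)
      _ = 2 * (x + 1) ^ (1 / 2 + θ) * (‖g‖ * ‖w‖ ^ (-θ)) := by
          rw [show (1 - θ : ℝ) = 1 + -θ by ring, rpow_add hw0, rpow_one]
          field_simp
      _ ≤ 2 * (x + 1) ^ (1 / 2 + θ) * (‖g‖ * (2 * (1 + |t|) ^ (-θ))) := by gcongr
      _ = _ := by ring
  have hmain := MeasureTheory.norm_integral_le_of_norm_le (hGi.const_mul (4 * (x + 1) ^ (1 / 2 + θ)))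
    (Filter.Eventually.of_forall hpt)
  rw [MeasureTheory.integral_const_mul, ← hJ] at hmain
  have hpi : ‖((1 / (2 * π) : ℝ) : ℂ)‖ ≤ 1 := by
    rw [Complex.norm_real, norm_of_nonneg (by positivity), div_le_one (by positivity)]
    linarith [pi_gt_three]
  refine (mul_le_mul hpi hmain (norm_nonneg _) zero_le_one).trans ?_
  have : 0 ≤ (x + 1) ^ (1 / 2 + θ) := by positivity
  nlinarith

/-- Passing from unit averages of `D - M` to `D - M` itself, for monotone `D` and slowly varying
`M`. -/
lemma abs_sub_le_of_norm_integral_unit_le {D M : ℝ → ℝ} {e : ℝ → ℂ} (hD : Monotone D)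
    (hMc : ContinuousOn M (Set.Ici 1)) (heD : ∀ x, 1 ≤ x → (e x).re = D x - M x)
    (hei : ∀ a b, IntervalIntegrable e MeasureTheory.volume a b)
    {ε : ℝ} (hε : 0 < ε)
    (hM : ∃ C : ℝ, 0 < C ∧ ∀ X u : ℝ, 2 ≤ X → |u - X| ≤ 1 → |M u - M X| ≤ C * X ^ ε)
    (hu : ∃ C : ℝ, 0 < C ∧ ∀ x, 1 ≤ x → ‖∫ u in x..(x + 1), e u‖ ≤ C * (x + 1) ^ (1 / 2 + ε)) :
    ∃ C : ℝ, 0 < C ∧ ∀ X : ℝ, 2 ≤ X → |D X - M X| ≤ C * X ^ (1 / 2 + ε) := by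
  obtain ⟨C₁, hC₁, h1⟩ := hM
  obtain ⟨C₂, hC₂, h2⟩ := hu
  have hint : ∀ x, 1 ≤ x → |∫ u in x..(x + 1), (D u - M u)| ≤ C₂ * (x + 1) ^ (1 / 2 + ε) := by
    intro x hx
    refine le_trans ?_ ((Complex.abs_re_le_norm _).trans (h2 x hx))
    have h := Complex.reCLM.intervalIntegral_comp_comm (hei x (x + 1))
    rw [← Complex.reCLM_apply, ← h, intervalIntegral.integral_congr fun u hu => ?_]
    rw [Set.uIcc_of_le (by linarith)] at hu
    exact (heD u (by linarith [hu.1])).symm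
  have hMi : ∀ x, 1 ≤ x → IntervalIntegrable M MeasureTheory.volume x (x + 1) := by
    intro x hx
    refine (hMc.mono ?_).intervalIntegrable
    rw [Set.uIcc_of_le (by linarith)]
    intro u hu
    exact hx.trans hu.1
  refine ⟨C₁ + C₂ * 2 ^ (1 / 2 + ε), by positivity, fun X hX => ?_⟩
  have hX0 : 0 < X := by linarith
  have hXε : X ^ ε ≤ X ^ (1 / 2 + ε) := rpow_le_rpow_of_exponent_le (by linarith) (by linarith)
  have hX1 : (X + 1) ^ (1 / 2 + ε) ≤ 2 ^ (1 / 2 + ε) * X ^ (1 / 2 + ε) := by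
    rw [← mul_rpow (by norm_num) hX0.le]
    exact rpow_le_rpow (by linarith) (by linarith) (by linarith)
  have hX2 : X ^ (1 / 2 + ε) ≤ (X + 1) ^ (1 / 2 + ε) :=
    rpow_le_rpow hX0.le (by linarith) (by linarith)
  have hup : D X - M X - C₁ * X ^ ε ≤ C₂ * (X + 1) ^ (1 / 2 + ε) := by
    refine le_trans ?_ ((le_abs_self _).trans (hint X (by linarith)))
    have h := intervalIntegral.integral_mono_on (a := X) (b := X + 1) (μ := MeasureTheory.volume)
      (f := fun _ => D X - M X - C₁ * X ^ ε) (g := fun u => D u - M u) (by linarith)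
      intervalIntegrable_const ((hD.intervalIntegrable).sub (hMi X (by linarith))) fun u hu => ?_
    · simpa using h
    · have := hD hu.1
      have := h1 X u hX (by rw [abs_le]; constructor <;> linarith [hu.1, hu.2])
      linarith [(abs_le.1 this).2]
  have hlo : -(C₂ * X ^ (1 / 2 + ε)) ≤ D X - M X + C₁ * X ^ ε := by
    have hh := hint (X - 1) (by linarith)
    rw [sub_add_cancel] at hh
    refine ((abs_le.1 hh).1).trans ?_
    have h := intervalIntegral.integral_mono_on (a := X - 1) (b := X) (μ := MeasureTheory.volume)
      (f := fun u => D u - M u) (g := fun _ => D X - M X + C₁ * X ^ ε) (by linarith)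
      ((hD.intervalIntegrable).sub (by simpa using hMi (X - 1) (by linarith)))
      intervalIntegrable_const fun u hu => ?_
    · simpa using h
    · have := hD hu.2
      have := h1 X u hX (by rw [abs_le]; constructor <;> linarith [hu.1, hu.2])
      linarith [(abs_le.1 this).1]
  rw [abs_le]
  have e1 := mul_le_mul_of_nonneg_left hXε hC₁.le
  have e2 := mul_le_mul_of_nonneg_left hX1 hC₂.le
  have e3 := mul_le_mul_of_nonneg_left hX2 hC₂.le
  constructor <;> nlinarith

lemma exists_principal_part {U : Set ℂ} (hU : IsOpen U) {p : ℂ} (hp : p ∈ U) (m : ℕ) {q : ℂ → ℂ}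
    (hq : DifferentiableOn ℂ q U) : ∃ A : ℕ → ℂ, ∃ g : ℂ → ℂ, DifferentiableOn ℂ g U ∧
      ∀ s ∈ U, s ≠ p → q s / (s - p) ^ m =
        ∑ j ∈ Finset.range m, A j / (s - p) ^ (j + 1) + g s := by
  induction m generalizing q with
  | zero => exact ⟨0, q, hq, fun s _ _ => by simp⟩
  | succ m ih =>
    obtain ⟨A, g, hg, h⟩ := ih ((Complex.differentiableOn_dslope (hU.mem_nhds hp)).2 hq)
    refine ⟨fun j => if j = m then q p else A j, g, hg, fun s hs hsp => ?_⟩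
    have hne : s - p ≠ 0 := sub_ne_zero.2 hsp
    have h1 := h s hs hsp
    have h2 : ∀ j ∈ Finset.range m, (if j = m then q p else A j) / (s - p) ^ (j + 1) =
        A j / (s - p) ^ (j + 1) := fun j hj => by rw [if_neg (Finset.mem_range.1 hj).ne]
    have h3 : (fun j => if j = m then q p else A j) m = q p := if_pos rfl
    rw [Finset.sum_range_succ, Finset.sum_congr rfl h2, h3, add_right_comm, ← h1,
      dslope_of_ne _ hsp, slope_def_field]
    field_simp
    ring

lemma exists_partial_fractions {U : Set ℂ} (hU : IsOpen U) {p₁ p₂ : ℂ} (hp₁ : p₁ ∈ U)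
    (hp₂ : p₂ ∈ U) (hne : p₁ ≠ p₂) (m l : ℕ) {q : ℂ → ℂ} (hq : DifferentiableOn ℂ q U) :
    ∃ A B : ℕ → ℂ, ∃ G : ℂ → ℂ, DifferentiableOn ℂ G U ∧
      ∀ s ∈ U, s ≠ p₁ → s ≠ p₂ → q s / ((s - p₁) ^ m * (s - p₂) ^ l) =
        ∑ j ∈ Finset.range m, A j / (s - p₁) ^ (j + 1) +
        ∑ j ∈ Finset.range l, B j / (s - p₂) ^ (j + 1) + G s := by
  have hU₁ : IsOpen (U \ {p₁}) := hU.sdiff isClosed_singleton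
  have hU₂ : IsOpen (U \ {p₂}) := hU.sdiff isClosed_singleton
  have hdiv : ∀ (p : ℂ) (k : ℕ), DifferentiableOn ℂ (fun s => q s / (s - p) ^ k) (U \ {p}) := by
    intro p k
    refine (hq.mono Set.sdiff_subset).div (by fun_prop) fun s hs => ?_
    exact pow_ne_zero _ (sub_ne_zero.2 hs.2)
  have hsum : ∀ (A : ℕ → ℂ) (p : ℂ) (k : ℕ), DifferentiableOn ℂ
      (fun s => ∑ j ∈ Finset.range k, A j / (s - p) ^ (j + 1)) (U \ {p}) := by
    intro A p k
    refine DifferentiableOn.fun_sum fun j _ => ?_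
    refine (differentiableOn_const _).div (by fun_prop) fun s hs => ?_
    exact pow_ne_zero _ (sub_ne_zero.2 hs.2)
  obtain ⟨A, g₁, hg₁, h₁⟩ := exists_principal_part hU₂ (p := p₁) ⟨hp₁, hne⟩ m (hdiv p₂ l)
  obtain ⟨B, g₂, hg₂, h₂⟩ := exists_principal_part hU₁ (p := p₂) ⟨hp₂, hne.symm⟩ l (hdiv p₁ m)
  set P : ℂ → ℂ := fun s => ∑ j ∈ Finset.range m, A j / (s - p₁) ^ (j + 1) with hP
  set Q : ℂ → ℂ := fun s => ∑ j ∈ Finset.range l, B j / (s - p₂) ^ (j + 1) with hQ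
  set G : ℂ → ℂ := fun s => if s = p₂ then g₂ s - P s else g₁ s - Q s with hG
  have hcomm : ∀ s, q s / ((s - p₁) ^ m * (s - p₂) ^ l) = q s / (s - p₂) ^ l / (s - p₁) ^ m := by
    intro s
    rw [div_div, mul_comm]
  have hcomm' : ∀ s, q s / ((s - p₁) ^ m * (s - p₂) ^ l) = q s / (s - p₁) ^ m / (s - p₂) ^ l := by
    intro s
    rw [div_div]
  have hG₁ : ∀ s ∈ U \ {p₂}, G s = g₁ s - Q s := fun s hs => if_neg hs.2
  have hG₂ : ∀ s ∈ U \ {p₁}, G s = g₂ s - P s := by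
    intro s hs
    by_cases hs2 : s = p₂
    · exact if_pos hs2
    · have e1 := h₁ s ⟨hs.1, hs2⟩ hs.2
      have e2 := h₂ s hs hs2
      rw [← hcomm] at e1
      rw [← hcomm', e1] at e2
      rw [hG₁ s ⟨hs.1, hs2⟩]
      linear_combination e2
  refine ⟨A, B, G, fun s hs => ?_, fun s hs hs1 hs2 => ?_⟩
  · by_cases hs2 : s = p₂
    · have hmem : s ∈ U \ {p₁} := ⟨hs, by rw [hs2]; exact hne.symm⟩
      have hd : DifferentiableOn ℂ G (U \ {p₁}) := (hg₂.sub (hsum A p₁ m)).congr hG₂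
      exact ((hd s hmem).differentiableAt (hU₁.mem_nhds hmem)).differentiableWithinAt
    · have hmem : s ∈ U \ {p₂} := ⟨hs, hs2⟩
      have hd : DifferentiableOn ℂ G (U \ {p₂}) := (hg₁.sub (hsum B p₂ l)).congr hG₁
      exact ((hd s hmem).differentiableAt (hU₂.mem_nhds hmem)).differentiableWithinAt
  · rw [hG₁ s ⟨hs, hs2⟩, hcomm, h₁ s ⟨hs, hs2⟩ hs1]
    ring

lemma log_pow_le_factorial_mul {x : ℝ} (hx : 1 ≤ x) (j : ℕ) : log x ^ j ≤ j.factorial * x := by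
  have h := pow_div_factorial_le_exp (log x) (log_nonneg hx) j
  rwa [exp_log (by linarith), div_le_iff₀ (by positivity), mul_comm] at h

lemma integrableOn_log_pow_mul_cpow (j : ℕ) {z : ℂ} (hz : 1 < z.re) :
    MeasureTheory.IntegrableOn (fun x : ℝ => ((log x ^ j : ℝ) : ℂ) * (x : ℂ) ^ (-(z + 1)))
      (Set.Ioi 1) := by
  refine integrableOn_mul_cpow (e := fun x : ℝ => ((log x ^ j : ℝ) : ℂ)) (by fun_prop) (m := 1)
    (K := j.factorial) (fun x hx => ?_) (by simp; linarith)
  rw [Complex.norm_real, norm_of_nonneg (pow_nonneg (log_nonneg hx) _), pow_one]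
  exact log_pow_le_factorial_mul hx j

lemma integral_log_pow_mul_cpow (j : ℕ) {z : ℂ} (hz : 1 < z.re) :
    ∫ x in Set.Ioi (1 : ℝ), ((log x ^ j : ℝ) : ℂ) * (x : ℂ) ^ (-(z + 1)) =
      j.factorial / z ^ (j + 1) := by
  have hz0 : z ≠ 0 := by
    rintro rfl
    norm_num at hz
  induction j with
  | zero =>
    have h := integral_Ioi_cpow_of_lt (a := -(z + 1)) (by simp; linarith) one_pos
    simp only [pow_zero, Complex.ofReal_one, one_mul, Nat.factorial_zero, Nat.cast_one, zero_add,
      pow_one]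
    rw [h]
    simp
  | succ j ih =>
    set f : ℝ → ℂ := fun x => ((log x ^ (j + 1) : ℝ) : ℂ) * (x : ℂ) ^ (-z) with hf
    have hder : ∀ x ∈ Set.Ici (1 : ℝ), HasDerivAt f
        ((j + 1) * (((log x ^ j : ℝ) : ℂ) * (x : ℂ) ^ (-(z + 1))) -
          z * (((log x ^ (j + 1) : ℝ) : ℂ) * (x : ℂ) ^ (-(z + 1)))) x := by
      intro x hx
      have hx0 : (0 : ℝ) < x := one_pos.trans_le hx
      have hxc : (x : ℂ) ≠ 0 := by exact_mod_cast hx0.ne'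
      have h1 := ((hasDerivAt_log hx0.ne').pow (j + 1)).ofReal_comp
      have h2 := hasDerivAt_ofReal_cpow_const hx0.ne' (r := -z) (neg_ne_zero.2 hz0)
      refine (h1.mul h2).congr_deriv ?_
      have e1 : (x : ℂ) ^ (-z - 1) = (x : ℂ) ^ (-z) / x := by
        rw [Complex.cpow_sub _ _ hxc, Complex.cpow_one]
      have e2 : (x : ℂ) ^ (-(z + 1)) = (x : ℂ) ^ (-z) / x := by
        rw [neg_add', e1]
      rw [e1, e2]
      rw [Pi.pow_apply]
      push_cast
      field_simp
      ring
    have hi1 := (integrableOn_log_pow_mul_cpow j hz).const_mul ((j : ℂ) + 1)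
    have hi2 := (integrableOn_log_pow_mul_cpow (j + 1) hz).const_mul z
    have hlim : Filter.Tendsto f Filter.atTop (nhds 0) := by
      rw [tendsto_zero_iff_norm_tendsto_zero]
      have ht : Filter.Tendsto (fun x : ℝ => ((j + 1).factorial : ℝ) * x ^ (-(z.re - 1)))
          Filter.atTop (nhds 0) := by
        simpa using (tendsto_rpow_neg_atTop (by linarith : 0 < z.re - 1)).const_mul
          ((j + 1).factorial : ℝ)
      refine squeeze_zero' (Filter.Eventually.of_forall fun _ => norm_nonneg _) ?_ ht
      filter_upwards [Filter.eventually_ge_atTop 1] with x hx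
      have hx0 : 0 < x := by linarith
      rw [hf, norm_mul, Complex.norm_real, norm_of_nonneg (pow_nonneg (log_nonneg hx) _),
        Complex.norm_cpow_eq_rpow_re_of_pos hx0, Complex.neg_re]
      refine (mul_le_mul_of_nonneg_right (log_pow_le_factorial_mul hx (j + 1))
        (by positivity)).trans_eq ?_
      rw [mul_assoc, ← rpow_one_add' hx0.le (by linarith)]
      ring_nf
    have h := MeasureTheory.integral_Ioi_of_hasDerivAt_of_tendsto' hder (hi1.sub hi2) hlim
    rw [MeasureTheory.integral_sub hi1 hi2, MeasureTheory.integral_const_mul,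
      MeasureTheory.integral_const_mul, ih] at h
    have hf1 : f 1 = 0 := by simp [hf]
    rw [hf1, sub_zero, sub_eq_zero] at h
    rw [eq_div_iff (pow_ne_zero _ hz0), Nat.factorial_succ, pow_succ z, mul_comm, mul_assoc, ← h]
    push_cast
    field_simp

lemma LSeries_dk (k : ℕ) {s : ℂ} (hs : 1 < s.re) :
    LSeriesSummable (fun n => (dk k n : ℂ)) s ∧
      LSeries (fun n => (dk k n : ℂ)) s = riemannZeta s ^ k := by
  induction k with
  | zero =>
    have h : ∀ n : ℕ, n ≠ 0 → (dk 0 n : ℂ) = LSeries.delta n := by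
      intro n hn
      simp [dk, LSeries.delta, ArithmeticFunction.one_apply]
    refine ⟨(LSeriesSummable_congr s fun {n} hn => h n hn).2 ?_, ?_⟩
    · refine LSeriesSummable_of_isBigO_rpow (x := 0) (by linarith) ?_
      refine Asymptotics.IsBigO.of_bound 1 (Filter.Eventually.of_forall fun n => ?_)
      simp only [LSeries.delta]
      split_ifs with h1 <;> simp [h1]
    · rw [LSeries_congr (fun {n} hn => h n hn) s, LSeries_delta, pow_zero, Pi.one_apply]
  | succ k ih =>
    have h1 : LSeriesSummable (1 : ℕ → ℂ) s := LSeriesSummable_one_iff.2 hs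
    have h : ∀ n : ℕ, n ≠ 0 → (dk (k + 1) n : ℂ) =
        LSeries.convolution (fun n => (dk k n : ℂ)) 1 n := by
      intro n hn
      rw [dk_succ, LSeries.convolution_def]
      simp
    refine ⟨(LSeriesSummable_congr s fun {n} hn => h n hn).2 (ih.1.convolution h1), ?_⟩
    rw [LSeries_congr (fun {n} hn => h n hn) s, LSeries_convolution' ih.1 h1, ih.2,
      LSeries_one_eq_riemannZeta hs, pow_succ]

lemma LSeries_dWeighted (l : ℕ) {a : ℝ} (ha : 0 ≤ a) {s : ℂ} (hs : 1 < s.re) :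
    LSeriesSummable (fun n => (dWeighted l a n : ℂ)) s ∧
      LSeries (fun n => (dWeighted l a n : ℂ)) s = zetaProd l a s := by
  have h4 := LSeries_dk 4 hs
  have hl := LSeries_dk l (s := s + a) (by simp; linarith)
  have hterm : ∀ n, LSeries.term (fun n => (((dk l n : ℝ) * (n : ℝ) ^ (-a) : ℝ) : ℂ)) s n =
      LSeries.term (fun n => (dk l n : ℂ)) (s + a) n := by
    intro n
    rcases eq_or_ne n 0 with rfl | hn
    · simp
    · rw [LSeries.term_of_ne_zero hn, LSeries.term_of_ne_zero hn,
        Complex.cpow_add _ _ (Nat.cast_ne_zero.2 hn), rpow_neg (Nat.cast_nonneg n)]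
      push_cast
      rw [Complex.ofReal_cpow (Nat.cast_nonneg n)]
      push_cast
      field_simp
  have hg1 : LSeriesSummable (fun n => (((dk l n : ℝ) * (n : ℝ) ^ (-a) : ℝ) : ℂ)) s := by
    rw [LSeriesSummable, funext hterm]
    exact hl.1
  have hg2 : LSeries (fun n => (((dk l n : ℝ) * (n : ℝ) ^ (-a) : ℝ) : ℂ)) s =
      riemannZeta (s + a) ^ l := by
    rw [LSeries, funext hterm]
    exact hl.2
  have h : ∀ n : ℕ, n ≠ 0 → (dWeighted l a n : ℂ) =
      LSeries.convolution (fun n => (dk 4 n : ℂ))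
        (fun n => (((dk l n : ℝ) * (n : ℝ) ^ (-a) : ℝ) : ℂ)) n := by
    intro n hn
    rw [dWeighted, LSeries.convolution_def]
    push_cast
    refine Finset.sum_congr rfl fun p _ => by ring
  refine ⟨(LSeriesSummable_congr s fun {n} hn => h n hn).2 (h4.1.convolution hg1), ?_⟩
  rw [LSeries_congr (fun {n} hn => h n hn) s, LSeries_convolution' h4.1 hg1, h4.2, hg2, zetaProd]

lemma dWeighted_nonneg (l : ℕ) (a : ℝ) (n : ℕ) : 0 ≤ dWeighted l a n :=
  Finset.sum_nonneg fun p _ => by positivity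

lemma sum_dWeighted_le (l : ℕ) {a : ℝ} (ha : 0 ≤ a) : ∃ K : ℝ, 0 < K ∧ ∀ n : ℕ,
    ∑ k ∈ Finset.Icc 1 n, dWeighted l a k ≤ K * (n : ℝ) ^ 2 := by
  have hs := (LSeries_dWeighted l ha (s := 2) (by norm_num)).1.norm
  refine ⟨(∑' n, ‖LSeries.term (fun n => (dWeighted l a n : ℂ)) 2 n‖) + 1, ?_, fun n => ?_⟩
  · have : 0 ≤ ∑' n, ‖LSeries.term (fun n => (dWeighted l a n : ℂ)) 2 n‖ :=
      tsum_nonneg fun _ => norm_nonneg _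
    linarith
  · calc ∑ k ∈ Finset.Icc 1 n, dWeighted l a k
        ≤ ∑ k ∈ Finset.Icc 1 n, ‖LSeries.term (fun n => (dWeighted l a n : ℂ)) 2 k‖ *
          (n : ℝ) ^ 2 := by
          refine Finset.sum_le_sum fun k hk => ?_
          rw [Finset.mem_Icc] at hk
          have hk0 : k ≠ 0 := by lia
          have hkp : (0 : ℝ) < k := by exact_mod_cast Nat.pos_of_ne_zero hk0
          have hkn : (k : ℝ) ≤ n := by exact_mod_cast hk.2
          rw [LSeries.term_of_ne_zero hk0, norm_div, Complex.norm_real,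
            norm_of_nonneg (dWeighted_nonneg _ _ _), Complex.norm_natCast_cpow_of_pos
            (Nat.pos_of_ne_zero hk0)]
          have h2 : (k : ℝ) ^ (2 : ℂ).re = (k : ℝ) ^ 2 := by
            rw [Complex.re_ofNat, rpow_ofNat]
          rw [h2, div_mul_eq_mul_div, le_div_iff₀ (by positivity)]
          have := dWeighted_nonneg l a k
          gcongr
      _ ≤ _ := by
          rw [← Finset.sum_mul]
          refine mul_le_mul_of_nonneg_right ?_ (by positivity)
          have := hs.sum_le_tsum (Finset.Icc 1 n) fun _ _ => norm_nonneg _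
          linarith

/-- The summatory function of the weighted divisor function. -/
noncomputable def summatory (l : ℕ) (a : ℝ) (x : ℝ) : ℝ :=
  ∑ n ∈ Finset.Icc 1 ⌊x⌋₊, dWeighted l a n

lemma monotone_summatory (l : ℕ) (a : ℝ) : Monotone (summatory l a) := by
  intro x y hxy
  refine Finset.sum_le_sum_of_subset_of_nonneg ?_ fun n _ _ => dWeighted_nonneg l a n
  exact Finset.Icc_subset_Icc_right (Nat.floor_mono hxy)

lemma summatory_nonneg (l : ℕ) (a x : ℝ) : 0 ≤ summatory l a x :=
  Finset.sum_nonneg fun n _ => dWeighted_nonneg l a n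

lemma summatory_le (l : ℕ) {a : ℝ} (ha : 0 ≤ a) : ∃ K : ℝ, 0 < K ∧ ∀ x : ℝ, 0 ≤ x →
    summatory l a x ≤ K * x ^ 2 := by
  obtain ⟨K, hK, h⟩ := sum_dWeighted_le l ha
  refine ⟨K, hK, fun x hx => (h _).trans ?_⟩
  have := Nat.floor_le hx
  gcongr

lemma continuousWithinAt_summatory (l : ℕ) (a : ℝ) {x : ℝ} (hx : 0 ≤ x) :
    ContinuousWithinAt (summatory l a) (Set.Ioi x) x := by
  refine (continuousWithinAt_const (b := summatory l a x)).congr_of_eventuallyEq ?_ rfl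
  have h : Set.Ioo x (⌊x⌋₊ + 1) ∈ nhdsWithin x (Set.Ioi x) :=
    Ioo_mem_nhdsGT (Nat.lt_floor_add_one x)
  filter_upwards [h] with y hy
  have : ⌊y⌋₊ = ⌊x⌋₊ := by
    rw [Nat.floor_eq_iff (hx.trans hy.1.le)]
    exact ⟨(Nat.floor_le hx).trans hy.1.le, hy.2⟩
  rw [summatory, summatory, this]

lemma integral_summatory_mul_cpow (l : ℕ) {a : ℝ} (ha : 0 ≤ a) {s : ℂ} (hs : 2 < s.re) :
    ∫ x in Set.Ioi (1 : ℝ), (summatory l a x : ℂ) * (x : ℂ) ^ (-(s + 1)) =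
      zetaProd l a s / s := by
  have hs0 : s ≠ 0 := by
    rintro rfl
    norm_num at hs
  obtain ⟨K, hK, h⟩ := sum_dWeighted_le l ha
  have hO : (fun n : ℕ => ∑ k ∈ Finset.Icc 1 n, dWeighted l a k) =O[Filter.atTop]
      fun n : ℕ => (n : ℝ) ^ (2 : ℝ) := by
    refine Asymptotics.IsBigO.of_bound K (Filter.Eventually.of_forall fun n => ?_)
    rw [norm_of_nonneg (Finset.sum_nonneg fun n _ => dWeighted_nonneg l a n),
      norm_of_nonneg (by positivity), rpow_ofNat]
    exact h n
  have hmain := LSeries_eq_mul_integral_of_nonneg (fun n => dWeighted l a n) (r := 2)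
    (by norm_num) hs hO (dWeighted_nonneg l a)
  rw [eq_div_iff hs0, ← (LSeries_dWeighted l ha (by linarith : 1 < s.re)).2, hmain, mul_comm]
  simp only [summatory, Complex.ofReal_sum]

/-- The main term `x^p ∑_{j < n} (A j / j!) (log x)^j` coming from a pole at `p`. -/
noncomputable def polarTerm (p : ℝ) (n : ℕ) (A : ℕ → ℂ) (x : ℝ) : ℂ :=
  ((x ^ p : ℝ) : ℂ) * ∑ j ∈ Finset.range n, A j / j.factorial * ((log x ^ j : ℝ) : ℂ)

lemma measurable_polarTerm (p : ℝ) (n : ℕ) (A : ℕ → ℂ) : Measurable (polarTerm p n A) := by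
  unfold polarTerm
  fun_prop

lemma continuousAt_polarTerm (p : ℝ) (n : ℕ) (A : ℕ → ℂ) {x : ℝ} (hx : 0 < x) :
    ContinuousAt (polarTerm p n A) x := by
  have h1 : ContinuousAt (fun x : ℝ => ((x ^ p : ℝ) : ℂ)) x :=
    Complex.continuous_ofReal.continuousAt.comp (continuousAt_rpow_const _ _ (Or.inl hx.ne'))
  have h2 : ∀ j : ℕ, ContinuousAt (fun x : ℝ => ((log x ^ j : ℝ) : ℂ)) x := fun j =>
    Complex.continuous_ofReal.continuousAt.comp ((continuousAt_log hx.ne').pow j)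
  refine h1.mul (tendsto_finsetSum _ fun j _ => ?_)
  exact continuousAt_const.mul (h2 j)

lemma norm_polarTerm_le {p : ℝ} (hp : p ≤ 1) (n : ℕ) (A : ℕ → ℂ) {x : ℝ} (hx : 1 ≤ x) :
    ‖polarTerm p n A x‖ ≤ (∑ j ∈ Finset.range n, ‖A j‖) * x ^ 2 := by
  have hx0 : 0 < x := by linarith
  have h1 : x ^ p ≤ x := by
    simpa using rpow_le_rpow_of_exponent_le hx hp
  have h2 : ‖∑ j ∈ Finset.range n, A j / j.factorial * ((log x ^ j : ℝ) : ℂ)‖ ≤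
      (∑ j ∈ Finset.range n, ‖A j‖) * x := by
    rw [Finset.sum_mul]
    refine norm_sum_le_of_le _ fun j _ => ?_
    rw [norm_mul, norm_div, Complex.norm_natCast, Complex.norm_real,
      norm_of_nonneg (pow_nonneg (log_nonneg hx) _), div_mul_eq_mul_div, mul_div_assoc]
    refine mul_le_mul_of_nonneg_left ?_ (norm_nonneg _)
    rw [div_le_iff₀ (by positivity), mul_comm]
    exact log_pow_le_factorial_mul hx j
  rw [polarTerm, norm_mul, Complex.norm_real, norm_of_nonneg (by positivity)]
  calc _ ≤ x * ((∑ j ∈ Finset.range n, ‖A j‖) * x) := by gcongr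
    _ = _ := by ring

lemma integral_polarTerm_mul_cpow (p : ℝ) (n : ℕ) (A : ℕ → ℂ) {s : ℂ} (hs : p + 1 < s.re) :
    MeasureTheory.IntegrableOn (fun x : ℝ => polarTerm p n A x * (x : ℂ) ^ (-(s + 1)))
      (Set.Ioi 1) ∧
    ∫ x in Set.Ioi (1 : ℝ), polarTerm p n A x * (x : ℂ) ^ (-(s + 1)) =
      ∑ j ∈ Finset.range n, A j / (s - p) ^ (j + 1) := by
  have hz : 1 < (s - p).re := by simp; linarith
  have heq : ∀ x ∈ Set.Ioi (1 : ℝ), ∑ j ∈ Finset.range n, A j / j.factorial *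
      (((log x ^ j : ℝ) : ℂ) * (x : ℂ) ^ (-(s - p + 1))) =
      polarTerm p n A x * (x : ℂ) ^ (-(s + 1)) := by
    intro x hx
    have hx0 : 0 < x := one_pos.trans hx
    have hxc : (x : ℂ) ≠ 0 := by exact_mod_cast hx0.ne'
    rw [polarTerm, Complex.ofReal_cpow hx0.le, mul_right_comm, ← Complex.cpow_add _ _ hxc,
      Finset.mul_sum]
    refine Finset.sum_congr rfl fun j _ => ?_
    rw [show (p : ℂ) + -(s + 1) = -(s - p + 1) by ring]
    ring
  have hi : ∀ j ∈ Finset.range n, MeasureTheory.IntegrableOn (fun x : ℝ => A j / j.factorial *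
      (((log x ^ j : ℝ) : ℂ) * (x : ℂ) ^ (-(s - p + 1)))) (Set.Ioi 1) := fun j _ =>
    (integrableOn_log_pow_mul_cpow j hz).const_mul _
  constructor
  · refine MeasureTheory.IntegrableOn.congr_fun ?_ heq measurableSet_Ioi
    exact MeasureTheory.integrable_finsetSum _ hi
  · rw [← MeasureTheory.setIntegral_congr_fun measurableSet_Ioi heq,
      MeasureTheory.integral_finsetSum _ hi]
    refine Finset.sum_congr rfl fun j _ => ?_
    rw [MeasureTheory.integral_const_mul, integral_log_pow_mul_cpow j hz]
    have : (j.factorial : ℂ) ≠ 0 := by exact_mod_cast j.factorial_ne_zero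
    field_simp

lemma re_polarTerm (p : ℝ) (n : ℕ) (A : ℕ → ℂ) (x : ℝ) : (polarTerm p n A x).re =
    x ^ p * ∑ j ∈ Finset.range n, (A j / j.factorial).re * log x ^ j := by
  rw [polarTerm, Complex.re_ofReal_mul, Complex.re_sum]
  congr 1
  refine Finset.sum_congr rfl fun j _ => ?_
  rw [Complex.re_mul_ofReal]

lemma abs_rpow_mul_log_pow_sub_le {p : ℝ} (hp0 : 0 ≤ p) (hp1 : p ≤ 1) (j : ℕ) {ε : ℝ}
    (hε : 0 < ε) : ∃ C : ℝ, 0 < C ∧ ∀ X u : ℝ, 2 ≤ X → |u - X| ≤ 1 →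
      |u ^ p * log u ^ j - X ^ p * log X ^ j| ≤ C * X ^ ε := by
  set δ : ℝ := ε / (j + 1) with hδ
  have hδ0 : 0 < δ := by positivity
  set B : ℝ := 1 + 1 / δ with hB
  have hB1 : 1 ≤ B := by
    have : 0 < 1 / δ := by positivity
    linarith
  refine ⟨(1 + j) * (B ^ j * 2 ^ ε), by positivity, fun X u hX hu => ?_⟩
  rw [abs_le] at hu
  have hlog : ∀ y : ℝ, 1 ≤ y → y ≤ 2 * X → ∀ i ≤ j, log y ^ i ≤ B ^ j * 2 ^ ε * X ^ ε := by
    intro y h1 h2 i hi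
    have hy0 : 0 < y := by linarith
    have hl0 := log_nonneg h1
    have hle : log y ≤ B * y ^ δ := by
      have := one_add_log_le_rpow δ hδ0 y h1
      linarith
    have hone : 1 ≤ B * y ^ δ := by
      have := one_add_log_le_rpow δ hδ0 y h1
      linarith
    calc log y ^ i ≤ (B * y ^ δ) ^ i := pow_le_pow_left₀ hl0 hle i
      _ ≤ (B * y ^ δ) ^ j := pow_le_pow_right₀ hone hi
      _ = B ^ j * y ^ (δ * j) := by rw [mul_pow, ← rpow_mul_natCast hy0.le]
      _ ≤ B ^ j * y ^ ε := by
          gcongr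
          rw [hδ, div_mul_eq_mul_div, div_le_iff₀ (by positivity)]
          nlinarith
      _ ≤ B ^ j * (2 * X) ^ ε := by gcongr
      _ = _ := by rw [mul_rpow (by norm_num) (by linarith), mul_assoc]
  have hder : ∀ y ∈ Set.Icc (X - 1) (X + 1), HasDerivWithinAt (fun y : ℝ => y ^ p * log y ^ j)
      (p * y ^ (p - 1) * log y ^ j + y ^ p * (j * log y ^ (j - 1) * y⁻¹))
      (Set.Icc (X - 1) (X + 1)) y := by
    intro y hy
    have hy0 : y ≠ 0 := by linarith [hy.1]
    exact ((hasDerivAt_rpow_const (Or.inl hy0)).mul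
      ((hasDerivAt_log hy0).pow j)).hasDerivWithinAt
  have h := Convex.norm_image_sub_le_of_norm_hasDerivWithin_le hder (x := X) (y := u)
    (C := (1 + j) * (B ^ j * 2 ^ ε) * X ^ ε) (fun y hy => ?_) (convex_Icc _ _)
    (by constructor <;> linarith) (by constructor <;> linarith [hu.1, hu.2])
  · refine h.trans ?_
    have h1 : ‖u - X‖ ≤ 1 := abs_le.2 hu
    have : 0 ≤ (1 + j) * (B ^ j * 2 ^ ε) * X ^ ε := by positivity
    nlinarith
  · have hy1 : 1 ≤ y := by linarith [hy.1]
    have hy0 : 0 < y := by linarith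
    have hl0 := log_nonneg hy1
    have hyp : y ^ (p - 1) ≤ 1 := rpow_le_one_of_one_le_of_nonpos hy1 (by linarith)
    have e1 := hlog y hy1 (by linarith [hy.2]) j le_rfl
    have e2 := hlog y hy1 (by linarith [hy.2]) (j - 1) (Nat.sub_le _ _)
    have e3 : y ^ p * (j * log y ^ (j - 1) * y⁻¹) = y ^ (p - 1) * (j * log y ^ (j - 1)) := by
      rw [rpow_sub_one hy0.ne']
      ring
    rw [e3, norm_of_nonneg (by positivity)]
    calc _ ≤ 1 * 1 * (B ^ j * 2 ^ ε * X ^ ε) + 1 * (j * (B ^ j * 2 ^ ε * X ^ ε)) := by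
          gcongr
      _ = _ := by ring

lemma abs_re_polarTerm_sub_le {p : ℝ} (hp0 : 0 ≤ p) (hp1 : p ≤ 1) (n : ℕ) (A : ℕ → ℂ) {ε : ℝ}
    (hε : 0 < ε) : ∃ C : ℝ, 0 < C ∧ ∀ X u : ℝ, 2 ≤ X → |u - X| ≤ 1 →
      |(polarTerm p n A u).re - (polarTerm p n A X).re| ≤ C * X ^ ε := by
  choose C hC h using fun j => abs_rpow_mul_log_pow_sub_le hp0 hp1 j hε
  refine ⟨(∑ j ∈ Finset.range n, |(A j / j.factorial).re| * C j) + 1, ?_, fun X u hX hu => ?_⟩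
  · have : 0 ≤ ∑ j ∈ Finset.range n, |(A j / j.factorial).re| * C j :=
      Finset.sum_nonneg fun j _ => mul_nonneg (abs_nonneg _) (hC j).le
    linarith
  · have hX0 : 0 < X := by linarith
    have hXε : 0 < X ^ ε := by positivity
    rw [re_polarTerm, re_polarTerm, Finset.mul_sum, Finset.mul_sum, ← Finset.sum_sub_distrib]
    have hs : |∑ j ∈ Finset.range n, (u ^ p * ((A j / j.factorial).re * log u ^ j) -
        X ^ p * ((A j / j.factorial).re * log X ^ j))| ≤
        ∑ j ∈ Finset.range n, |(A j / j.factorial).re| * C j * X ^ ε := by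
      refine (Finset.abs_sum_le_sum_abs _ _).trans (Finset.sum_le_sum fun j _ => ?_)
      rw [mul_left_comm, mul_left_comm (X ^ p), ← mul_sub, abs_mul, mul_assoc]
      exact mul_le_mul_of_nonneg_left (h j X u hX hu) (abs_nonneg _)
    rw [← Finset.sum_mul] at hs
    nlinarith

lemma exists_zetaProd_decomposition (l : ℕ) {a : ℝ} (ha0 : 0 < a) (ha1 : a < 1) :
    ∃ A B : ℕ → ℂ, ∃ G : ℂ → ℂ, DifferentiableOn ℂ G {s | 0 < s.re} ∧
      ∀ s : ℂ, 0 < s.re → s ≠ 1 → s ≠ ((1 - a : ℝ) : ℂ) → zetaProd l a s / s =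
        ∑ j ∈ Finset.range 4, A j / (s - (1 : ℝ)) ^ (j + 1) +
        ∑ j ∈ Finset.range l, B j / (s - (1 - a : ℝ)) ^ (j + 1) + G s := by
  have hU : IsOpen {s : ℂ | 0 < s.re} := isOpen_lt continuous_const Complex.continuous_re
  have hne : ((1 : ℝ) : ℂ) ≠ ((1 - a : ℝ) : ℂ) := by
    intro h
    have := Complex.ofReal_injective h
    linarith
  have hq : DifferentiableOn ℂ (fun s => riemannZeta₁ s ^ 4 * riemannZeta₁ (s + a) ^ l / s)
      {s : ℂ | 0 < s.re} := by
    refine DifferentiableOn.div (DifferentiableOn.mul ?_ ?_) differentiableOn_id fun s hs h0 => ?_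
    · exact (differentiable_riemannZeta₁.pow 4).differentiableOn
    · exact ((differentiable_riemannZeta₁.comp (by fun_prop)).pow l).differentiableOn
    · rw [h0] at hs
      exact lt_irrefl (0 : ℝ) hs
  obtain ⟨A, B, G, hG, h⟩ := exists_partial_fractions hU (p₁ := ((1 : ℝ) : ℂ))
    (p₂ := ((1 - a : ℝ) : ℂ)) (by simp) (by simpa using ha1) hne 4 l hq
  refine ⟨A, B, G, hG, fun s hs h1 h2 => ?_⟩
  rw [← h s hs (by simpa using h1) h2]
  have hs1 : s - ((1 : ℝ) : ℂ) ≠ 0 := sub_ne_zero.2 (by simpa using h1)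
  have hs2 : s - ((1 - a : ℝ) : ℂ) ≠ 0 := sub_ne_zero.2 h2
  have hs0 : s ≠ 0 := by
    rintro rfl
    simp at hs
  have hsa : s + a ≠ 1 := by
    intro hh
    apply h2
    push_cast
    linear_combination hh
  have e1 := sub_one_mul_riemannZeta h1
  have e2 := sub_one_mul_riemannZeta hsa
  have e3 : s - ((1 : ℝ) : ℂ) = s - 1 := by simp
  have e4 : s - ((1 - a : ℝ) : ℂ) = s + a - 1 := by
    push_cast
    ring
  rw [e3] at hs1 ⊢
  rw [e4] at hs2 ⊢
  rw [zetaProd, ← e1, ← e2, mul_pow, mul_pow]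
  field_simp

lemma norm_polar_sum_le (n : ℕ) (A : ℕ → ℂ) (p x y : ℝ) (hy : 1 ≤ |y|) :
    ‖∑ j ∈ Finset.range n, A j / ((x : ℂ) + y * Complex.I - p) ^ (j + 1)‖ ≤
      (∑ j ∈ Finset.range n, ‖A j‖) * |y|⁻¹ := by
  have hy0 : 0 < |y| := by linarith
  have h : |y| ≤ ‖(x : ℂ) + y * Complex.I - p‖ := by
    simpa using Complex.abs_im_le_norm ((x : ℂ) + y * Complex.I - p)
  rw [Finset.sum_mul]
  refine norm_sum_le_of_le _ fun j _ => ?_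
  rw [norm_div, norm_pow, div_eq_mul_inv]
  refine mul_le_mul_of_nonneg_left (inv_anti₀ hy0 ?_) (norm_nonneg _)
  calc |y| ≤ |y| ^ (j + 1) := le_self_pow₀ hy (by lia)
    _ ≤ _ := pow_le_pow_left₀ hy0.le h _

lemma norm_zetaProd_strip_le (l : ℕ) (hl : l ≤ 6) {a : ℝ} (ha0 : 0 < a) (ha1 : a < 1) :
    ∃ C : ℝ, 0 < C ∧ ∀ x y : ℝ, 1 / 2 ≤ x → x ≤ 3 → 1 ≤ |y| →
      ‖zetaProd l a (x + y * Complex.I)‖ ≤ C * |y| ^ (19 / 10 : ℝ) := by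
  obtain ⟨C, hC, h⟩ := norm_zeta_le_sixth (1 / 50) 4 (by norm_num)
  set D := max C 1 with hD
  have hD1 : 1 ≤ D := le_max_right _ _
  have hD0 : 0 < D := by linarith
  refine ⟨D ^ 10, by positivity, fun x y hx1 hx2 hy => ?_⟩
  have hy0 : 0 < |y| := by linarith
  set R := D * |y| ^ (1 / 6 + 1 / 50 : ℝ) with hR
  have hR1 : 1 ≤ R := one_le_mul_of_one_le_of_one_le hD1 (one_le_rpow hy (by norm_num))
  have hz : ∀ σ : ℝ, 1 / 2 ≤ σ → σ ≤ 4 → ‖riemannZeta (σ + y * Complex.I)‖ ≤ R := fun σ h1 h2 =>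
    (h σ y h1 h2 hy).trans (mul_le_mul_of_nonneg_right (le_max_left _ _) (by positivity))
  have h1 := hz x hx1 (by linarith)
  have h2 := hz (x + a) (by linarith) (by linarith)
  rw [zetaProd, norm_mul, norm_pow, norm_pow,
    show (x : ℂ) + y * Complex.I + a = ((x + a : ℝ) : ℂ) + y * Complex.I by push_cast; ring]
  calc _ ≤ R ^ 4 * R ^ l := by gcongr
    _ ≤ R ^ 4 * R ^ 6 := by gcongr
    _ = D ^ 10 * |y| ^ ((1 / 6 + 1 / 50 : ℝ) * 10) := by
        rw [← pow_add, hR, mul_pow, ← rpow_natCast (|y| ^ _), ← rpow_mul hy0.le]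
        norm_num
    _ ≤ _ := by
        gcongr
        norm_num

lemma norm_zetaProd_three_le (l : ℕ) {a : ℝ} (ha : 0 ≤ a) : ∃ C : ℝ, 0 < C ∧ ∀ y : ℝ,
    ‖zetaProd l a ((3 : ℝ) + y * Complex.I)‖ ≤ C := by
  have hs := (LSeries_dWeighted l ha (s := 3) (by norm_num)).1.norm
  set S := ∑' n, ‖LSeries.term (fun n => (dWeighted l a n : ℂ)) 3 n‖ with hS
  have hS0 : 0 ≤ S := tsum_nonneg fun _ => norm_nonneg _
  refine ⟨S + 1, by linarith, fun y => ?_⟩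
  have h := LSeries_dWeighted l ha (s := (3 : ℝ) + y * Complex.I) (by simp)
  have hn : ∀ n, ‖LSeries.term (fun n => (dWeighted l a n : ℂ)) ((3 : ℝ) + y * Complex.I) n‖ =
      ‖LSeries.term (fun n => (dWeighted l a n : ℂ)) 3 n‖ := by
    intro n
    rw [LSeries.norm_term_eq, LSeries.norm_term_eq]
    simp
  rw [← h.2, LSeries]
  refine (norm_tsum_le_tsum_norm h.1.norm).trans ?_
  rw [tsum_congr hn]
  linarith

lemma norm_regular_part_le {l : ℕ} {a : ℝ} {A B : ℕ → ℂ} {G : ℂ → ℂ}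
    (h : ∀ s : ℂ, 0 < s.re → s ≠ 1 → s ≠ ((1 - a : ℝ) : ℂ) → zetaProd l a s / s =
        ∑ j ∈ Finset.range 4, A j / (s - (1 : ℝ)) ^ (j + 1) +
        ∑ j ∈ Finset.range l, B j / (s - (1 - a : ℝ)) ^ (j + 1) + G s)
    {x y : ℝ} (hx : 0 < x) (hy : 1 ≤ |y|) :
    ‖G (x + y * Complex.I)‖ ≤ (‖zetaProd l a (x + y * Complex.I)‖ +
      (∑ j ∈ Finset.range 4, ‖A j‖ + ∑ j ∈ Finset.range l, ‖B j‖)) * |y|⁻¹ := by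
  have hy0 : 0 < |y| := by linarith
  have hne : ∀ p : ℝ, (x : ℂ) + y * Complex.I ≠ p := by
    intro p hp
    have := congrArg Complex.im hp
    simp at this
    simp [this] at hy0
  have h1 := h (x + y * Complex.I) (by simpa using hx) (by exact_mod_cast hne 1) (hne _)
  have h2 : ‖zetaProd l a (x + y * Complex.I) / (x + y * Complex.I)‖ ≤
      ‖zetaProd l a (x + y * Complex.I)‖ * |y|⁻¹ := by
    rw [norm_div, div_eq_mul_inv]
    refine mul_le_mul_of_nonneg_left (inv_anti₀ hy0 ?_) (norm_nonneg _)
    simpa using Complex.abs_im_le_norm ((x : ℂ) + y * Complex.I)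
  have h3 := norm_polar_sum_le 4 A 1 x y hy
  have h4 := norm_polar_sum_le l B (1 - a) x y hy
  rw [← sub_eq_iff_eq_add'] at h1
  rw [← h1]
  refine (norm_sub_le _ _).trans ?_
  linarith [norm_add_le (∑ j ∈ Finset.range 4, A j / ((x : ℂ) + y * Complex.I - (1 : ℝ)) ^ (j + 1))
    (∑ j ∈ Finset.range l, B j / ((x : ℂ) + y * Complex.I - (1 - a : ℝ)) ^ (j + 1))]

lemma integrable_regular_part {l : ℕ} (hl1 : 1 ≤ l) (hl6 : l ≤ 6) {a : ℝ} (ha : 0.440002 ≤ a)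
    (ha2 : a < 1 / 2) {A B : ℕ → ℂ} {G : ℂ → ℂ} (hGd : DifferentiableOn ℂ G {s | 0 < s.re})
    (h : ∀ s : ℂ, 0 < s.re → s ≠ 1 → s ≠ ((1 - a : ℝ) : ℂ) → zetaProd l a s / s =
        ∑ j ∈ Finset.range 4, A j / (s - (1 : ℝ)) ^ (j + 1) +
        ∑ j ∈ Finset.range l, B j / (s - (1 - a : ℝ)) ^ (j + 1) + G s) {θ : ℝ} (hθ : 0 < θ) :
    MeasureTheory.Integrable fun t : ℝ =>
      ‖G (((1 / 2 : ℝ) : ℂ) + t * Complex.I)‖ * (1 + |t|) ^ (-θ) := by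
  have hGc : Continuous fun t : ℝ => ‖G (((1 / 2 : ℝ) : ℂ) + t * Complex.I)‖ :=
    (hGd.continuousOn.comp_continuous (by fun_prop) fun t => by simp).norm
  obtain ⟨M, hM⟩ := (isCompact_Icc (a := (-1 : ℝ)) (b := 1)).exists_bound_of_continuousOn
    hGc.continuousOn
  set S := ∑ j ∈ Finset.range 4, ‖A j‖ + ∑ j ∈ Finset.range l, ‖B j‖ with hS
  have hS0 : 0 ≤ S := by positivity
  have hM0 : 0 ≤ M := (norm_nonneg _).trans (hM 0 (by simp))
  have hone : MeasureTheory.Integrable fun t : ℝ => (1 + |t|) ^ (-(1 + θ)) := by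
    have := integrable_one_add_norm (E := ℝ) (μ := MeasureTheory.volume) (r := 1 + θ)
      (by simpa using hθ)
    simpa using this
  refine (((integrable_zetaProd l hl1 hl6 a ha ha2 θ hθ).const_mul 2).add
    (hone.const_mul (2 * S + 2 * M))).mono' ?_ (Filter.Eventually.of_forall fun t => ?_)
  · refine (hGc.mul ?_).aestronglyMeasurable
    exact (by fun_prop : Continuous fun t : ℝ => 1 + |t|).rpow_const
      fun t => Or.inl (by positivity)
  · have ht0 : 0 < 1 + |t| := by positivity
    have hpow : (1 + |t|) ^ (-θ) = (1 + |t|) * (1 + |t|) ^ (-(1 + θ)) := by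
      rw [← rpow_one_add' ht0.le (by linarith)]
      ring_nf
    have hP : 0 < (1 + |t|) ^ (-(1 + θ)) := by positivity
    set Z := ‖zetaProd l a (((1 / 2 : ℝ) : ℂ) + t * Complex.I)‖ with hZ
    have hZ0 : 0 ≤ Z := norm_nonneg _
    have key : ‖G (((1 / 2 : ℝ) : ℂ) + t * Complex.I)‖ * (1 + |t|) ≤ 2 * Z + (2 * S + 2 * M) := by
      rcases le_total 1 |t| with ht | ht
      · have h1 := norm_regular_part_le h (x := 1 / 2) (by norm_num) ht
        rw [← hS, ← hZ] at h1
        have h2 : |t|⁻¹ * (1 + |t|) ≤ 2 := by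
          rw [inv_mul_le_iff₀ (by linarith)]
          linarith
        calc _ ≤ (Z + S) * |t|⁻¹ * (1 + |t|) := by gcongr
          _ = (Z + S) * (|t|⁻¹ * (1 + |t|)) := by ring
          _ ≤ (Z + S) * 2 := by gcongr
          _ ≤ _ := by linarith
      · have h1 := hM t (abs_le.1 ht)
        rw [norm_norm] at h1
        calc _ ≤ M * 2 := by gcongr; linarith
          _ ≤ _ := by linarith
    rw [norm_of_nonneg (by positivity), hpow, ← mul_assoc]
    refine (mul_le_mul_of_nonneg_right key hP.le).trans (le_of_eq ?_)
    simp only [Pi.add_apply]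
    ring

/-- The error term of the summatory function, set to `0` below `1`. -/
noncomputable def errorTerm (l : ℕ) (a : ℝ) (A B : ℕ → ℂ) (x : ℝ) : ℂ :=
  if x < 1 then 0 else
    (summatory l a x : ℂ) - (polarTerm 1 4 A x + polarTerm (1 - a) l B x)

lemma errorTerm_of_one_le (l : ℕ) (a : ℝ) (A B : ℕ → ℂ) {x : ℝ} (hx : 1 ≤ x) :
    errorTerm l a A B x =
      (summatory l a x : ℂ) - (polarTerm 1 4 A x + polarTerm (1 - a) l B x) :=
  if_neg (not_lt.2 hx)

lemma measurable_errorTerm (l : ℕ) (a : ℝ) (A B : ℕ → ℂ) : Measurable (errorTerm l a A B) := by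
  refine Measurable.ite measurableSet_Iio measurable_const ?_
  exact (Complex.measurable_ofReal.comp (monotone_summatory l a).measurable).sub
    ((measurable_polarTerm _ _ _).add (measurable_polarTerm _ _ _))

lemma norm_errorTerm_le (l : ℕ) {a : ℝ} (ha : 0 ≤ a) (A B : ℕ → ℂ) :
    ∃ K : ℝ, ∀ x, 1 ≤ x → ‖errorTerm l a A B x‖ ≤ K * x ^ 2 := by
  obtain ⟨K, hK, h⟩ := summatory_le l ha
  refine ⟨K + (∑ j ∈ Finset.range 4, ‖A j‖ + ∑ j ∈ Finset.range l, ‖B j‖), fun x hx => ?_⟩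
  rw [errorTerm_of_one_le l a A B hx]
  have h1 : ‖(summatory l a x : ℂ)‖ ≤ K * x ^ 2 := by
    rw [Complex.norm_real, norm_of_nonneg (summatory_nonneg l a x)]
    exact h x (by linarith)
  refine (norm_sub_le _ _).trans ?_
  linarith [norm_add_le (polarTerm 1 4 A x) (polarTerm (1 - a) l B x),
    norm_polarTerm_le le_rfl 4 A hx, norm_polarTerm_le (by linarith : 1 - a ≤ 1) l B hx]

lemma continuousWithinAt_errorTerm (l : ℕ) (a : ℝ) (A B : ℕ → ℂ) {x : ℝ} (hx : 1 ≤ x) :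
    ContinuousWithinAt (errorTerm l a A B) (Set.Ioi x) x := by
  have hx0 : 0 < x := by linarith
  have h1 : ContinuousWithinAt (fun x => (summatory l a x : ℂ)) (Set.Ioi x) x :=
    Complex.continuous_ofReal.continuousAt.comp_continuousWithinAt
      (continuousWithinAt_summatory l a hx0.le)
  exact (h1.sub ((continuousAt_polarTerm 1 4 A hx0).add
    (continuousAt_polarTerm (1 - a) l B hx0)).continuousWithinAt).congr
    (fun y hy => errorTerm_of_one_le l a A B (hx.trans (le_of_lt hy)))
    (errorTerm_of_one_le l a A B hx)

lemma integral_errorTerm_mul_cpow (l : ℕ) {a : ℝ} (ha : 0 ≤ a) (A B : ℕ → ℂ) {s : ℂ}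
    (hs : 2 < s.re) :
    ∫ x in Set.Ioi (1 : ℝ), errorTerm l a A B x * (x : ℂ) ^ (-(s + 1)) =
      zetaProd l a s / s - (∑ j ∈ Finset.range 4, A j / (s - (1 : ℝ)) ^ (j + 1) +
        ∑ j ∈ Finset.range l, B j / (s - (1 - a : ℝ)) ^ (j + 1)) := by
  obtain ⟨K, hK, h⟩ := summatory_le l ha
  obtain ⟨i1, e1⟩ := integral_polarTerm_mul_cpow 1 4 A (s := s) (by linarith)
  obtain ⟨i2, e2⟩ := integral_polarTerm_mul_cpow (1 - a) l B (s := s) (by linarith)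
  have i0 := integrableOn_mul_cpow (e := fun x => (summatory l a x : ℂ))
    (Complex.measurable_ofReal.comp (monotone_summatory l a).measurable) (K := K) (m := 2)
    (s := s + 1) (fun x hx => by
      rw [Complex.norm_real, norm_of_nonneg (summatory_nonneg l a x)]
      exact h x (by linarith)) (by simp; linarith)
  rw [← integral_summatory_mul_cpow l ha hs, ← e1, ← e2,
    ← MeasureTheory.integral_add' i1 i2, ← MeasureTheory.integral_sub' i0 (i1.add i2)]
  refine MeasureTheory.setIntegral_congr_fun measurableSet_Ioi fun x hx => ?_
  simp only [errorTerm_of_one_le l a A B (le_of_lt hx), Pi.add_apply, Pi.sub_apply]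
  ring

theorem exists_abs_summatory_sub_le (l : ℕ) (hl1 : 1 ≤ l) (hl6 : l ≤ 6) {a : ℝ}
    (ha : 0.440002 ≤ a) (ha2 : a < 1 / 2) : ∃ A B : ℕ → ℂ, ∀ ε : ℝ, 0 < ε →
      ∃ C : ℝ, 0 < C ∧ ∀ X : ℝ, 2 ≤ X → |summatory l a X -
        ((polarTerm 1 4 A X).re + (polarTerm (1 - a) l B X).re)| ≤ C * X ^ (1 / 2 + ε) := by
  have ha0 : 0 < a := by linarith
  have ha1 : a < 1 := by linarith
  obtain ⟨A, B, G, hGd, h⟩ := exists_zetaProd_decomposition l ha0 ha1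
  refine ⟨A, B, fun ε hε => ?_⟩
  have he := measurable_errorTerm l a A B
  obtain ⟨K, hK⟩ := norm_errorTerm_le l ha0.le A B
  have he0 : ∀ x, x < 1 → errorTerm l a A B x = 0 := fun x hx => if_pos hx
  have hei := intervalIntegrable_of_sq_bound he hK he0
  have hG : ∀ s : ℂ, s.re = 3 →
      ∫ x in Set.Ioi (1 : ℝ), errorTerm l a A B x * (x : ℂ) ^ (-(s + 1)) = G s := by
    intro s hs
    rw [integral_errorTerm_mul_cpow l ha0.le A B (by linarith), h s (by linarith)]
    · ring
    · rintro rfl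
      norm_num at hs
    · rintro rfl
      rw [Complex.ofReal_re] at hs
      linarith
  set S := ∑ j ∈ Finset.range 4, ‖A j‖ + ∑ j ∈ Finset.range l, ‖B j‖ with hS
  have hS0 : 0 ≤ S := by positivity
  obtain ⟨C₃, hC₃, h3⟩ := norm_zetaProd_three_le l ha0.le
  have hG3 : ∀ y : ℝ, 1 ≤ |y| → ‖G ((3 : ℝ) + y * Complex.I)‖ ≤ (C₃ + S) * |y|⁻¹ := fun y hy =>
    (norm_regular_part_le h three_pos hy).trans
      (mul_le_mul_of_nonneg_right (add_le_add (h3 y) le_rfl) (by positivity))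
  obtain ⟨C₄, hC₄, h4⟩ := norm_zetaProd_strip_le l hl6 ha0 ha1
  have hG4 : ∀ x y : ℝ, 1 / 2 ≤ x → x ≤ 3 → 1 ≤ |y| →
      ‖G (x + y * Complex.I)‖ ≤ (C₄ + S) * |y| ^ (9 / 10 : ℝ) := by
    intro x y hx1 hx2 hy
    have hy0 : 0 < |y| := by linarith
    have hp : 1 ≤ |y| ^ (19 / 10 : ℝ) := one_le_rpow hy (by norm_num)
    refine (norm_regular_part_le h (by linarith) hy).trans ?_
    rw [← hS]
    calc _ ≤ (C₄ * |y| ^ (19 / 10 : ℝ) + S * |y| ^ (19 / 10 : ℝ)) * |y|⁻¹ := by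
          refine mul_le_mul_of_nonneg_right (add_le_add (h4 x y hx1 hx2 hy) ?_) (by positivity)
          exact le_mul_of_one_le_right hS0 hp
      _ = (C₄ + S) * (|y| ^ (19 / 10 : ℝ) * |y|⁻¹) := by ring
      _ = _ := by
        rw [← rpow_neg_one, ← rpow_add hy0]
        norm_num
  have hGi : ∀ {θ : ℝ}, 0 < θ → MeasureTheory.Integrable fun t : ℝ =>
      ‖G (((1 / 2 : ℝ) : ℂ) + t * Complex.I)‖ * (1 + |t|) ^ (-θ) := fun hθ =>
    integrable_regular_part hl1 hl6 ha ha2 hGd h hθ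
  have hφ := fun (x : ℝ) (hx : 1 ≤ x) => primitive_eq_integral_vertical he hK he0
    (fun x hx => continuousWithinAt_errorTerm l a A B hx)
    (hGd.mono fun s hs => (by norm_num : (0 : ℝ) < 1 / 2).trans_le hs.1) hG hG3
    (by norm_num : (9 / 10 : ℝ) < 1) hG4 (by simpa only [rpow_neg_one] using hGi one_pos) hx
  obtain ⟨C, hC, hu⟩ := norm_integral_unit_le hei hφ (lt_min hε one_pos) (min_le_right ε 1)
    (hGi (lt_min hε one_pos))
  refine abs_sub_le_of_norm_integral_unit_le (e := errorTerm l a A B) (monotone_summatory l a)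
    (M := fun X => (polarTerm 1 4 A X).re + (polarTerm (1 - a) l B X).re) ?_ ?_ hei hε ?_
    ⟨C, hC, fun x hx => (hu x hx).trans ?_⟩
  · intro x hx
    have hx0 : 0 < x := one_pos.trans_le hx
    exact ((Complex.continuous_re.continuousAt.comp (continuousAt_polarTerm 1 4 A hx0)).add
      (Complex.continuous_re.continuousAt.comp
        (continuousAt_polarTerm (1 - a) l B hx0))).continuousWithinAt
  · intro x hx
    simp [errorTerm_of_one_le l a A B hx]
  · obtain ⟨D₁, hD₁, k1⟩ := abs_re_polarTerm_sub_le zero_le_one le_rfl 4 A hε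
    obtain ⟨D₂, hD₂, k2⟩ := abs_re_polarTerm_sub_le (p := 1 - a) (by linarith) (by linarith) l B hε
    refine ⟨D₁ + D₂, by positivity, fun X u hX hu => ?_⟩
    rw [add_sub_add_comm, add_mul]
    exact (abs_add_le _ _).trans (add_le_add (k1 X u hX hu) (k2 X u hX hu))
  · gcongr
    · linarith
    · exact min_le_left _ _

/-- Corollary 2 of Ivić–Zhai, case `ℓ ∈ {5, 6}`: for fixed `a` in the stated range, the
error term `E_{4,ℓ}(X)` in the asymptotic formula for `∑_{n ≤ X} d_{4,ℓ}(n;a)` is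
`≪_ε X^{1/2+ε}`. -/
theorem weighted_divisor_error_l5_l6 (ℓ : ℕ) (hℓ : ℓ = 5 ∨ ℓ = 6)
    (a : ℝ) (ha₁ : 0.440002 ≤ a) (ha₂ : a < 1 / 2) :
    ∃ c : Fin 4 → ℝ, ∃ c' : Fin ℓ → ℝ, ∀ ε : ℝ, 0 < ε → ∃ C : ℝ, 0 < C ∧
      ∀ X : ℝ, 2 ≤ X →
        |(∑ n ∈ Finset.Icc 1 ⌊X⌋₊, dWeighted ℓ a n) -
            X * ∑ k : Fin 4, c k * Real.log X ^ (k : ℕ) -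
            X ^ (1 - a) * ∑ k : Fin ℓ, c' k * Real.log X ^ (k : ℕ)| ≤
          C * X ^ (1 / 2 + ε) := by
  obtain ⟨A, B, h⟩ := exists_abs_summatory_sub_le ℓ (by lia) (by lia) ha₁ ha₂
  refine ⟨fun k => (A k / (k : ℕ).factorial).re, fun k => (B k / (k : ℕ).factorial).re,
    fun ε hε => ?_⟩
  obtain ⟨C, hC, hX⟩ := h ε hε
  refine ⟨C, hC, fun X h2 => ?_⟩
  have := hX X h2
  rwa [re_polarTerm, re_polarTerm, rpow_one, ← sub_sub, summatory, Finset.sum_range,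
    Finset.sum_range] at this
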